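/- Let k > 2 be a fixed real number and let q be a large integer such that every Dirichlet L-function modulo q satisfies the Riemann Hypothesis. Then there is a constant C depending only on k such that for all real y with 10 ≤ y ≤ q, one has ∑_{χ ∈ X_q^*} |∑_{n ≤ y} χ(n)|^{4k−2} ≤ C · y^{2k−1} · φ(q) · (log y)^{4k²}. -/

import Mathlib

open Complex Real Finset

def dirichletRH {q : ℕ} [NeZero q] (χ : DirichletCharacter ℂ q) : Prop :=
  ∀ s : ℂ, 0 < s.re → s.re < 1 → DirichletCharacter.LFunction χ s = 0 → s.re = 1 / 2


/-! ### Part 1: orthogonality and moments -/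

lemma char_conj_eq {q : ℕ} [NeZero q] (χ : DirichletCharacter ℂ q) {a : ZMod q} (ha : IsUnit a) :
    (starRingEnd ℂ) (χ a) = χ a⁻¹ := by
  have h : χ a⁻¹ * χ a = 1 := by
    rw [← map_mul, ZMod.inv_mul_of_unit a ha, map_one]
  obtain ⟨u, rfl⟩ := ha
  have hn : ‖χ u‖ = 1 := DirichletCharacter.unit_norm_eq_one χ u
  have h2 : (starRingEnd ℂ) (χ u) * χ u = 1 := by
    rw [mul_comm, Complex.mul_conj, Complex.normSq_eq_norm_sq, hn]; simp
  have h0 : χ u ≠ 0 := by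
    intro h0; rw [h0] at hn; simp at hn
  exact mul_right_cancel₀ h0 (h2.trans h.symm)

lemma orth_pair {q : ℕ} [NeZero q] (n m : ℕ) (hn : n < q) (hm : m < q) :
    ‖∑ χ : DirichletCharacter ℂ q, χ (n : ZMod q) * (starRingEnd ℂ) (χ (m : ZMod q))‖
      ≤ if n = m then (Nat.totient q : ℝ) else 0 := by
  by_cases hu : IsUnit (m : ZMod q)
  · have : ∑ χ : DirichletCharacter ℂ q, χ (n : ZMod q) * (starRingEnd ℂ) (χ (m : ZMod q))
        = ∑ χ : DirichletCharacter ℂ q, χ (m : ZMod q)⁻¹ * χ (n : ZMod q) := by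
      refine Finset.sum_congr rfl fun χ _ => ?_
      rw [char_conj_eq χ hu, mul_comm]
    rw [this, DirichletCharacter.sum_char_inv_mul_char_eq ℂ hu]
    have hiff : ((m : ZMod q) = (n : ZMod q)) ↔ n = m := by
      rw [ZMod.natCast_eq_natCast_iff']
      rw [Nat.mod_eq_of_lt hn, Nat.mod_eq_of_lt hm]; exact eq_comm
    by_cases h : n = m
    · simp [h]
    · simp [h, hiff.not.mpr h]
  · have : ∑ χ : DirichletCharacter ℂ q, χ (n : ZMod q) * (starRingEnd ℂ) (χ (m : ZMod q)) = 0 := by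
      refine Finset.sum_eq_zero fun χ _ => ?_
      rw [MulChar.map_nonunit χ hu]; simp
    rw [this, norm_zero]
    split_ifs <;> positivity

lemma orth_base {q : ℕ} [NeZero q] {ι : Type*} (I : Finset ι) (g : ι → ℕ) (b : ι → ℂ)
    (hg : ∀ i ∈ I, g i < q) :
    ∑ χ : DirichletCharacter ℂ q, ‖∑ i ∈ I, b i * χ (g i : ZMod q)‖ ^ 2
      ≤ Nat.totient q * ∑ i ∈ I, ∑ j ∈ I with g j = g i, ‖b i‖ * ‖b j‖ := by
  have h1 : ((∑ χ : DirichletCharacter ℂ q, ‖∑ i ∈ I, b i * χ (g i : ZMod q)‖ ^ 2 : ℝ) : ℂ)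
      = ∑ i ∈ I, ∑ j ∈ I, b i * (starRingEnd ℂ) (b j) *
        ∑ χ : DirichletCharacter ℂ q, χ (g i : ZMod q) * (starRingEnd ℂ) (χ (g j : ZMod q)) := by
    push_cast
    have : ∀ χ : DirichletCharacter ℂ q, ((‖∑ i ∈ I, b i * χ (g i : ZMod q)‖ : ℂ)) ^ 2
        = ∑ i ∈ I, ∑ j ∈ I, b i * (starRingEnd ℂ) (b j) *
          (χ (g i : ZMod q) * (starRingEnd ℂ) (χ (g j : ZMod q))) := by
      intro χ
      rw [← Complex.mul_conj', map_sum, Finset.sum_mul_sum]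
      refine Finset.sum_congr rfl fun i _ => Finset.sum_congr rfl fun j _ => ?_
      rw [map_mul]; ring
    rw [Finset.sum_congr rfl fun χ _ => this χ, Finset.sum_comm]
    refine Finset.sum_congr rfl fun i _ => ?_
    rw [Finset.sum_comm]
    refine Finset.sum_congr rfl fun j _ => ?_
    rw [Finset.mul_sum]
  have h2 : (∑ χ : DirichletCharacter ℂ q, ‖∑ i ∈ I, b i * χ (g i : ZMod q)‖ ^ 2 : ℝ)
      = ‖((∑ χ : DirichletCharacter ℂ q, ‖∑ i ∈ I, b i * χ (g i : ZMod q)‖ ^ 2 : ℝ) : ℂ)‖ := by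
    rw [Complex.norm_real, Real.norm_of_nonneg]
    positivity
  rw [h2, h1, Finset.mul_sum]
  refine (norm_sum_le _ _).trans (Finset.sum_le_sum fun i hi => ?_)
  rw [Finset.mul_sum, Finset.sum_filter]
  refine (norm_sum_le _ _).trans (Finset.sum_le_sum fun j hj => ?_)
  rw [norm_mul, norm_mul, RCLike.norm_conj]
  have := orth_pair (q := q) (g i) (g j) (hg i hi) (hg j hj)
  by_cases h : g j = g i
  · rw [if_pos h.symm] at this
    rw [if_pos h]
    calc _ ≤ ‖b i‖ * ‖b j‖ * (Nat.totient q : ℝ) := by gcongr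
      _ = _ := by ring
  · rw [if_neg (Ne.symm h)] at this
    rw [if_neg h]
    have h0 := le_antisymm this (norm_nonneg _)
    rw [h0]; simp

lemma orth_fiber {q : ℕ} [NeZero q] {ι : Type*} (I : Finset ι) (g : ι → ℕ) (b : ι → ℂ) (D : ℕ)
    (hg : ∀ i ∈ I, g i < q) (hD : ∀ i ∈ I, #{j ∈ I | g j = g i} ≤ D) :
    ∑ χ : DirichletCharacter ℂ q, ‖∑ i ∈ I, b i * χ (g i : ZMod q)‖ ^ 2
      ≤ Nat.totient q * (D * ∑ i ∈ I, ‖b i‖ ^ 2) := by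
  refine (orth_base I g b hg).trans ?_
  gcongr
  have h1 : ∑ i ∈ I, ∑ j ∈ I with g j = g i, ‖b i‖ * ‖b j‖
      ≤ ∑ i ∈ I, ∑ j ∈ I with g j = g i, (‖b i‖ ^ 2 / 2 + ‖b j‖ ^ 2 / 2) := by
    gcongr with i hi j hj
    nlinarith [sq_nonneg (‖b i‖ - ‖b j‖)]
  have h2 : ∑ i ∈ I, ∑ j ∈ I with g j = g i, (‖b i‖ ^ 2 / 2 + ‖b j‖ ^ 2 / 2)
      = ∑ i ∈ I, ∑ j ∈ I with g j = g i, ‖b i‖ ^ 2 := by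
    simp only [Finset.sum_add_distrib]
    have : ∑ i ∈ I, ∑ j ∈ I with g j = g i, ‖b j‖ ^ 2 / 2
        = ∑ i ∈ I, ∑ j ∈ I with g j = g i, ‖b i‖ ^ 2 / 2 := by
      simp only [Finset.sum_filter]
      rw [Finset.sum_comm]
      refine Finset.sum_congr rfl fun i _ => Finset.sum_congr rfl fun j _ => ?_
      simp only [eq_comm]
    rw [this, ← Finset.sum_add_distrib]
    refine Finset.sum_congr rfl fun i _ => ?_
    rw [← Finset.sum_add_distrib]
    refine Finset.sum_congr rfl fun j _ => ?_
    ring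
  rw [h2] at h1
  refine h1.trans ?_
  rw [Finset.mul_sum]
  refine Finset.sum_le_sum fun i hi => ?_
  rw [Finset.sum_const, nsmul_eq_mul]
  gcongr
  exact hD i hi

/-- tuples of primes with the same product are permutations of each other -/
lemma prime_tuple_fiber (l : ℕ) (P : Finset ℕ) (hP : ∀ p ∈ P, p.Prime) (e : ℕ) (he : e ≠ 0)
    (i : Fin l → ℕ) (hi : i ∈ Fintype.piFinset (fun _ : Fin l => P)) :
    #{j ∈ Fintype.piFinset (fun _ : Fin l => P) | ∏ r, j r ^ e = ∏ r, i r ^ e} ≤ l.factorial := by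
  classical
  have : {j ∈ Fintype.piFinset (fun _ : Fin l => P) | ∏ r, j r ^ e = ∏ r, i r ^ e}
      ⊆ Finset.image (fun σ : Equiv.Perm (Fin l) => i ∘ σ) Finset.univ := by
    intro j hj
    rw [Finset.mem_filter, Fintype.mem_piFinset] at hj
    rw [Fintype.mem_piFinset] at hi
    obtain ⟨hj, hprod⟩ := hj
    rw [Finset.prod_pow, Finset.prod_pow] at hprod
    have hprod := Nat.pow_left_injective he hprod
    have hpi : ∀ x ∈ List.ofFn i, Nat.Prime x := by
      intro x hx
      rw [List.mem_ofFn] at hx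
      obtain ⟨r, rfl⟩ := hx
      exact hP _ (hi r)
    have hpj : ∀ x ∈ List.ofFn j, Nat.Prime x := by
      intro x hx
      rw [List.mem_ofFn] at hx
      obtain ⟨r, rfl⟩ := hx
      exact hP _ (hj r)
    have e1 : (List.ofFn i).prod = ∏ r, i r := by rw [List.prod_ofFn]
    have e2 : (List.ofFn j).prod = ∏ r, i r := by rw [List.prod_ofFn, hprod]
    have hperm : (List.ofFn j).Perm (List.ofFn i) :=
      (Nat.primeFactorsList_unique e2 hpj).trans (Nat.primeFactorsList_unique e1 hpi).symm
    have hp2 : (List.ofFn (j ∘ Tuple.sort j)).Perm (List.ofFn (i ∘ Tuple.sort i)) :=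
      ((Tuple.sort j).ofFn_comp_perm j).trans (hperm.trans ((Tuple.sort i).ofFn_comp_perm i).symm)
    have heq := hp2.eq_of_pairwise' (Tuple.monotone_sort j).sortedLE_ofFn.pairwise
      (Tuple.monotone_sort i).sortedLE_ofFn.pairwise
    have heq := List.ofFn_injective heq
    rw [Finset.mem_image]
    refine ⟨(Tuple.sort j).symm.trans (Tuple.sort i), Finset.mem_univ _, ?_⟩
    funext r
    have := congrFun heq ((Tuple.sort j).symm r)
    simp at this
    simp [this]
  refine (Finset.card_le_card this).trans (Finset.card_image_le.trans ?_)
  rw [Finset.card_univ, Fintype.card_perm, Fintype.card_fin]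

/-- moments of prime sums -/
lemma prime_moment {q : ℕ} [NeZero q] (l : ℕ) (P : Finset ℕ) (hP : ∀ p ∈ P, p.Prime)
    (e : ℕ) (he : e ≠ 0) (a : ℕ → ℂ) (X : ℝ) (hX : ∀ p ∈ P, (p : ℝ) ^ e ≤ X) (hXq : X ^ l < q) :
    ∑ χ : DirichletCharacter ℂ q, ‖∑ p ∈ P, a p * χ ((p ^ e : ℕ) : ZMod q)‖ ^ (2 * l)
      ≤ Nat.totient q * (l.factorial * (∑ p ∈ P, ‖a p‖ ^ 2) ^ l) := by
  classical
  have key : ∀ χ : DirichletCharacter ℂ q,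
      ‖∑ p ∈ P, a p * χ ((p ^ e : ℕ) : ZMod q)‖ ^ (2 * l)
      = ‖∑ i ∈ Fintype.piFinset (fun _ : Fin l => P),
          (∏ r, a (i r)) * χ ((∏ r, i r ^ e : ℕ) : ZMod q)‖ ^ 2 := by
    intro χ
    rw [mul_comm, pow_mul, ← norm_pow]
    congr 2
    have := Finset.prod_univ_sum (fun _ : Fin l => P)
      (fun _ p => a p * χ ((p ^ e : ℕ) : ZMod q))
    rw [Finset.prod_const, Finset.card_univ, Fintype.card_fin] at this
    rw [this]
    refine Finset.sum_congr rfl fun i _ => ?_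
    rw [Finset.prod_mul_distrib]
    congr 1
    push_cast
    rw [map_prod]
  rw [Finset.sum_congr rfl fun χ _ => key χ]
  have hm := orth_fiber (q := q) (Fintype.piFinset (fun _ : Fin l => P))
    (fun i => ∏ r, i r ^ e) (fun i => ∏ r, a (i r)) l.factorial ?_ ?_
  · refine hm.trans (le_of_eq ?_)
    congr 2
    have := Finset.prod_univ_sum (fun _ : Fin l => P) (fun _ p => ‖a p‖ ^ 2)
    rw [Finset.prod_const, Finset.card_univ, Fintype.card_fin] at this
    rw [this]
    refine Finset.sum_congr rfl fun i _ => ?_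
    rw [norm_prod, Finset.prod_pow]
  · intro i hi
    rw [Fintype.mem_piFinset] at hi
    have h1 : ((∏ r, i r ^ e : ℕ) : ℝ) ≤ X ^ l := by
      push_cast
      calc ∏ r, (i r : ℝ) ^ e ≤ ∏ r : Fin l, X :=
            Finset.prod_le_prod (fun r _ => by positivity) (fun r _ => hX _ (hi r))
        _ = X ^ l := by simp
    exact_mod_cast h1.trans_lt hXq
  · intro i hi
    exact prime_tuple_fiber l P hP e he i hi

/-- `k`-fold divisor function -/
def dk : ℕ → ℕ → ℕ
  | 0, n => if n = 1 then 1 else 0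
  | (k + 1), n => ∑ e ∈ n.divisors, dk k (n / e)

lemma dk_submul (k : ℕ) : ∀ a b : ℕ, dk k (a * b) ≤ dk k a * dk k b := by
  induction k with
  | zero =>
    intro a b
    simp only [dk]
    by_cases h : a * b = 1
    · have := mul_eq_one.mp h
      simp [this.1, this.2]
    · simp [h]
  | succ k ih =>
    intro a b
    by_cases ha : a = 0
    · simp [ha, dk]
    by_cases hb : b = 0
    · simp [hb, dk]
    simp only [dk]
    rw [Finset.sum_mul_sum, ← Finset.sum_product']
    have hsub : (a * b).divisors ⊆ (a.divisors ×ˢ b.divisors).image (fun x => x.1 * x.2) := by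
      intro e he
      rw [Nat.mem_divisors] at he
      obtain ⟨d1, d2, h1, h2, h3⟩ := exists_dvd_and_dvd_of_dvd_mul he.1
      rw [Finset.mem_image]
      exact ⟨(d1, d2), by simp [h1, h2, ha, hb], h3.symm⟩
    calc ∑ e ∈ (a * b).divisors, dk k (a * b / e)
        ≤ ∑ e ∈ (a.divisors ×ˢ b.divisors).image (fun x => x.1 * x.2), dk k (a * b / e) :=
          Finset.sum_le_sum_of_subset hsub
      _ ≤ ∑ x ∈ a.divisors ×ˢ b.divisors, dk k (a * b / (x.1 * x.2)) :=
          Finset.sum_image_le_of_nonneg (fun _ _ => Nat.zero_le _)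
      _ ≤ _ := by
          refine Finset.sum_le_sum fun x hx => ?_
          rw [Finset.mem_product, Nat.mem_divisors, Nat.mem_divisors] at hx
          rw [← Nat.div_mul_div_comm hx.1.1 hx.2.1]
          exact ih _ _

lemma dk_count (k : ℕ) (N : ℕ) : ∀ n : ℕ, 
    #{j ∈ Fintype.piFinset (fun _ : Fin k => Finset.Icc 1 N) | ∏ r, j r = n} ≤ dk k n := by
  induction k with
  | zero =>
    intro n
    simp only [dk]
    by_cases h : n = 1
    · simp [h]
    · simp [h, Ne.symm h]
  | succ k ih =>
    intro n
    by_cases hn : n = 0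
    · rw [Finset.filter_false_of_mem]
      · simp
      · intro j hj
        rw [Fintype.mem_piFinset] at hj
        rw [hn, Finset.prod_eq_zero_iff]
        rintro ⟨r, _, hr⟩
        have := Finset.mem_Icc.mp (hj r)
        omega
    simp only [dk]
    have : {j ∈ Fintype.piFinset (fun _ : Fin (k+1) => Finset.Icc 1 N) | ∏ r, j r = n}
        ⊆ n.divisors.biUnion (fun e =>
          ({j ∈ Fintype.piFinset (fun _ : Fin k => Finset.Icc 1 N) | ∏ r, j r = n / e}).image
            (fun j => (Fin.cons e j : Fin (k+1) → ℕ))) := by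
      intro j hj
      rw [Finset.mem_filter, Fintype.mem_piFinset] at hj
      obtain ⟨hj, hp⟩ := hj
      rw [Fin.prod_univ_succ] at hp
      rw [Finset.mem_biUnion]
      have h0 := Finset.mem_Icc.mp (hj 0)
      refine ⟨j 0, ?_, ?_⟩
      · rw [Nat.mem_divisors]; exact ⟨⟨_, hp.symm⟩, hn⟩
      · rw [Finset.mem_image]
        refine ⟨Fin.tail j, ?_, Fin.cons_self_tail j⟩
        rw [Finset.mem_filter, Fintype.mem_piFinset]
        refine ⟨fun r => hj r.succ, ?_⟩
        rw [← hp, Nat.mul_div_cancel_left _ (by omega)]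
        rfl
    refine (Finset.card_le_card this).trans (Finset.card_biUnion_le.trans ?_)
    exact Finset.sum_le_sum fun e _ => Finset.card_image_le.trans (ih _)

lemma dk_sum (k : ℕ) : ∀ N : ℕ, (∑ n ∈ Finset.Icc 1 N, (dk k n : ℝ)) ≤ N * (1 + Real.log N) ^ k := by
  induction k with
  | zero =>
    intro N
    simp only [dk, pow_zero, mul_one]
    rcases Nat.eq_zero_or_pos N with h | h
    · simp [h]
    · push_cast
      rw [Finset.sum_ite_eq' (Finset.Icc 1 N) 1]
      have : (1:ℝ) ≤ N := by exact_mod_cast h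
      split_ifs <;> linarith
  | succ k ih =>
    intro N
    rcases Nat.eq_zero_or_pos N with hN | hN
    · simp [hN]
    have h1 : (∑ n ∈ Finset.Icc 1 N, (dk (k+1) n : ℝ))
        ≤ ∑ e ∈ Finset.Icc 1 N, ∑ f ∈ Finset.Icc 1 (N / e), (dk k f : ℝ) := by
      simp only [dk]
      push_cast
      rw [Finset.sum_sigma', Finset.sum_sigma']
      refine le_of_eq (Finset.sum_bij' (fun x _ => ⟨x.2, x.1 / x.2⟩) (fun x _ => ⟨x.1 * x.2, x.1⟩)
        ?_ ?_ ?_ ?_ ?_)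
      · rintro ⟨n, e⟩ h
        simp only [Finset.mem_sigma, Finset.mem_Icc, Nat.mem_divisors] at h ⊢
        have he : 0 < e := Nat.pos_of_dvd_of_pos h.2.1 (by omega)
        have := Nat.le_of_dvd (by omega) h.2.1
        refine ⟨⟨he, by omega⟩, Nat.div_pos this he, Nat.div_le_div_right h.1.2⟩
      · rintro ⟨e, f⟩ h
        simp only [Finset.mem_sigma, Finset.mem_Icc, Nat.mem_divisors] at h ⊢
        have h3 := (Nat.le_div_iff_mul_le (by omega)).mp h.2.2
        refine ⟨⟨Nat.mul_pos (by omega) (by omega), by rw [mul_comm]; exact h3⟩, Dvd.intro _ rfl, ?_⟩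
        exact Nat.mul_ne_zero (by omega) (by omega)
      · rintro ⟨n, e⟩ h
        simp only [Finset.mem_sigma, Finset.mem_Icc, Nat.mem_divisors] at h ⊢
        simp [Nat.mul_div_cancel' h.2.1]
      · rintro ⟨e, f⟩ h
        simp only [Finset.mem_sigma, Finset.mem_Icc] at h ⊢
        simp [Nat.mul_div_cancel_left f (show 0 < e by omega)]
      · rintro ⟨n, e⟩ h
        rfl
    have hL : 0 ≤ Real.log N := Real.log_natCast_nonneg N
    calc _ ≤ _ := h1
      _ ≤ ∑ e ∈ Finset.Icc 1 N, ((N : ℝ) * (1 + Real.log N) ^ k) * ((e : ℝ))⁻¹ := by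
          refine Finset.sum_le_sum fun e he => (ih _).trans ?_
          rw [Finset.mem_Icc] at he
          have h2 : ((N / e : ℕ) : ℝ) ≤ N / e := Nat.cast_div_le
          have h3 : Real.log ((N / e : ℕ) : ℝ) ≤ Real.log N := by
            rcases Nat.eq_zero_or_pos (N / e) with h | h
            · rw [h]; simpa using hL
            · apply Real.log_le_log (by exact_mod_cast h)
              exact_mod_cast Nat.div_le_self N e
          have h4 : 0 ≤ Real.log ((N / e : ℕ) : ℝ) := Real.log_natCast_nonneg _
          calc ((N / e : ℕ) : ℝ) * (1 + Real.log ((N / e : ℕ) : ℝ)) ^ k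
              ≤ (N / e) * (1 + Real.log N) ^ k := by gcongr
            _ = _ := by rw [div_eq_mul_inv]; ring
      _ = ((N : ℝ) * (1 + Real.log N) ^ k) * (harmonic N : ℝ) := by
          rw [← Finset.mul_sum, harmonic_eq_sum_Icc]; push_cast; rfl
      _ ≤ ((N : ℝ) * (1 + Real.log N) ^ k) * (1 + Real.log N) := by
          gcongr; exact harmonic_le_one_add_log N
      _ = _ := by ring

lemma low_moment {q : ℕ} [NeZero q] (M N : ℕ) (hN : N ^ M < q) :
    ∑ χ : DirichletCharacter ℂ q, ‖∑ n ∈ Finset.Icc 1 N, χ (n : ZMod q)‖ ^ (2 * M)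
      ≤ Nat.totient q * ((N : ℝ) * (1 + Real.log N) ^ M) ^ M := by
  classical
  have key : ∀ χ : DirichletCharacter ℂ q,
      ‖∑ n ∈ Finset.Icc 1 N, χ (n : ZMod q)‖ ^ (2 * M)
      = ‖∑ i ∈ Fintype.piFinset (fun _ : Fin M => Finset.Icc 1 N),
          (fun _ => (1:ℂ)) i * χ ((∏ r, i r : ℕ) : ZMod q)‖ ^ 2 := by
    intro χ
    rw [mul_comm, pow_mul, ← norm_pow]
    congr 2
    have := Finset.prod_univ_sum (fun _ : Fin M => Finset.Icc 1 N)
      (fun _ n => χ (n : ZMod q))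
    rw [Finset.prod_const, Finset.card_univ, Fintype.card_fin] at this
    rw [this]
    refine Finset.sum_congr rfl fun i _ => ?_
    push_cast
    rw [map_prod, one_mul]
  rw [Finset.sum_congr rfl fun χ _ => key χ]
  have hm := orth_base (q := q) (Fintype.piFinset (fun _ : Fin M => Finset.Icc 1 N))
    (fun i => ∏ r, i r) (fun _ => 1) ?_
  · refine hm.trans ?_
    gcongr
    calc ∑ i ∈ Fintype.piFinset (fun _ : Fin M => Finset.Icc 1 N),
          ∑ j ∈ Fintype.piFinset (fun _ : Fin M => Finset.Icc 1 N) with ∏ r, j r = ∏ r, i r,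
            ‖(1:ℂ)‖ * ‖(1:ℂ)‖
        ≤ ∑ i ∈ Fintype.piFinset (fun _ : Fin M => Finset.Icc 1 N), ∏ r, (dk M (i r) : ℝ) := by
          refine Finset.sum_le_sum fun i _ => ?_
          simp only [norm_one, mul_one, Finset.sum_const, nsmul_eq_mul]
          have h1 := dk_count M N (∏ r, i r)
          have h2 : ∀ s : Finset (Fin M), dk M (∏ r ∈ s, i r) ≤ ∏ r ∈ s, dk M (i r) := by
            intro s
            induction s using Finset.induction_on with
            | empty =>
              simp only [Finset.prod_empty]
              have : ∀ k, dk k 1 = 1 := by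
                intro k
                induction k with
                | zero => simp [dk]
                | succ k ih => simp [dk, ih]
              rw [this]
            | insert a s ha ih =>
              rw [Finset.prod_insert ha, Finset.prod_insert ha]
              exact (dk_submul _ _ _).trans (Nat.mul_le_mul_left _ ih)
          exact_mod_cast h1.trans (h2 Finset.univ)
      _ = (∑ n ∈ Finset.Icc 1 N, (dk M n : ℝ)) ^ M := by
          have := Finset.prod_univ_sum (fun _ : Fin M => Finset.Icc 1 N) (fun _ n => (dk M n : ℝ))
          rw [Finset.prod_const, Finset.card_univ, Fintype.card_fin] at this
          rw [this]
      _ ≤ _ := by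
          gcongr
          exact dk_sum M N
  · intro i hi
    rw [Fintype.mem_piFinset] at hi
    refine lt_of_le_of_lt ?_ hN
    calc ∏ r, i r ≤ ∏ r : Fin M, N := Finset.prod_le_prod' fun r _ => (Finset.mem_Icc.mp (hi r)).2
      _ = N ^ M := by simp



/-! ### Part 3a : the trivial bound for L -/

lemma char_range_sum {q : ℕ} [NeZero q] {χ : DirichletCharacter ℂ q} (hχ : χ ≠ 1) :
    ∑ k ∈ range q, χ (k : ZMod q) = 0 := by
  rw [← MulChar.sum_eq_zero_of_ne_one hχ]
  refine Finset.sum_bij (fun k _ => (k : ZMod q)) (fun _ _ => Finset.mem_univ _) ?_ ?_ ?_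
  · intro a ha b hb hab
    have := (ZMod.natCast_eq_natCast_iff a b q).mp hab
    exact Nat.ModEq.eq_of_lt_of_lt this (Finset.mem_range.mp ha) (Finset.mem_range.mp hb)
  · intro b _
    exact ⟨b.val, Finset.mem_range.mpr (ZMod.val_lt b), by simp⟩
  · intro a _
    rfl

lemma char_sum_bound {q : ℕ} [NeZero q] {χ : DirichletCharacter ℂ q} (hχ : χ ≠ 1) (n : ℕ) :
    ‖∑ k ∈ Finset.Icc 1 n, χ (k : ZMod q)‖ ≤ q := by
  have h1 : ∀ m r : ℕ, ∑ k ∈ range (q * m + r), χ (k : ZMod q) = ∑ k ∈ range r, χ (k : ZMod q) := by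
    intro m
    induction m with
    | zero => intro r; simp
    | succ m ih =>
      intro r
      rw [show q * (m + 1) + r = q + (q * m + r) by ring, Finset.sum_range_add, char_range_sum hχ,
        zero_add, ← ih r]
      refine Finset.sum_congr rfl fun k _ => ?_
      simp
  have hq1 : q ≠ 1 := by
    rintro rfl
    exact hχ (Subsingleton.elim _ _)
  have h0 : χ 0 = 0 := by
    apply MulChar.map_nonunit
    intro h
    have : Subsingleton (ZMod q) := by
      rw [isUnit_zero_iff] at h
      exact subsingleton_of_zero_eq_one h
    rw [ZMod.subsingleton_iff] at this
    exact hq1 this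
  have h2 : ∑ k ∈ Finset.Icc 1 n, χ (k : ZMod q) = ∑ k ∈ range (n + 1), χ (k : ZMod q) := by
    have hI : Finset.Icc 1 n = Finset.Ico 1 (n + 1) := by ext; simp
    rw [Finset.sum_range_succ', hI, Finset.sum_Ico_eq_sum_range]
    simp [h0, add_comm]
  rw [h2, ← Nat.div_add_mod (n + 1) q, h1]
  calc ‖∑ k ∈ range ((n + 1) % q), χ (k : ZMod q)‖ ≤ ∑ k ∈ range ((n + 1) % q), 1 :=
        norm_sum_le_of_le _ fun k _ => χ.norm_le_one _
    _ = (((n + 1) % q : ℕ) : ℝ) := by simp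
    _ ≤ q := by exact_mod_cast (Nat.mod_lt _ (NeZero.pos q)).le

open MeasureTheory Filter Topology in
lemma L_bound {q : ℕ} [NeZero q] {χ : DirichletCharacter ℂ q} (hχ : χ ≠ 1) {s : ℂ}
    (hs : 0 < s.re) : ‖DirichletCharacter.LFunction χ s‖ ≤ q * ‖s‖ / s.re := by
  set S : ℝ → ℂ := fun t => ∑ k ∈ Finset.Icc 1 ⌊t⌋₊, χ (k : ZMod q) with hS
  have hSb : ∀ t, ‖S t‖ ≤ q := fun t => char_sum_bound hχ _
  have hS0 : ∀ t < 1, S t = 0 := by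
    intro t ht
    have : ⌊t⌋₊ = 0 := Nat.floor_eq_zero.mpr ht
    simp [hS, this]
  have hSm : Measurable S := by
    have : S = (fun n : ℕ => ∑ k ∈ Finset.Icc 1 n, χ (k : ZMod q)) ∘ fun t : ℝ => ⌊t⌋₊ := rfl
    rw [this]
    exact (measurable_from_top).comp Nat.measurable_floor
  have hloc : LocallyIntegrable S := by
    intro x
    refine ⟨Set.Icc (x-1) (x+1), Icc_mem_nhds (by linarith) (by linarith), ?_⟩
    refine Measure.integrableOn_of_bounded (M := q) ?_ hSm.aestronglyMeasurable ?_
    · simp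
    · exact ae_of_all _ hSb
  have htop : S =O[atTop] (fun t : ℝ => t ^ (-(0:ℝ))) := by
    refine Asymptotics.IsBigO.of_bound q ?_
    refine Eventually.of_forall fun t => ?_
    simpa using hSb t
  have hbot : ∀ b : ℝ, S =O[𝓝[>] 0] (fun t : ℝ => t ^ (-b)) := by
    intro b
    refine Asymptotics.IsBigO.of_bound 0 ?_
    have : Set.Iio (1:ℝ) ∈ 𝓝[>] (0:ℝ) := mem_nhdsWithin_of_mem_nhds (Iio_mem_nhds (by norm_num))
    filter_upwards [this] with t ht
    simp [hS0 t ht]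
  have hdiff : ∀ z : ℂ, 0 < z.re → DifferentiableAt ℂ (fun z => z * mellin S (-z)) z := by
    intro z hz
    have h1 : DifferentiableAt ℂ (mellin S) (-z) :=
      mellin_differentiableAt_of_isBigO_rpow (a := 0) (b := -z.re - 1)
        (hloc.locallyIntegrableOn _) htop (by simpa using hz) (hbot _) (by simp)
    exact differentiableAt_id.mul (h1.comp z differentiableAt_id.neg)
  have hmell : ∀ z : ℂ, mellin S (-z) = ∫ t in Set.Ioi (1:ℝ), S t * (t:ℂ) ^ (-(z + 1)) := by
    intro z
    rw [mellin, ← integral_indicator measurableSet_Ioi, ← integral_indicator measurableSet_Ioi]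
    have hae : ∀ᵐ t : ℝ, t ≠ 1 := by
      simp [ae_iff, measure_singleton]
    refine integral_congr_ae ?_
    filter_upwards [hae] with t ht
    by_cases h1 : 1 < t
    · have h0 : 0 < t := by linarith
      simp only [Set.indicator, Set.mem_Ioi, h1, h0, if_true, smul_eq_mul]
      rw [mul_comm]; congr 2; ring
    · have : S t = 0 := hS0 t (lt_of_le_of_ne (not_lt.mp h1) ht)
      simp [Set.indicator, this]
  have hEq : ∀ z : ℂ, 1 < z.re → DirichletCharacter.LFunction χ z = z * mellin S (-z) := by
    intro z hz
    rw [DirichletCharacter.LFunction_eq_LSeries χ hz, hmell]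
    refine LSeries_eq_mul_integral (fun n : ℕ => χ (n : ZMod q)) (r := 0) le_rfl (by linarith)
      (ZMod.LSeriesSummable_of_one_lt_re _ hz) ?_
    refine Asymptotics.IsBigO.of_bound q ?_
    refine Eventually.of_forall fun n => ?_
    simpa using char_sum_bound hχ n
  have hU : IsOpen {z : ℂ | 0 < z.re} := isOpen_lt continuous_const Complex.continuous_re
  have hEqOn : Set.EqOn (DirichletCharacter.LFunction χ) (fun z => z * mellin S (-z))
      {z : ℂ | 0 < z.re} := by
    refine AnalyticOnNhd.eqOn_of_preconnected_of_eventuallyEq (𝕜 := ℂ) (z₀ := 2) ?_ ?_ ?_ ?_ ?_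
    · exact ((DirichletCharacter.differentiable_LFunction hχ).differentiableOn).analyticOnNhd hU
    · refine DifferentiableOn.analyticOnNhd (fun z hz => ?_) hU
      exact (hdiff z hz).differentiableWithinAt
    · exact (convex_halfSpace_re_gt 0).isPreconnected
    · simp
    · have : {z : ℂ | 1 < z.re} ∈ 𝓝 (2:ℂ) :=
        (isOpen_lt continuous_const Complex.continuous_re).mem_nhds (by simp)
      filter_upwards [this] with z hz using hEq z hz
  rw [hEqOn hs]
  simp only
  rw [norm_mul, hmell, mul_comm (q:ℝ), mul_div_assoc]
  gcongr
  have hi := integral_Ioi_rpow_of_lt (a := -(s.re + 1)) (by linarith) (c := 1) one_pos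
  have hii := integrableOn_Ioi_rpow_of_lt (a := -(s.re + 1)) (by linarith) (c := 1) one_pos
  calc ‖∫ t in Set.Ioi (1:ℝ), S t * (t:ℂ) ^ (-(s + 1))‖
      ≤ ∫ t in Set.Ioi (1:ℝ), q * t ^ (-(s.re + 1)) := by
        refine norm_integral_le_of_norm_le (hii.const_mul _) ?_
        refine (ae_restrict_iff' measurableSet_Ioi).mpr (ae_of_all _ fun t ht => ?_)
        rw [norm_mul, Complex.norm_cpow_eq_rpow_re_of_pos (by linarith [Set.mem_Ioi.mp ht])]
        have : (-(s + 1)).re = -(s.re + 1) := by simp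
        rw [this]
        gcongr
        · exact Real.rpow_nonneg (by linarith [Set.mem_Ioi.mp ht]) _
        · exact hSb t
    _ = q / s.re := by
        rw [integral_const_mul, hi]
        have : -(s.re+1)+1 = -s.re := by ring
        rw [this]; simp; field_simp


/-! ### Part 3b : the logarithm of L -/

lemma L_ne_zero {q : ℕ} [NeZero q] {χ : DirichletCharacter ℂ q} (hχ : χ ≠ 1)
    (hRH : dirichletRH χ) {s : ℂ} (hs : 1 / 2 < s.re) : DirichletCharacter.LFunction χ s ≠ 0 := by
  intro h
  by_cases h1 : s.re < 1
  · have := hRH s (by linarith) h1 h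
    linarith
  · exact DirichletCharacter.LFunction_ne_zero_of_one_le_re χ (Or.inl hχ) (not_lt.mp h1) h

/-- coefficients of `log L` -/
noncomputable def bc {q : ℕ} (χ : DirichletCharacter ℂ q) (n : ℕ) : ℂ :=
  ((ArithmeticFunction.vonMangoldt n / Real.log n : ℝ) : ℂ) * χ (n : ZMod q)

lemma norm_bc_le {q : ℕ} (χ : DirichletCharacter ℂ q) (n : ℕ) : ‖bc χ n‖ ≤ 1 := by
  rw [bc, norm_mul, Complex.norm_real, Real.norm_eq_abs]
  have h0 : (0:ℝ) ≤ Real.log n := Real.log_natCast_nonneg n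
  have h1 : |ArithmeticFunction.vonMangoldt n / Real.log n| ≤ 1 := by
    rw [abs_of_nonneg (div_nonneg ArithmeticFunction.vonMangoldt_nonneg h0)]
    exact div_le_one_of_le₀ ArithmeticFunction.vonMangoldt_le_log h0
  calc _ ≤ (1:ℝ) * 1 := by gcongr; exact χ.norm_le_one _
    _ = 1 := one_mul 1

lemma bc_abscissa {q : ℕ} (χ : DirichletCharacter ℂ q) :
    LSeries.abscissaOfAbsConv (bc χ) ≤ 1 :=
  LSeries.abscissaOfAbsConv_le_of_le_const ⟨1, fun n _ => norm_bc_le χ n⟩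

lemma bc_log {q : ℕ} (χ : DirichletCharacter ℂ q) (n : ℕ) :
    LSeries.logMul (bc χ) n = χ (n : ZMod q) * (ArithmeticFunction.vonMangoldt n : ℂ) := by
  rw [LSeries.logMul, bc, ← Complex.natCast_log]
  by_cases h : Real.log n = 0
  · have : ArithmeticFunction.vonMangoldt n = 0 :=
      le_antisymm (h ▸ ArithmeticFunction.vonMangoldt_le_log) ArithmeticFunction.vonMangoldt_nonneg
    simp [this]
  · rw [← mul_assoc, ← Complex.ofReal_mul, mul_div_cancel₀ _ h, mul_comm]

def IsLogL {q : ℕ} [NeZero q] (χ : DirichletCharacter ℂ q) (G : ℂ → ℂ) : Prop :=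
  DifferentiableOn ℂ G {s | 1 / 2 < s.re} ∧
  (∀ s : ℂ, 1 / 2 < s.re → Complex.exp (G s) = DirichletCharacter.LFunction χ s) ∧
  ∀ s : ℂ, 1 < s.re → G s = LSeries (bc χ) s

open Filter Topology in
lemma exists_logL {q : ℕ} [NeZero q] {χ : DirichletCharacter ℂ q} (hχ : χ ≠ 1)
    (hRH : dirichletRH χ) : ∃ G, IsLogL χ G := by
  have hU : IsOpen {s : ℂ | 1 / 2 < s.re} := isOpen_lt continuous_const Complex.continuous_re
  have hU1 : IsOpen {s : ℂ | 1 < s.re} := isOpen_lt continuous_const Complex.continuous_re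
  have hsc : IsSimplyConnected {s : ℂ | 1 / 2 < s.re} := by
    have := (convex_halfSpace_re_gt (1/2)).contractibleSpace ⟨2, by simp; norm_num⟩
    exact SimplyConnectedSpace.ofContractible _
  obtain ⟨f, hfc, hf⟩ := Complex.exists_continuousOn_eqOn_exp_comp hsc hU
    (g := DirichletCharacter.LFunction χ)
    (DirichletCharacter.differentiable_LFunction hχ).continuous.continuousOn
    (by rintro ⟨s, hs, h⟩; exact L_ne_zero hχ hRH hs h)
  have hfe : ∀ s : ℂ, 1 / 2 < s.re → Complex.exp (f s) = DirichletCharacter.LFunction χ s :=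
    fun s hs => hf hs
  have hfd : DifferentiableOn ℂ f {s | 1 / 2 < s.re} := by
    intro s hs
    apply DifferentiableAt.differentiableWithinAt
    have hca : ContinuousAt f s := hfc.continuousAt (hU.mem_nhds hs)
    have hev : ∀ᶠ z in 𝓝 s, f z = f s + Complex.log (DirichletCharacter.LFunction χ z / DirichletCharacter.LFunction χ s) := by
      have h1 : ∀ᶠ z in 𝓝 s, ‖f z - f s‖ < 1 := by
        have := Metric.continuousAt_iff'.mp hca 1 one_pos
        filter_upwards [this] with z hz
        rwa [← dist_eq_norm]
      filter_upwards [h1, hU.mem_nhds hs] with z hz hz2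
      rw [← hfe z hz2, ← hfe s hs, ← Complex.exp_sub, Complex.log_exp]
      · ring
      · have := (Complex.abs_im_le_norm (f z - f s))
        have := abs_le.mp this
        linarith [Real.pi_gt_three]
      · have := (Complex.abs_im_le_norm (f z - f s))
        have := abs_le.mp this
        linarith [Real.pi_gt_three]
    have hd : DifferentiableAt ℂ (fun z => f s + Complex.log (DirichletCharacter.LFunction χ z / DirichletCharacter.LFunction χ s)) s := by
      refine DifferentiableAt.const_add _ ?_
      refine DifferentiableAt.clog ?_ ?_
      · exact (DirichletCharacter.differentiable_LFunction hχ s).div_const _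
      · rw [div_self (L_ne_zero hχ hRH hs)]
        simp
    exact hd.congr_of_eventuallyEq hev
  have hder : ∀ s : ℂ, 1 < s.re → HasDerivAt (fun z => f z - LSeries (bc χ) z) 0 s := by
    intro s hs
    have hs2 : 1/2 < s.re := by linarith
    have h1 : HasDerivAt f (deriv f s) s := (hfd.differentiableAt (hU.mem_nhds hs2)).hasDerivAt
    have h2 : HasDerivAt (fun z => Complex.exp (f z)) (Complex.exp (f s) * deriv f s) s := h1.cexp
    have h3 : HasDerivAt (DirichletCharacter.LFunction χ) (Complex.exp (f s) * deriv f s) s := by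
      refine h2.congr_of_eventuallyEq ?_
      filter_upwards [hU.mem_nhds hs2] with z hz using (hfe z hz).symm
    have h4 : deriv f s = deriv (DirichletCharacter.LFunction χ) s / DirichletCharacter.LFunction χ s := by
      rw [h3.deriv, hfe s hs2]
      rw [mul_div_cancel_left₀ _ (L_ne_zero hχ hRH hs2)]
    have h5 := LSeries_hasDerivAt (f := bc χ) (s := s)
      ((bc_abscissa χ).trans_lt (by exact_mod_cast hs))
    have h6 : LSeries (LSeries.logMul (bc χ)) s = - deriv f s := by
      rw [h4, DirichletCharacter.deriv_LFunction_eq_deriv_LSeries χ hs,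
        DirichletCharacter.LFunction_eq_LSeries χ hs, ← neg_div,
        ← DirichletCharacter.LSeries_twist_vonMangoldt_eq χ hs]
      refine LSeries_congr (fun {n} _ => ?_) s
      rw [bc_log]; rfl
    have := h1.sub h5
    rw [h6, neg_neg, sub_self] at this
    exact this
  obtain ⟨κ, hκ⟩ : ∃ κ, ∀ s : ℂ, 1 < s.re → f s = LSeries (bc χ) s + κ := by
    refine ⟨f 2 - LSeries (bc χ) 2, fun s hs => ?_⟩
    have := hU1.is_const_of_deriv_eq_zero (𝕜 := ℂ) (f := fun z => f z - LSeries (bc χ) z)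
      (convex_halfSpace_re_gt 1).isPreconnected
      (fun z hz => (hder z hz).differentiableAt.differentiableWithinAt)
      (fun z hz => (hder z hz).deriv) hs (show (2:ℂ) ∈ {s : ℂ | 1 < s.re} by simp)
    have h : f s - LSeries (bc χ) s = f 2 - LSeries (bc χ) 2 := this
    rw [← h]; ring
  have hexp : Complex.exp κ = 1 := by
    have t1 : Tendsto (fun x : ℝ => Complex.exp (LSeries (bc χ) x + κ)) atTop
        (𝓝 (Complex.exp (bc χ 1 + κ))) := by
      refine (Complex.continuous_exp.tendsto _).comp ?_
      exact (LSeries.tendsto_atTop ((bc_abscissa χ).trans_lt (by exact EReal.coe_lt_top 1))).add_const _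
    have t2 : Tendsto (fun x : ℝ => LSeries (fun n : ℕ => χ (n : ZMod q)) x) atTop
        (𝓝 (χ ((1:ℕ) : ZMod q))) := by
      refine LSeries.tendsto_atTop ?_
      refine (LSeries.abscissaOfAbsConv_le_of_le_const ⟨1, fun n _ => χ.norm_le_one _⟩).trans_lt
        (by exact EReal.coe_lt_top 1)
    have t3 : (fun x : ℝ => Complex.exp (LSeries (bc χ) x + κ)) =ᶠ[atTop]
        (fun x : ℝ => LSeries (fun n : ℕ => χ (n : ZMod q)) x) := by
      filter_upwards [eventually_gt_atTop 1] with x hx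
      have hx' : 1 < (x:ℂ).re := by simpa using hx
      rw [← hκ x hx', hfe x (by linarith), DirichletCharacter.LFunction_eq_LSeries χ hx']
    have := tendsto_nhds_unique (t1.congr' t3) t2
    simpa [bc] using this
  refine ⟨fun s => f s - κ, hfd.sub_const _, ?_, ?_⟩
  · intro s hs
    rw [Complex.exp_sub, hexp, div_one, hfe s hs]
  · intro s hs
    have := hκ s hs
    simp only [this]; ring

lemma LSeries_two_bound (a : ℕ → ℂ) (ha : ∀ n, ‖a n‖ ≤ 1) {s : ℂ} (hs : 2 ≤ s.re) :
    ‖LSeries a s‖ ≤ 2 := by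
  have hb : ∀ n, ‖LSeries.term a s n‖ ≤ 1 / (n:ℝ)^2 := by
    intro n
    rw [LSeries.norm_term_eq]
    split_ifs with h
    · positivity
    · have hn : (1:ℝ) ≤ n := by exact_mod_cast Nat.one_le_iff_ne_zero.mpr h
      have : (n:ℝ)^2 ≤ (n:ℝ) ^ s.re := by
        rw [← Real.rpow_natCast]
        exact Real.rpow_le_rpow_of_exponent_le hn (by simpa using hs)
      gcongr
      exact ha n
  rw [LSeries]
  refine (tsum_of_norm_bounded hasSum_zeta_two hb).trans ?_
  have := Real.pi_lt_d2
  nlinarith [Real.pi_pos]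

/-- the analytic conductor -/
noncomputable def QQ (q : ℕ) (t : ℝ) : ℝ := q * (|t| + 2)

lemma two_le_QQ (q : ℕ) [NeZero q] (t : ℝ) : 2 ≤ QQ q t := by
  have h : (1:ℝ) ≤ q := by exact_mod_cast NeZero.one_le
  rw [QQ]
  nlinarith [abs_nonneg t]

lemma log_QQ_pos (q : ℕ) [NeZero q] (t : ℝ) : 2 / 3 ≤ Real.log (QQ q t) := by
  have h1 := Real.log_two_gt_d9
  have := Real.log_le_log (by norm_num) (two_le_QQ q t)
  linarith

lemma log_QQ_add (q : ℕ) [NeZero q] (t u : ℝ) :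
    Real.log (QQ q (t + u)) ≤ Real.log (QQ q t) + Real.log (1 + |u|) := by
  have h : (1:ℝ) ≤ q := by exact_mod_cast NeZero.one_le
  have h2 := two_le_QQ q t
  have h3 := two_le_QQ q (t+u)
  rw [← Real.log_mul (by linarith) (by positivity)]
  refine Real.log_le_log (by linarith) ?_
  rw [QQ, QQ, mul_assoc]
  gcongr
  nlinarith [abs_add_le t u, abs_nonneg t, abs_nonneg u, mul_nonneg (abs_nonneg t) (abs_nonneg u)]

lemma logL_bound {q : ℕ} [NeZero q] {χ : DirichletCharacter ℂ q} (hχ : χ ≠ 1) {G : ℂ → ℂ}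
    (hG : IsLogL χ G) {η : ℝ} (h0 : 0 < η) (h1 : η ≤ 1) {s : ℂ} (hs : 1 / 2 + η ≤ s.re) :
    ‖G s‖ ≤ 18 / η * Real.log (QQ q s.im) := by
  obtain ⟨hd, he, hser⟩ := hG
  have hq : (1:ℝ) ≤ q := by exact_mod_cast NeZero.one_le
  set Q := QQ q s.im with hQ
  have hQ2 : 2 ≤ Q := two_le_QQ q _
  have hlQ : 2/3 ≤ Real.log Q := log_QQ_pos q _
  by_cases h2 : 2 ≤ s.re
  · rw [hser s (by linarith)]
    refine (LSeries_two_bound _ (norm_bc_le χ) h2).trans ?_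
    calc (2:ℝ) ≤ 18 * (2/3) := by norm_num
      _ ≤ 18 / η * Real.log Q := by
        gcongr
        rw [le_div_iff₀ h0]; nlinarith
  push Not at h2
  have hball : ∀ z ∈ Metric.ball (0:ℂ) (3/2), 1/2 < ((⟨2, s.im⟩ : ℂ) + z).re := by
    intro z hz
    have := (Complex.abs_re_le_norm z).trans_lt (mem_ball_zero_iff.mp hz)
    have := abs_lt.mp this
    simp only [Complex.add_re]; linarith
  have key := Complex.borelCaratheodory (f := fun z => G ((⟨2, s.im⟩ : ℂ) + z)) (M := 3 * Real.log Q)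
    (R := 3/2) (z := ((s.re - 2 : ℝ) : ℂ)) (by linarith) ?_ ?_ (by norm_num) ?_
  · have e1 : (⟨2, s.im⟩ : ℂ) + ((s.re - 2 : ℝ) : ℂ) = s := by
      apply Complex.ext <;> simp
    simp only [e1] at key
    have e2 : ‖((s.re - 2 : ℝ) : ℂ)‖ = 2 - s.re := by
      rw [Complex.norm_real, Real.norm_eq_abs, abs_of_neg (by linarith)]; ring
    rw [e2] at key
    have e3 : ‖G ((⟨2, s.im⟩ : ℂ) + 0)‖ ≤ 2 := by
      rw [add_zero, hser _ (by norm_num)]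
      exact LSeries_two_bound _ (norm_bc_le χ) (by norm_num)
    refine key.trans ?_
    rw [← add_div]
    have e4 : η ≤ 3/2 - (2 - s.re) := by linarith
    calc _ ≤ (2 * (3 * Real.log Q) * (3/2) + 2 * (3/2 + 3/2)) / η := by
          gcongr <;> linarith
      _ ≤ (18 * Real.log Q) / η := by
          gcongr; linarith
      _ = _ := by ring
  · intro z hz
    have : DifferentiableAt ℂ G ((⟨2, s.im⟩ : ℂ) + z) :=
      hd.differentiableAt ((isOpen_lt continuous_const Complex.continuous_re).mem_nhds (hball z hz))
    exact (this.comp z (differentiableAt_id.const_add _)).differentiableWithinAt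
  · intro z hz
    set w := (⟨2, s.im⟩ : ℂ) + z with hw
    have hwr := hball z hz
    simp only [Set.mem_setOf_eq]
    have h3 : ‖DirichletCharacter.LFunction χ w‖ = Real.exp (G w).re := by
      rw [← he w hwr, Complex.norm_exp]
    have h4 : Real.exp (G w).re ≤ Q ^ 3 := by
      rw [← h3]
      refine (L_bound hχ (by linarith)).trans ?_
      rw [div_le_iff₀ (by linarith)]
      have h5 : ‖w‖ ≤ |s.im| + 7/2 := by
        have := norm_add_le (⟨2, s.im⟩ : ℂ) z
        have h6 := (Complex.norm_le_abs_re_add_abs_im (⟨2, s.im⟩ : ℂ))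
        simp only [abs_two] at h6
        have := mem_ball_zero_iff.mp hz
        rw [← hw] at *
        linarith
      have h7 : (q:ℝ) * ‖w‖ ≤ 2 * Q := by
        rw [hQ, QQ]
        nlinarith [abs_nonneg s.im]
      have : Q^3 ≥ 4 * Q := by nlinarith [mul_nonneg (by linarith : 0 ≤ Q) (by linarith : 0 ≤ Q - 2), mul_nonneg (mul_nonneg (by linarith : 0 ≤ Q) (by linarith : 0 ≤ Q - 2)) (by linarith : 0 ≤ Q)]
      have h9 : 0 ≤ Q^3 := by positivity
      nlinarith
    have := Real.log_le_log (Real.exp_pos _) h4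
    rw [Real.log_exp, Real.log_pow] at this
    exact_mod_cast this
  · rw [mem_ball_zero_iff, Complex.norm_real, Real.norm_eq_abs, abs_of_neg (by linarith)]
    linarith

lemma psi_bound {q : ℕ} [NeZero q] {χ : DirichletCharacter ℂ q} (hχ : χ ≠ 1) {G : ℂ → ℂ}
    (hG : IsLogL χ G) {η : ℝ} (h0 : 0 < η) (h1 : η ≤ 1) {s : ℂ} (hs : 1 / 2 + 2 * η ≤ s.re) :
    ‖deriv G s‖ ≤ 54 / η ^ 2 * Real.log (QQ q s.im) := by
  have key := Complex.norm_deriv_le_of_forall_mem_sphere_norm_le (c := s) (f := G) (R := η)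
    (C := 54 / η * Real.log (QQ q s.im)) h0 ?_ ?_
  · refine key.trans (le_of_eq ?_)
    field_simp
  · have hsub : Metric.closedBall s η ⊆ {s : ℂ | 1 / 2 < s.re} := by
      intro z hz
      have h2 := (Complex.abs_re_le_norm (z - s)).trans (mem_closedBall_iff_norm.mp hz)
      have := abs_le.mp h2
      simp only [Complex.sub_re] at this
      simp only [Set.mem_setOf_eq]; linarith
    exact (hG.1.mono hsub).diffContOnCl_ball (subset_refl _)
  · intro z hz
    have h2 := (Complex.abs_re_le_norm (z - s)).trans (mem_sphere_iff_norm.mp hz).le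
    have h2 := abs_le.mp h2
    have h3 := (Complex.abs_im_le_norm (z - s)).trans (mem_sphere_iff_norm.mp hz).le
    simp only [Complex.sub_re, Complex.sub_im] at h2 h3
    refine (logL_bound hχ hG h0 h1 (s := z) (by linarith)).trans ?_
    have h4 := log_QQ_add q s.im (z.im - s.im)
    have h5 : Real.log (1 + |z.im - s.im|) ≤ 2 * Real.log (QQ q s.im) := by
      have h6 := Real.log_le_sub_one_of_pos (x := 1 + |z.im - s.im|) (by positivity)
      have := log_QQ_pos q s.im
      linarith
    rw [add_sub_cancel] at h4
    calc _ ≤ 18 / η * (3 * Real.log (QQ q s.im)) := by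
          gcongr; linarith
      _ = _ := by ring


/-! ### Part 3c : one-sided bound for the logarithmic derivative -/

open Complex.HadamardThreeLines in
lemma logL_reflect {q : ℕ} [NeZero q] {χ : DirichletCharacter ℂ q} (hχ : χ ≠ 1) {G : ℂ → ℂ}
    (hG : IsLogL χ G) {c : ℝ} (hc : 1 / 2 < c) (hc1 : c ≤ 3 / 4) (τ a : ℝ) (ha : 0 ≤ a)
    (hac : a < c - 1 / 2) :
    (G ⟨c - a, τ⟩).re - (G ⟨c + a, τ⟩).re ≤ 12000 * Real.log (QQ q τ) * a := by
  obtain ⟨hd, he, hser⟩ := id hG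
  have hq : (1:ℝ) ≤ q := by exact_mod_cast NeZero.one_le
  set Gc : ℂ → ℂ := fun s => (starRingEnd ℂ) (G ((starRingEnd ℂ) s)) with hGc
  set h : ℂ → ℂ := fun s => DirichletCharacter.LFunction χ s * Complex.exp (- Gc (2 * c - s)) *
    Complex.exp ((s - ⟨c, τ⟩) ^ 2) with hh
  have hGcd : ∀ s : ℂ, 1 / 2 < s.re → DifferentiableAt ℂ Gc s := by
    intro s hs
    have h1 : DifferentiableAt ℂ G ((starRingEnd ℂ) s) :=
      hd.differentiableAt ((isOpen_lt continuous_const Complex.continuous_re).mem_nhds (by simpa using hs))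
    have := h1.star_conj
    rw [Complex.conj_conj] at this
    exact this
  have hhd : ∀ s : ℂ, s.re ≤ c → DifferentiableAt ℂ h s := by
    intro s hs
    have h1 : DifferentiableAt ℂ (fun s => Gc (2 * c - s)) s := by
      have : DifferentiableAt ℂ Gc (2 * c - s) := hGcd _ (by simp; linarith)
      exact this.comp s (differentiableAt_id.const_sub _)
    have h2 := DirichletCharacter.differentiable_LFunction hχ s
    have h3 : DifferentiableAt ℂ (fun s : ℂ => (s - ⟨c, τ⟩) ^ 2) s := by fun_prop
    exact (h2.mul h1.neg.cexp).mul h3.cexp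
  have hbound : ∀ η : ℝ, 0 < η → η ≤ 1 → ∀ s : ℂ, c - 1 / 4 ≤ s.re → s.re ≤ c →
      1 / 2 + η ≤ 2 * c - s.re →
      ‖h s‖ ≤ Real.exp ((3 + 18 / η) * Real.log (QQ q τ) + (3 + 18 / η) ^ 2 / 4 + 1 / 16) := by
    intro η h0 h1 s hs1 hs2 hs3
    have hlQ := log_QQ_pos q s.im
    have hQ := two_le_QQ q s.im
    set Q := QQ q s.im with hQdef
    have hL : ‖DirichletCharacter.LFunction χ s‖ ≤ Real.exp (3 * Real.log Q) := by
      refine (L_bound hχ (by linarith)).trans ?_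
      have e1 : Real.exp (3 * Real.log Q) = Q ^ 3 := by
        rw [mul_comm, Real.exp_mul, Real.exp_log (by linarith)]
        exact_mod_cast Real.rpow_natCast Q 3
      rw [e1, div_le_iff₀ (by linarith)]
      have h5 : ‖s‖ ≤ |s.im| + 1 := by
        have h6 := (Complex.norm_le_abs_re_add_abs_im s)
        rw [abs_of_nonneg (by linarith)] at h6
        linarith
      have h7 : (q:ℝ) * ‖s‖ ≤ Q := by
        rw [hQdef, QQ]
        nlinarith [abs_nonneg s.im]
      have : Q^3 ≥ 4 * Q := by nlinarith [mul_nonneg (by linarith : 0 ≤ Q) (by linarith : 0 ≤ Q - 2), mul_nonneg (mul_nonneg (by linarith : 0 ≤ Q) (by linarith : 0 ≤ Q - 2)) (by linarith : 0 ≤ Q)]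
      have h9 : 0 ≤ Q^3 := by positivity
      nlinarith
    have hE1 : ‖Complex.exp (- Gc (2 * c - s))‖ ≤ Real.exp (18 / η * Real.log Q) := by
      rw [Complex.norm_exp, Real.exp_le_exp]
      have e1 : ‖Gc (2 * c - s)‖ ≤ 18 / η * Real.log Q := by
        rw [hGc]
        simp only [RCLike.norm_conj]
        have := logL_bound hχ hG h0 h1 (s := (starRingEnd ℂ) (2 * c - s)) (by simpa using hs3)
        simpa [hQdef] using this
      have e2 := Complex.abs_re_le_norm (- Gc (2 * c - s))
      rw [norm_neg] at e2
      exact (le_abs_self _).trans (e2.trans e1)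
    have hE2 : ‖Complex.exp ((s - ⟨c, τ⟩) ^ 2)‖ ≤ Real.exp (1/16 - (s.im - τ)^2) := by
      rw [Complex.norm_exp, Real.exp_le_exp]
      have : ((s - (⟨c, τ⟩ : ℂ)) ^ 2).re = (s.re - c)^2 - (s.im - τ)^2 := by
        rw [pow_two, Complex.mul_re]; simp; ring
      rw [this]
      nlinarith
    have hQ0 := log_QQ_add q τ (s.im - τ)
    rw [add_sub_cancel] at hQ0
    have hl1 : Real.log (1 + |s.im - τ|) ≤ |s.im - τ| := by
      have := Real.log_le_sub_one_of_pos (x := 1 + |s.im - τ|) (by positivity)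
      linarith
    rw [hh]
    simp only
    rw [norm_mul, norm_mul]
    calc _ ≤ Real.exp (3 * Real.log Q) * Real.exp (18 / η * Real.log Q) * Real.exp (1/16 - (s.im - τ)^2) := by
          gcongr
      _ = Real.exp ((3 + 18 / η) * Real.log Q + (1/16 - (s.im - τ)^2)) := by
          rw [← Real.exp_add, ← Real.exp_add]; congr 1; ring
      _ ≤ _ := by
          rw [Real.exp_le_exp]
          have hB : 0 ≤ 3 + 18 / η := by positivity
          set B := 3 + 18 / η
          have h8 : B * Real.log Q ≤ B * (Real.log (QQ q τ) + |s.im - τ|) :=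
            mul_le_mul_of_nonneg_left (by linarith) hB
          have h9 : (s.im - τ)^2 = |s.im - τ|^2 := (sq_abs _).symm
          rw [h9]
          nlinarith [sq_nonneg (|s.im - τ| - B / 2)]
  have hlq := log_QQ_pos q τ
  have key := norm_le_interp_of_mem_verticalClosedStrip' (f := h) (z := ⟨c - a, τ⟩) (l := c - 1/4)
    (u := c) (a := Real.exp (3000 * Real.log (QQ q τ))) (b := 1) (by linarith) ?_ ?_ ?_ ?_ ?_
  · rw [Real.one_rpow, mul_one, ← Real.exp_mul] at key
    have e1 : 1 - ((⟨c - a, τ⟩ : ℂ).re - (c - 1/4)) / (c - (c - 1/4)) = 4 * a := by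
      simp only; field_simp; ring
    rw [e1] at key
    have e2 : Gc (2 * c - ⟨c - a, τ⟩) = (starRingEnd ℂ) (G ⟨c + a, τ⟩) := by
      rw [hGc]
      simp only
      congr 2
      apply Complex.ext <;> simp
      ring
    have e3 : ‖h ⟨c - a, τ⟩‖ = Real.exp ((G ⟨c - a, τ⟩).re - (G ⟨c + a, τ⟩).re + a ^ 2) := by
      rw [hh]
      simp only
      rw [norm_mul, norm_mul, e2, ← he _ (by simp only; linarith), Complex.norm_exp, Complex.norm_exp, Complex.norm_exp,
        ← Real.exp_add, ← Real.exp_add]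
      congr 1
      have : (((⟨c - a, τ⟩ : ℂ) - (⟨c, τ⟩ : ℂ)) ^ 2).re = a ^ 2 := by
        rw [pow_two, Complex.mul_re]; simp; ring
      rw [this]; simp; ring
    rw [e3, Real.exp_le_exp] at key
    nlinarith [sq_nonneg a]
  · simp only [verticalClosedStrip, Set.mem_preimage, Set.mem_Icc]
    constructor <;> linarith
  · have hcl : closure (verticalStrip (c - 1/4) c) ⊆ {s : ℂ | s.re ≤ c} := by
      refine closure_minimal ?_ (isClosed_le Complex.continuous_re continuous_const)
      intro s hs
      exact hs.2.le
    refine DifferentiableOn.diffContOnCl fun s hs => ?_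
    exact (hhd s (hcl hs)).differentiableWithinAt
  · refine ⟨Real.exp ((3 + 18 / (c-1/2)) * Real.log (QQ q τ) + (3 + 18 / (c-1/2)) ^ 2 / 4 + 1 / 16), ?_⟩
    rintro _ ⟨s, hs, rfl⟩
    simp only [verticalClosedStrip, Set.mem_preimage, Set.mem_Icc] at hs
    exact hbound (c - 1/2) (by linarith) (by linarith) s hs.1 hs.2 (by linarith [hs.2])
  · intro s hs
    have hs : s.re = c - 1/4 := hs
    refine (hbound (1/4) (by norm_num) (by norm_num) s (by linarith) (by linarith) (by linarith)).trans ?_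
    rw [Real.exp_le_exp]
    norm_num
    linarith
  · intro s hs
    have hs : s.re = c := hs
    rw [hh]
    simp only
    have e0 : (starRingEnd ℂ) (2 * c - s) = s := by
      apply Complex.ext <;> simp; linarith
    rw [norm_mul, norm_mul, ← he s (by linarith), Complex.norm_exp, Complex.norm_exp, Complex.norm_exp,
        ← Real.exp_add, ← Real.exp_add, hGc]
    simp only
    rw [e0]
    have : ((s - (⟨c, τ⟩ : ℂ)) ^ 2).re = - (s.im - τ)^2 := by
        rw [pow_two, Complex.mul_re]; simp [hs]; ring
    rw [this]
    simp
    positivity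

open Filter Topology in
lemma psi_re_lower {q : ℕ} [NeZero q] {χ : DirichletCharacter ℂ q} (hχ : χ ≠ 1) {G : ℂ → ℂ}
    (hG : IsLogL χ G) {c : ℝ} (hc : 1 / 2 < c) (hc1 : c ≤ 3 / 4) (τ : ℝ) :
    - (deriv G ⟨c, τ⟩).re ≤ 6000 * Real.log (QQ q τ) := by
  set K := 12000 * Real.log (QQ q τ) with hK
  have hd : HasDerivAt G (deriv G ⟨c, τ⟩) ⟨c, τ⟩ :=
    (hG.1.differentiableAt ((isOpen_lt continuous_const Complex.continuous_re).mem_nhds hc)).hasDerivAt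
  have h1 : HasDerivAt (fun a : ℝ => G (⟨c, τ⟩ + (a:ℂ))) (deriv G ⟨c, τ⟩) 0 := by
    have e : HasDerivAt (fun a : ℝ => (⟨c, τ⟩ : ℂ) + (a:ℂ)) 1 0 :=
      (Complex.ofRealCLM.hasDerivAt (x := (0:ℝ))).const_add _
    have hd' : HasDerivAt G (deriv G ⟨c, τ⟩) ((⟨c, τ⟩ : ℂ) + ((0:ℝ):ℂ)) := by simpa using hd
    have := hd'.comp (0:ℝ) e
    rw [mul_one] at this
    exact this
  have h2 : HasDerivAt (fun a : ℝ => G (⟨c, τ⟩ + ((-a : ℝ):ℂ))) (- deriv G ⟨c, τ⟩) 0 := by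
    have h1' : HasDerivAt (fun a : ℝ => G (⟨c, τ⟩ + (a:ℂ))) (deriv G ⟨c, τ⟩) (-0) := by simpa using h1
    have := h1'.scomp (0:ℝ) (hasDerivAt_neg (0:ℝ))
    simpa [Function.comp_def] using this
  have h3 : HasDerivAt (fun a : ℝ => K * a + (G (⟨c, τ⟩ + (a:ℂ)) - G (⟨c, τ⟩ + ((-a : ℝ):ℂ))).re)
      (K * 1 + (deriv G ⟨c, τ⟩ - - deriv G ⟨c, τ⟩).re) 0 := by
    refine HasDerivAt.add ((hasDerivAt_id (0:ℝ)).const_mul K) ?_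
    exact Complex.reCLM.hasFDerivAt.comp_hasDerivAt (0:ℝ) (h1.sub h2)
  have h4 := h3.tendsto_slope_zero_right
  have h5 : 0 ≤ K * 1 + (deriv G ⟨c, τ⟩ - - deriv G ⟨c, τ⟩).re := by
    refine ge_of_tendsto h4 ?_
    have : Set.Ioo (0:ℝ) (c - 1/2) ∈ 𝓝[>] (0:ℝ) := Ioo_mem_nhdsGT (by linarith)
    filter_upwards [this] with a ha
    have := logL_reflect hχ hG hc hc1 τ a ha.1.le ha.2
    have e1 : (⟨c, τ⟩ : ℂ) + (a:ℂ) = ⟨c + a, τ⟩ := by apply Complex.ext <;> simp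
    have e2 : (⟨c, τ⟩ : ℂ) + ((-a:ℝ):ℂ) = ⟨c - a, τ⟩ := by apply Complex.ext <;> simp; ring
    rw [zero_add]
    simp only [e1, e2, smul_eq_mul]
    refine mul_nonneg (inv_nonneg.mpr ha.1.le) ?_
    simp only [Complex.sub_re, Complex.ofReal_zero, neg_zero, sub_self, Complex.zero_re, mul_zero, add_zero]
    rw [← hK] at this
    linarith
  simp at h5
  linarith


/-! ### Part 3d : the triangle kernel -/

noncomputable def tri (a u : ℝ) : ℝ := max 0 (1 - |u| / a)

noncomputable def Fk (a : ℝ) (z : ℂ) : ℂ :=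
  ∫ u in (0:ℝ)..a, ((1 - u / a : ℝ) : ℂ) * (cexp (z * u) + cexp (-(z * u)))

lemma tri_nonneg (a u : ℝ) : 0 ≤ tri a u := le_max_left _ _

lemma tri_le_one {a : ℝ} (ha : 0 < a) (u : ℝ) : tri a u ≤ 1 := by
  unfold tri
  have : 0 ≤ |u| / a := by positivity
  exact max_le (by norm_num) (by linarith)

lemma tri_continuous (a : ℝ) : Continuous (tri a) := by
  unfold tri; fun_prop

lemma tri_eq_zero {a u : ℝ} (ha : 0 < a) (hu : a ≤ |u|) : tri a u = 0 := by
  unfold tri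
  have : 1 ≤ |u| / a := by rw [le_div_iff₀ ha]; linarith
  exact max_eq_left (by linarith)

lemma tri_eq {a u : ℝ} (ha : 0 < a) (hu : |u| ≤ a) : tri a u = 1 - |u| / a := by
  unfold tri
  have : |u| / a ≤ 1 := by rw [div_le_iff₀ ha]; linarith
  exact max_eq_right (by linarith)

lemma Fk_continuous (a : ℝ) : Continuous (Fk a) := by
  unfold Fk
  apply intervalIntegral.continuous_parametric_intervalIntegral_of_continuous'
  fun_prop

lemma Fk_half (a : ℝ) (ha : 0 < a) (z : ℂ) (hz : z ≠ 0) :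
    ∫ u in (0:ℝ)..a, ((1 - u / a : ℝ) : ℂ) * cexp (z * u) =
      cexp (a * z) / (a * z ^ 2) - 1 / z - 1 / (a * z ^ 2) := by
  have ha' : (a:ℂ) ≠ 0 := by exact_mod_cast ha.ne'
  have hder : ∀ u ∈ Set.uIcc 0 a, HasDerivAt (fun u : ℝ => ((1 - u / a : ℂ)) * cexp (z * u) / z + cexp (z * u) / (a * z ^ 2))
      (((1 - u / a : ℝ) : ℂ) * cexp (z * u)) u := by
    intro u _
    have h0 : HasDerivAt (fun u : ℝ => (u:ℂ)) 1 u := Complex.ofRealCLM.hasDerivAt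
    have h1 : HasDerivAt (fun u : ℝ => cexp (z * u)) (cexp (z * u) * (z * 1)) u :=
      (h0.const_mul z).cexp
    have h2 : HasDerivAt (fun u : ℝ => (1 - (u:ℂ) / a)) (-(1 / a)) u := (h0.div_const _).const_sub 1
    have h3 := ((h2.mul h1).div_const z).add (h1.div_const (a * z ^ 2))
    refine h3.congr_deriv ?_
    push_cast
    field_simp
    ring
  rw [intervalIntegral.integral_eq_sub_of_hasDerivAt hder (by apply Continuous.intervalIntegrable; fun_prop)]
  simp only [Complex.ofReal_zero, mul_zero, Complex.exp_zero, zero_div, sub_zero]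
  rw [div_self ha', mul_comm z]
  ring

lemma Fk_eq (a : ℝ) (ha : 0 < a) (z : ℂ) (hz : z ≠ 0) :
    Fk a z = (cexp (a * z) + cexp (-(a * z)) - 2) / (a * z ^ 2) := by
  have ha' : (a:ℂ) ≠ 0 := by exact_mod_cast ha.ne'
  unfold Fk
  simp_rw [mul_add]
  rw [intervalIntegral.integral_add (by apply Continuous.intervalIntegrable; fun_prop)
    (by apply Continuous.intervalIntegrable; fun_prop), Fk_half a ha z hz]
  have := Fk_half a ha (-z) (neg_ne_zero.mpr hz)
  simp_rw [neg_mul] at this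
  rw [this]
  rw [mul_neg]
  field_simp
  ring

lemma Fk_differentiableAt (a : ℝ) (ha : 0 < a) (z : ℂ) (hz : z ≠ 0) : DifferentiableAt ℂ (Fk a) z := by
  have ha' : (a:ℂ) ≠ 0 := by exact_mod_cast ha.ne'
  have : DifferentiableAt ℂ (fun z => (cexp (a * z) + cexp (-(a * z)) - 2) / (a * z ^ 2)) z := by
    refine DifferentiableAt.div (by fun_prop) (by fun_prop) (by positivity)
  refine this.congr_of_eventuallyEq ?_
  filter_upwards [isOpen_ne.mem_nhds hz] with w hw using Fk_eq a ha w hw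

lemma Fk_bound {a R : ℝ} (ha : 0 < a) {z : ℂ} (hR : |z.re| ≤ R) :
    ‖Fk a z‖ ≤ 4 * (a + 2 / a) * Real.exp (R * a) * (1 + |z.im|) ^ (-2 : ℝ) := by
  have hexp : ∀ u : ℝ, |u| ≤ a → ‖cexp (z * u)‖ ≤ Real.exp (R * a) := by
    intro u hu
    rw [Complex.norm_exp, Real.exp_le_exp]
    simp only [Complex.mul_re, Complex.ofReal_re, Complex.ofReal_im, mul_zero, sub_zero]
    calc z.re * u ≤ |z.re * u| := le_abs_self _
      _ = |z.re| * |u| := abs_mul _ _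
      _ ≤ _ := mul_le_mul hR hu (abs_nonneg _) ((abs_nonneg _).trans hR)
  have hexp' : ∀ u : ℝ, |u| ≤ a → ‖cexp (-(z * u))‖ ≤ Real.exp (R * a) := by
    intro u hu
    have := hexp (-u) (by rwa [abs_neg])
    simpa using this
  have hR0 : 0 ≤ R := (abs_nonneg _).trans hR
  have hE1 : 1 ≤ Real.exp (R * a) := Real.one_le_exp (by positivity)
  have b1 : ‖Fk a z‖ ≤ 2 * Real.exp (R * a) * a := by
    have := intervalIntegral.norm_integral_le_of_norm_le_const (a := (0:ℝ)) (b := a)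
      (f := fun u : ℝ => ((1 - u / a : ℝ) : ℂ) * (cexp (z * u) + cexp (-(z * u)))) (C := 2 * Real.exp (R * a)) ?_
    · rwa [sub_zero, abs_of_pos ha] at this
    · intro u hu
      rw [Set.uIoc_of_le ha.le] at hu
      have hua : |u| ≤ a := by rw [abs_of_pos hu.1]; exact hu.2
      rw [norm_mul, Complex.norm_real, Real.norm_eq_abs]
      have h1 : |1 - u / a| ≤ 1 := by
        have : u / a ≤ 1 := by rw [div_le_iff₀ ha]; linarith [hu.2]
        have : 0 ≤ u / a := div_nonneg hu.1.le ha.le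
        rw [abs_le]; constructor <;> linarith
      have h2 := (norm_add_le (cexp (z * u)) (cexp (-(z * u)))).trans (add_le_add (hexp u hua) (hexp' u hua))
      calc _ ≤ 1 * (Real.exp (R * a) + Real.exp (R * a)) := mul_le_mul h1 h2 (norm_nonneg _) (by norm_num)
        _ = _ := by ring
  have b2 : ‖z‖ ^ 2 * ‖Fk a z‖ ≤ 4 * Real.exp (R * a) / a := by
    by_cases hz : z = 0
    · rw [hz]; simp; positivity
    · rw [Fk_eq a ha z hz, norm_div, norm_mul, norm_pow, Complex.norm_real, Real.norm_eq_abs, abs_of_pos ha]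
      have hzn : 0 < ‖z‖ := norm_pos_iff.mpr hz
      have e1 := hexp a (by rw [abs_of_pos ha])
      have e2 := hexp' a (by rw [abs_of_pos ha])
      rw [mul_comm z] at e1 e2
      have : ‖cexp (a * z) + cexp (-(a * z)) - 2‖ ≤ 4 * Real.exp (R * a) := by
        refine (norm_sub_le _ _).trans ?_
        have := norm_add_le (cexp (a * z)) (cexp (-(a * z)))
        have h2 : ‖(2:ℂ)‖ = 2 := by simp
        rw [h2]
        linarith
      calc _ = ‖cexp (a * z) + cexp (-(a * z)) - 2‖ / a := by field_simp
        _ ≤ _ := by gcongr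
  have him : |z.im| ≤ ‖z‖ := Complex.abs_im_le_norm z
  rw [Real.rpow_neg (by positivity), ← div_eq_mul_inv, le_div_iff₀ (by positivity)]
  norm_cast
  have h3 : (1 + |z.im|) ^ 2 ≤ 2 * (1 + ‖z‖ ^ 2) := by
    have := abs_nonneg z.im
    nlinarith [sq_nonneg (1 - |z.im|)]
  calc _ ≤ ‖Fk a z‖ * (2 * (1 + ‖z‖ ^ 2)) := by gcongr
    _ = 2 * (‖Fk a z‖ + ‖z‖ ^ 2 * ‖Fk a z‖) := by ring
    _ ≤ 2 * (2 * Real.exp (R * a) * a + 4 * Real.exp (R * a) / a) := by gcongr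
    _ = _ := by ring

lemma Fk_scale (a : ℝ) (ha : 0 < a) (z : ℂ) : Fk a (z / a) = a * Fk 1 z := by
  have ha' : (a:ℂ) ≠ 0 := by exact_mod_cast ha.ne'
  unfold Fk
  have := intervalIntegral.smul_integral_comp_mul_left (a := 0) (b := 1)
    (fun u : ℝ => ((1 - u / a : ℝ) : ℂ) * (cexp (z / a * u) + cexp (-(z / a * u)))) a
  rw [mul_zero, mul_one] at this
  rw [← this, Complex.real_smul]
  congr 2
  ext u
  have e1 : z / a * ((a * u : ℝ):ℂ) = z * u := by push_cast; field_simp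
  have e2 : a * u / a = u / 1 := by field_simp
  rw [e1, e2]

lemma Fk_imag (a : ℝ) (ha : 0 < a) (τ : ℝ) : ∃ r : ℝ, 0 ≤ r ∧ Fk a (τ * I) = r := by
  by_cases h : τ = 0
  · refine ⟨a, ha.le, ?_⟩
    unfold Fk
    simp only [h, Complex.ofReal_zero, zero_mul, Complex.exp_zero, neg_zero]
    rw [intervalIntegral.integral_mul_const, intervalIntegral.integral_ofReal]
    have : ∫ u in (0:ℝ)..a, (1 - u / a) = a / 2 := by
      rw [intervalIntegral.integral_sub (by simp) (by apply Continuous.intervalIntegrable; fun_prop)]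
      simp [intervalIntegral.integral_div, integral_id]
      field_simp
      ring
    rw [this]; push_cast; ring
  · have hz : (τ:ℂ) * I ≠ 0 := by simp [h]
    refine ⟨2 * (1 - Real.cos (a * τ)) / (a * τ ^ 2), ?_, ?_⟩
    · have := Real.cos_le_one (a * τ)
      have h1 : 0 ≤ 1 - Real.cos (a * τ) := by linarith
      positivity
    · rw [Fk_eq a ha _ hz]
      have : cexp (a * (τ * I)) + cexp (-(a * (τ * I))) = 2 * Complex.cos (a * τ) := by
        rw [Complex.cos]; ring_nf
      rw [this]
      push_cast
      have h1 : ((a:ℂ) * (τ * I) ^ 2) = - (a * τ ^ 2) := by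
        rw [mul_pow, Complex.I_sq]; ring
      rw [h1, div_neg, ← neg_div]
      ring

lemma Fk_fourier (a : ℝ) (ha : 0 < a) (z : ℂ) : ∫ u : ℝ, cexp (z * u) * tri a u = Fk a z := by
  have hintg : MeasureTheory.IntegrableOn (fun u : ℝ => cexp (z * u) * tri a u) (Set.Icc (-a) a) := by
    apply Continuous.integrableOn_Icc
    have := tri_continuous a
    fun_prop
  have h1 : ∫ u : ℝ, cexp (z * u) * tri a u = ∫ u in Set.Ioc (-a) a, cexp (z * u) * tri a u := by
    symm
    apply MeasureTheory.setIntegral_eq_integral_of_forall_compl_eq_zero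
    intro u hu
    rw [tri_eq_zero ha, Complex.ofReal_zero, mul_zero]
    by_contra hc
    push Not at hc
    exact hu ⟨(abs_lt.mp hc).1, (abs_lt.mp hc).2.le⟩
  have hcont : Continuous (fun u : ℝ => cexp (z * u) * tri a u) := by
    have := tri_continuous a
    fun_prop
  rw [h1, ← intervalIntegral.integral_of_le (by linarith),
    ← intervalIntegral.integral_add_adjacent_intervals (b := 0) (hcont.intervalIntegrable _ _) (hcont.intervalIntegrable _ _)]
  have h2 : ∫ u in (-a)..0, cexp (z * u) * tri a u = ∫ u in (0:ℝ)..a, cexp (-(z * u)) * tri a u := by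
    have := intervalIntegral.integral_comp_neg (a := 0) (b := a) (fun u : ℝ => cexp (z * u) * (tri a u : ℂ))
    rw [neg_zero] at this
    rw [← this]
    congr 1
    ext u
    simp [tri]
  have hcont' : Continuous (fun u : ℝ => cexp (-(z * u)) * tri a u) := by
    have := tri_continuous a
    fun_prop
  rw [h2, ← intervalIntegral.integral_add (hcont'.intervalIntegrable _ _) (hcont.intervalIntegrable _ _)]
  unfold Fk
  apply intervalIntegral.integral_congr
  intro u hu
  rw [Set.uIcc_of_le ha.le] at hu
  have : tri a u = 1 - u / a := by
    rw [tri_eq ha (by rw [abs_of_nonneg hu.1]; exact hu.2), abs_of_nonneg hu.1]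
  simp only [this]
  ring

lemma integrable_pow_aux {r : ℝ} (hr : 1 < r) (K : ℝ) :
    MeasureTheory.Integrable (fun τ : ℝ => K * (1 + |τ|) ^ (-r)) := by
  have := (integrable_one_add_norm (E := ℝ) (μ := MeasureTheory.volume) (r := r) (by simpa using hr)).const_mul K
  simpa using this

lemma Fk_line_integrable {a : ℝ} (ha : 0 < a) (σ : ℝ) :
    MeasureTheory.Integrable (fun τ : ℝ => Fk a (σ + τ * I)) := by
  refine (integrable_pow_aux (r := 2) (by norm_num) (4 * (a + 2 / a) * Real.exp (|σ| * a))).mono' ?_ ?_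
  · have := Fk_continuous a
    exact Continuous.aestronglyMeasurable (by fun_prop)
  · refine Filter.Eventually.of_forall fun τ => ?_
    have := Fk_bound ha (z := σ + τ * I) (R := |σ|) (by simp)
    simpa using this

open FourierTransform in
lemma Fk_inversion {a : ℝ} (ha : 0 < a) (σ ξ : ℝ) :
    ∫ τ : ℝ, Fk a (σ + τ * I) * cexp (-((σ + τ * I) * ξ)) = 2 * π * tri a ξ := by
  set f : ℝ → ℂ := fun u => cexp (σ * u) * tri a u with hf
  have hfc : Continuous f := by
    have := tri_continuous a
    rw [hf]; fun_prop
  have hfi : MeasureTheory.Integrable f := by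
    apply hfc.integrable_of_hasCompactSupport
    refine HasCompactSupport.intro (isCompact_Icc (a := -a) (b := a)) ?_
    intro u hu
    rw [hf]
    simp only
    rw [tri_eq_zero ha, Complex.ofReal_zero, mul_zero]
    by_contra hc
    push Not at hc
    exact hu ⟨(abs_lt.mp hc).1.le, (abs_lt.mp hc).2.le⟩
  have hF : ∀ w : ℝ, 𝓕 f w = Fk a (σ + ((-(2 * π) * w : ℝ):ℂ) * I) := by
    intro w
    rw [Real.fourier_real_eq_integral_exp_smul, ← Fk_fourier a ha]
    congr 1
    ext u
    rw [hf, smul_eq_mul, ← mul_assoc, ← Complex.exp_add]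
    congr 2
    push_cast; ring
  have hFi : MeasureTheory.Integrable (𝓕 f) := by
    have : 𝓕 f = fun w => Fk a (σ + ((-(2 * π) * w : ℝ):ℂ) * I) := funext hF
    rw [this]
    exact (Fk_line_integrable ha σ).comp_mul_left' (by simp [Real.pi_ne_zero])
  have hinv := congrFun (hfc.fourierInv_fourier_eq hfi hFi) ξ
  rw [Real.fourierInv_eq_fourier_neg, Real.fourier_real_eq_integral_exp_smul] at hinv
  have hsub := MeasureTheory.Measure.integral_comp_mul_left
    (fun τ : ℝ => Fk a (σ + τ * I) * cexp (-((τ * I) * ξ))) (-(2 * π))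
  have e : (∫ v : ℝ, cexp (((-2 * π * v * -ξ : ℝ):ℂ) * I) • 𝓕 f v) =
      ∫ x : ℝ, (fun τ : ℝ => Fk a (σ + τ * I) * cexp (-((τ * I) * ξ))) (-(2 * π) * x) := by
    congr 1
    ext v
    rw [hF, smul_eq_mul, mul_comm]
    simp only
    congr 2
    push_cast; ring
  rw [e, hsub] at hinv
  have e2 : |(-(2 * π))⁻¹| = (2 * π)⁻¹ := by
    rw [abs_inv, abs_neg, abs_of_pos (by positivity)]
  rw [e2, Complex.real_smul, hf] at hinv
  simp only at hinv
  have e3 : ∫ τ : ℝ, Fk a (σ + τ * I) * cexp (-((σ + τ * I) * ξ)) =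
      cexp (-(σ * ξ)) * ∫ τ : ℝ, Fk a (σ + τ * I) * cexp (-((τ * I) * ξ)) := by
    rw [← MeasureTheory.integral_const_mul]
    congr 1
    ext τ
    rw [add_mul, neg_add, Complex.exp_add]
    ring
  rw [e3]
  have hpi : (π : ℂ) ≠ 0 := by exact_mod_cast Real.pi_ne_zero
  have e4 : (∫ τ : ℝ, Fk a (σ + τ * I) * cexp (-((τ * I) * ξ))) = 2 * π * (cexp (σ * ξ) * tri a ξ) := by
    rw [← hinv]; push_cast; rw [← mul_assoc, mul_inv_cancel₀ (by simp [hpi]), one_mul]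
  rw [e4]
  calc _ = 2 * π * (cexp (-(σ * ξ)) * cexp (σ * ξ)) * tri a ξ := by ring
    _ = _ := by rw [← Complex.exp_add]; simp


/-! ### Part 3d : shifting -/

open Filter Topology in
lemma vert_shift {H : ℂ → ℂ} {σ0 σ1 K : ℝ} (h01 : σ0 ≤ σ1)
    (hc : ContinuousOn H {z | σ0 ≤ z.re ∧ z.re ≤ σ1})
    (hd : ∀ z : ℂ, σ0 < z.re → z.re < σ1 → z ≠ 0 → DifferentiableAt ℂ H z)
    (hb : ∀ z : ℂ, σ0 ≤ z.re → z.re ≤ σ1 → ‖H z‖ ≤ K * (1 + |z.im|) ^ (-1 : ℝ))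
    (h0 : MeasureTheory.Integrable (fun τ : ℝ => H (σ0 + τ * I)))
    (h1 : MeasureTheory.Integrable (fun τ : ℝ => H (σ1 + τ * I))) :
    ∫ τ : ℝ, H (σ0 + τ * I) = ∫ τ : ℝ, H (σ1 + τ * I) := by
  have t0 := MeasureTheory.intervalIntegral_tendsto_integral h0 tendsto_neg_atTop_atBot tendsto_id
  have t1 := MeasureTheory.intervalIntegral_tendsto_integral h1 tendsto_neg_atTop_atBot tendsto_id
  have hrect : ∀ T : ℝ, 0 ≤ T → ‖(∫ τ in (-T)..T, H (σ1 + τ * I)) - ∫ τ in (-T)..T, H (σ0 + τ * I)‖ ≤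
      2 * (K * (1 + T) ^ (-1 : ℝ) * (σ1 - σ0)) := by
    intro T hT
    have key := Complex.integral_boundary_rect_eq_zero_of_differentiable_on_off_countable H
      (⟨σ0, -T⟩ : ℂ) (⟨σ1, T⟩ : ℂ) {0} (Set.countable_singleton 0) ?_ ?_
    · simp only at key
      have b1 : ‖∫ x in σ0..σ1, H (x + ((-T : ℝ):ℂ) * I)‖ ≤ K * (1 + T) ^ (-1 : ℝ) * (σ1 - σ0) := by
        have := intervalIntegral.norm_integral_le_of_norm_le_const (a := σ0) (b := σ1)
          (f := fun x : ℝ => H (x + ((-T : ℝ):ℂ) * I)) (C := K * (1 + T) ^ (-1 : ℝ)) ?_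
        · rwa [abs_of_nonneg (by linarith)] at this
        · intro x hx
          rw [Set.uIoc_of_le h01] at hx
          have := hb (x + ((-T : ℝ):ℂ) * I) (by simpa using hx.1.le) (by simpa using hx.2)
          simpa [abs_of_nonneg hT] using this
      have b2 : ‖∫ x in σ0..σ1, H (x + (T:ℂ) * I)‖ ≤ K * (1 + T) ^ (-1 : ℝ) * (σ1 - σ0) := by
        have := intervalIntegral.norm_integral_le_of_norm_le_const (a := σ0) (b := σ1)
          (f := fun x : ℝ => H (x + (T:ℂ) * I)) (C := K * (1 + T) ^ (-1 : ℝ)) ?_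
        · rwa [abs_of_nonneg (by linarith)] at this
        · intro x hx
          rw [Set.uIoc_of_le h01] at hx
          have := hb (x + (T:ℂ) * I) (by simpa using hx.1.le) (by simpa using hx.2)
          simpa [abs_of_nonneg hT] using this
      set X := ∫ x in σ0..σ1, H (x + ((-T : ℝ):ℂ) * I)
      set Y := ∫ x in σ0..σ1, H (x + (T:ℂ) * I)
      set U := ∫ τ in (-T)..T, H (σ1 + τ * I)
      set V := ∫ τ in (-T)..T, H (σ0 + τ * I)
      have e : I • (U - V) = Y - X := by
        rw [smul_sub]
        linear_combination key
      have : ‖U - V‖ = ‖Y - X‖ := by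
        rw [← e, norm_smul]; simp
      rw [this]
      have := norm_sub_le Y X
      linarith
    · refine hc.mono ?_
      intro z hz
      rw [Complex.mem_reProdIm] at hz
      simp only at hz
      rw [Set.uIcc_of_le h01] at hz
      exact hz.1
    · rintro z ⟨hz, hz0⟩
      rw [Complex.mem_reProdIm] at hz
      simp only [min_eq_left h01, max_eq_right h01] at hz
      exact hd z hz.1.1 hz.1.2 (by simpa using hz0)
  have t2 : Tendsto (fun T : ℝ => 2 * (K * (1 + T) ^ (-1 : ℝ) * (σ1 - σ0))) atTop (𝓝 0) := by
    have : Tendsto (fun T : ℝ => (1 + T) ^ (-1 : ℝ)) atTop (𝓝 0) :=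
      (tendsto_rpow_neg_atTop (by norm_num : (0:ℝ) < 1)).comp (tendsto_atTop_add_const_left _ 1 tendsto_id)
    have := ((this.const_mul K).mul_const (σ1 - σ0)).const_mul 2
    simpa using this
  have t3 := squeeze_zero_norm' (f := fun T : ℝ => (∫ τ in (-T)..T, H (σ1 + τ * I)) - ∫ τ in (-T)..T, H (σ0 + τ * I))
    (by filter_upwards [eventually_ge_atTop 0] with T hT using hrect T hT) t2
  have t4 := tendsto_nhds_unique t3 (t1.sub t0)
  exact (sub_eq_zero.mp t4.symm).symm

lemma rpow_combine {x K K' r s : ℝ} (hx : 0 ≤ x) {A B : ℝ} (hA : A ≤ K * (1 + x) ^ r)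
    (hA0 : 0 ≤ A) (hB0 : 0 ≤ B) (hB : B ≤ K' * (1 + x) ^ s) : A * B ≤ K * K' * (1 + x) ^ (r + s) := by
  have := mul_le_mul hA hB hB0 (hA0.trans hA)
  rw [Real.rpow_add (by positivity)]
  linarith

lemma right_line {a : ℝ} (ha : 0 < a) {f : ℕ → ℂ} {w : ℂ} {σ : ℝ} (hf : LSeriesSummable f (w + σ)) :
    MeasureTheory.Integrable (fun τ : ℝ => LSeries f (w + (σ + τ * I)) * Fk a (σ + τ * I)) ∧
    ∫ τ : ℝ, LSeries f (w + (σ + τ * I)) * Fk a (σ + τ * I) =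
      2 * π * ∑' n, LSeries.term f w n * tri a (Real.log n) := by
  set F : ℕ → ℝ → ℂ := fun n τ => LSeries.term f (w + (σ + τ * I)) n * Fk a (σ + τ * I) with hF
  have hFi := Fk_line_integrable ha σ
  have hterm : ∀ n (τ : ℝ), LSeries.term f (w + (σ + τ * I)) n = LSeries.term f w n * cexp (-((σ + τ * I) * (Real.log n : ℝ))) := by
    intro n τ
    rcases eq_or_ne n 0 with rfl | hn
    · simp
    · rw [LSeries.term_of_ne_zero hn, LSeries.term_of_ne_zero hn, Complex.cpow_add _ _ (by exact_mod_cast hn),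
        Complex.exp_neg, Complex.cpow_def_of_ne_zero (x := (n:ℂ)) (by exact_mod_cast hn) (σ + τ * I)]
      rw [← Complex.natCast_log, mul_comm ((Real.log n : ℝ) : ℂ)]
      rw [div_mul_eq_div_div, div_eq_mul_inv]
  have hnorm : ∀ n (τ : ℝ), ‖LSeries.term f (w + (σ + τ * I)) n‖ = ‖LSeries.term f (w + σ) n‖ := by
    intro n τ
    apply le_antisymm
    · exact LSeries.norm_term_le_of_re_le_re f (by simp) n
    · exact LSeries.norm_term_le_of_re_le_re f (by simp) n
  have hFint : ∀ n, MeasureTheory.Integrable (F n) := by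
    intro n
    rw [hF]
    simp only [hterm]
    have := Fk_continuous a
    refine (hFi.norm.const_mul ‖LSeries.term f (w + σ) n‖).mono' (Continuous.aestronglyMeasurable (by fun_prop)) ?_
    refine Filter.Eventually.of_forall fun τ => ?_
    rw [norm_mul, ← hterm, hnorm]
  have hsum : Summable fun n => ∫ τ, ‖F n τ‖ := by
    have : ∀ n, ∫ τ, ‖F n τ‖ = ‖LSeries.term f (w + σ) n‖ * ∫ τ : ℝ, ‖Fk a (σ + τ * I)‖ := by
      intro n
      rw [← MeasureTheory.integral_const_mul]
      congr 1
      ext τ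
      rw [hF, norm_mul, hnorm]
    simp_rw [this]
    exact (hf.norm).mul_right _
  have hts : ∀ τ : ℝ, LSeries f (w + (σ + τ * I)) * Fk a (σ + τ * I) = ∑' n, F n τ := by
    intro τ
    rw [LSeries, tsum_mul_right]
  constructor
  · simp_rw [hts]
    · refine (hFi.norm.const_mul (∑' n, ‖LSeries.term f (w + σ) n‖)).mono' ?_ ?_
      · simp_rw [← hts]
        have hc1 : Continuous fun τ : ℝ => LSeries f (w + (σ + τ * I)) := by
          unfold LSeries
          refine continuous_tsum (u := fun n => ‖LSeries.term f (w + σ) n‖) ?_ hf.norm ?_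
          · intro n
            simp only [hterm]
            fun_prop
          · intro n τ
            rw [hnorm]
        have := Fk_continuous a
        exact Continuous.aestronglyMeasurable (by fun_prop)
      · refine Filter.Eventually.of_forall fun τ => ?_
        rw [← hts, norm_mul]
        refine mul_le_mul_of_nonneg_right ?_ (norm_nonneg _)
        rw [LSeries]
        refine (norm_tsum_le_tsum_norm ?_).trans (le_of_eq ?_)
        · simp_rw [hnorm]; exact hf.norm
        · simp_rw [hnorm]
  · simp_rw [hts]
    rw [← MeasureTheory.integral_tsum_of_summable_integral_norm hFint hsum, ← tsum_mul_left]
    congr 1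
    ext n
    rw [hF]
    simp only [hterm]
    have := Fk_inversion ha σ (Real.log n)
    calc _ = LSeries.term f w n * ∫ τ : ℝ, Fk a (σ + τ * I) * cexp (-((σ + τ * I) * (Real.log n : ℝ))) := by
          rw [← MeasureTheory.integral_const_mul]
          congr 1; ext τ; ring
      _ = _ := by rw [this]; ring

lemma tri_shift {a : ℝ} (ha : 0 < a) {D : ℂ → ℂ} {f : ℕ → ℂ} {w : ℂ} {σ0 σ1 K : ℝ} (h01 : σ0 ≤ σ1)
    (hD : ∀ z : ℂ, σ0 ≤ z.re → z.re ≤ σ1 → DifferentiableAt ℂ D z)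
    (hb : ∀ z : ℂ, σ0 ≤ z.re → z.re ≤ σ1 → ‖D z‖ ≤ K * (1 + |z.im|) ^ (1 : ℝ))
    (hb0 : ∀ τ : ℝ, ‖D (σ0 + τ * I)‖ ≤ K * (1 + |τ|) ^ (1 / 2 : ℝ))
    (hs : LSeriesSummable f (w + σ1))
    (hr : ∀ τ : ℝ, D (σ1 + τ * I) = LSeries f (w + (σ1 + τ * I))) :
    MeasureTheory.Integrable (fun τ : ℝ => D (σ0 + τ * I) * Fk a (σ0 + τ * I)) ∧
    ∫ τ : ℝ, D (σ0 + τ * I) * Fk a (σ0 + τ * I) =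
      2 * π * ∑' n, LSeries.term f w n * tri a (Real.log n) := by
  obtain ⟨r1, r2⟩ := right_line ha hs
  simp_rw [← hr] at r1 r2
  set R := max |σ0| |σ1| with hR
  set K' := 4 * (a + 2 / a) * Real.exp (R * a) with hK'
  have hFb : ∀ z : ℂ, σ0 ≤ z.re → z.re ≤ σ1 → ‖Fk a z‖ ≤ K' * (1 + |z.im|) ^ (-2 : ℝ) := by
    intro z h0 h1
    exact Fk_bound ha (abs_le_max_abs_abs h0 h1)
  have i0 : MeasureTheory.Integrable (fun τ : ℝ => D (σ0 + τ * I) * Fk a (σ0 + τ * I)) := by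
    refine (integrable_pow_aux (r := 3 / 2) (by norm_num) (K * K')).mono' ?_ ?_
    · have h1 : Continuous fun τ : ℝ => D (σ0 + τ * I) := by
        rw [continuous_iff_continuousAt]
        intro τ
        have h2 : ContinuousAt D (σ0 + τ * I) := (hD _ (by simp) (by simpa using h01)).continuousAt
        exact ContinuousAt.comp (f := fun τ : ℝ => ((σ0:ℂ) + τ * I)) h2 (by fun_prop)
      have := Fk_continuous a
      exact (h1.mul (by fun_prop)).aestronglyMeasurable
    · refine Filter.Eventually.of_forall fun τ => ?_
      have h1 := hFb (σ0 + τ * I) (by simp) (by simpa using h01)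
      have him : ((σ0:ℂ) + τ * I).im = τ := by simp
      rw [him] at h1
      rw [norm_mul]
      have := rpow_combine (abs_nonneg τ) (hb0 τ) (norm_nonneg _) (norm_nonneg _) h1
      norm_num at this ⊢
      exact this
  refine ⟨i0, ?_⟩
  rw [← r2]
  refine vert_shift (H := fun z => D z * Fk a z) (K := K * K') h01 ?_ ?_ ?_ i0 r1
  · intro z hz
    exact ((hD z hz.1 hz.2).continuousAt.mul (Fk_continuous a).continuousAt).continuousWithinAt
  · intro z h0 h1 hz
    exact (hD z h0.le h1.le).mul (Fk_differentiableAt a ha z hz)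
  · intro z h0 h1
    rw [norm_mul]
    have := rpow_combine (abs_nonneg z.im) (hb z h0 h1) (norm_nonneg _) (norm_nonneg _) (hFb z h0 h1)
    norm_num at this ⊢
    exact this


/-! ### Part 3e : upper bound for log |L| -/

lemma hasDerivAt_posPart_sq (x : ℝ) : HasDerivAt (fun x : ℝ => (max 0 x) ^ 2) (2 * max 0 x) x := by
  rcases lt_trichotomy x 0 with h | h | h
  · rw [max_eq_left h.le, mul_zero]
    refine (hasDerivAt_const x (0:ℝ)).congr_of_eventuallyEq ?_
    filter_upwards [isOpen_Iio.mem_nhds h] with y hy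
    rw [max_eq_left (le_of_lt hy)]; norm_num
  · subst h
    rw [max_self, mul_zero, hasDerivAt_iff_isLittleO_nhds_zero]
    simp only [zero_add, max_self, smul_zero, sub_zero]
    have : (fun h : ℝ => (max 0 h) ^ 2) =O[nhds 0] fun h : ℝ => h ^ 2 := by
      refine Asymptotics.IsBigO.of_bound 1 (Filter.Eventually.of_forall fun h => ?_)
      rw [one_mul, Real.norm_eq_abs, Real.norm_eq_abs, abs_of_nonneg (by positivity), abs_of_nonneg (by positivity)]
      rcases le_total 0 h with h0 | h0
      · rw [max_eq_right h0]
      · rw [max_eq_left h0]; nlinarith [sq_nonneg h]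
    have h2 : (fun h : ℝ => h ^ 2) =o[nhds 0] fun h : ℝ => h := Asymptotics.isLittleO_pow_id (by norm_num)
    simpa using this.trans_isLittleO h2
  · rw [max_eq_right h.le]
    have := hasDerivAt_pow 2 x
    refine (this.congr_of_eventuallyEq ?_).congr_deriv (by simp)
    filter_upwards [isOpen_Ioi.mem_nhds h] with y hy
    rw [max_eq_right (le_of_lt hy)]

lemma tsum_cut {g : ℕ → ℝ} {Y : ℝ} {N : ℕ} (hN : Real.exp Y ≤ N) (hg : ∀ n : ℕ, Y ≤ Real.log n → g n = 0) :
    ∑' n, g n = ∑ n ∈ range N, g n := by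
  apply tsum_eq_sum
  intro n hn
  rw [Finset.mem_range, not_lt] at hn
  apply hg
  have : (N:ℝ) ≤ n := by exact_mod_cast hn
  rw [Real.le_log_iff_exp_le (lt_of_lt_of_le (Real.exp_pos Y) (hN.trans this))]
  exact hN.trans this

noncomputable def Sq (b : ℕ → ℝ) (Y : ℝ) : ℝ := ∑' n : ℕ, b n * (max 0 (Y - Real.log n)) ^ 2
noncomputable def Sl (b : ℕ → ℝ) (Y : ℝ) : ℝ := ∑' n : ℕ, b n * (max 0 (Y - Real.log n))

lemma Sq_hasDerivAt (b : ℕ → ℝ) (Y : ℝ) : HasDerivAt (Sq b) (2 * Sl b Y) Y := by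
  set N := ⌈Real.exp (Y + 1)⌉₊
  have hN : Real.exp (Y + 1) ≤ N := Nat.le_ceil _
  have e1 : Sl b Y = ∑ n ∈ range N, b n * (max 0 (Y - Real.log n)) := by
    apply tsum_cut (Y := Y) ((Real.exp_le_exp.mpr (by linarith)).trans hN)
    intro n hn
    rw [max_eq_left (by linarith), mul_zero]
  rw [e1, Finset.mul_sum]
  have h2 : HasDerivAt (fun Z => ∑ n ∈ range N, b n * (max 0 (Z - Real.log n)) ^ 2)
      (∑ n ∈ range N, 2 * (b n * (max 0 (Y - Real.log n)))) Y := by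
    refine HasDerivAt.fun_sum fun n _ => ?_
    have := ((hasDerivAt_posPart_sq (Y - Real.log n)).comp_sub_const Y (Real.log n)).const_mul (b n)
    refine this.congr_deriv (by ring)
  refine h2.congr_of_eventuallyEq ?_
  filter_upwards [isOpen_Iio.mem_nhds (show Y ∈ Set.Iio (Y + 1) by simp)] with Z hZ
  apply tsum_cut (Y := Y + 1) hN
  intro n hn
  have hZ : Z < Y + 1 := hZ
  rw [max_eq_left (by linarith)]; ring

lemma tri_log {Y : ℝ} (hY : 0 < Y) (n : ℕ) : Y * tri Y (Real.log n) = max 0 (Y - Real.log n) := by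
  unfold tri
  rw [abs_of_nonneg (Real.log_natCast_nonneg n), mul_max_of_nonneg _ _ hY.le, mul_zero]
  congr 1
  field_simp

lemma Sl_eq (b : ℕ → ℝ) {Y : ℝ} (hY : 0 < Y) : Sl b Y = Y * ∑' n : ℕ, b n * tri Y (Real.log n) := by
  rw [← tsum_mul_left, Sl]
  congr 1
  ext n
  rw [← tri_log hY]; ring

lemma Sd_eq (b : ℕ → ℝ) {Y : ℝ} (hY : 0 < Y) :
    Y * ∑' n : ℕ, b n * Real.log n * tri Y (Real.log n) = Y * Sl b Y - Sq b Y := by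
  rw [← tsum_mul_left, Sl, Sq]
  set N := ⌈Real.exp Y⌉₊
  have hN : Real.exp Y ≤ N := Nat.le_ceil _
  rw [tsum_cut (Y := Y) hN, tsum_cut (Y := Y) hN, tsum_cut (Y := Y) hN, Finset.mul_sum, ← Finset.sum_sub_distrib]
  · refine Finset.sum_congr rfl fun n _ => ?_
    rw [show Y * (b n * Real.log n * tri Y (Real.log n)) = b n * Real.log n * (Y * tri Y (Real.log n)) by ring, tri_log hY]
    rcases le_total 0 (Y - Real.log n) with h | h
    · rw [max_eq_right h]; ring
    · rw [max_eq_left h]; ring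
  · intro n hn; rw [max_eq_left (by linarith)]; ring
  · intro n hn; rw [max_eq_left (by linarith)]; ring
  · intro n hn
    rw [tri_eq_zero hY (by rw [abs_of_nonneg (Real.log_natCast_nonneg n)]; exact hn)]; ring

open Filter Topology in
lemma sq_compare (b : ℕ → ℝ) (M g : ℝ)
    (hM : ∀ Y : ℝ, 1 ≤ Y → ∑' n : ℕ, b n * Real.log n * tri Y (Real.log n) ≤ M)
    (hT : Tendsto (fun Y => ∑' n : ℕ, b n * tri Y (Real.log n)) atTop (𝓝 g)) (L : ℝ) (hL : 1 ≤ L) :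
    g ≤ Sq b L / L ^ 2 + 2 * M / L := by
  have hE : AntitoneOn (fun Y => Sq b Y / Y ^ 2 + 2 * M / Y) (Set.Ici 1) := by
    have hder : ∀ Y : ℝ, 1 ≤ Y → HasDerivAt (fun Y => Sq b Y / Y ^ 2 + 2 * M / Y)
        (2 / Y ^ 2 * (∑' n : ℕ, b n * Real.log n * tri Y (Real.log n) - M)) Y := by
      intro Y hY
      have hY0 : Y ≠ 0 := by linarith
      have h1 := (Sq_hasDerivAt b Y).div (hasDerivAt_pow 2 Y) (by positivity)
      have h2 := (hasDerivAt_const Y (2 * M)).div (hasDerivAt_id Y) hY0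
      refine (h1.add h2).congr_deriv ?_
      have e := Sd_eq b (Y := Y) (by linarith)
      have e' : ∑' n : ℕ, b n * Real.log n * tri Y (Real.log n) = (Y * Sl b Y - Sq b Y) / Y := by
        rw [← e]; field_simp
      rw [e']
      simp only [id]
      field_simp
      push_cast
      ring
    apply antitoneOn_of_deriv_nonpos (convex_Ici 1)
    · intro Y hY
      exact (hder Y hY).continuousAt.continuousWithinAt
    · intro Y hY
      rw [interior_Ici] at hY
      exact (hder Y (le_of_lt hY)).differentiableAt.differentiableWithinAt
    · intro Y hY
      rw [interior_Ici] at hY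
      rw [(hder Y (le_of_lt hY)).deriv]
      have := hM Y (le_of_lt hY)
      have h3 : 0 ≤ 2 / Y ^ 2 := by positivity
      nlinarith
  have key : ∀ ε : ℝ, 0 < ε → g - ε ≤ Sq b L / L ^ 2 + 2 * M / L := by
    intro ε hε
    have h1 : ∀ᶠ Y in atTop, g - ε ≤ ∑' n : ℕ, b n * tri Y (Real.log n) :=
      (hT.eventually (lt_mem_nhds (show g - ε < g by linarith))).mono fun _ h => h.le
    obtain ⟨Y0, hY0⟩ := (h1.and (eventually_ge_atTop (max 1 L))).exists_forall_of_atTop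
    have hY01 : max 1 L ≤ Y0 := (hY0 Y0 le_rfl).2
    have hY1 : 1 ≤ Y0 := (le_max_left _ _).trans hY01
    have hder : ∀ Y : ℝ, HasDerivAt (fun Y => Sq b Y - Y ^ 2 * (g - ε)) (2 * Sl b Y - 2 * Y * (g - ε)) Y := by
      intro Y
      have := (Sq_hasDerivAt b Y).sub ((hasDerivAt_pow 2 Y).mul_const (g - ε))
      exact this.congr_deriv (by simp)
    have hmono : MonotoneOn (fun Y => Sq b Y - Y ^ 2 * (g - ε)) (Set.Ici Y0) := by
      apply monotoneOn_of_deriv_nonneg (convex_Ici Y0)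
      · intro Y _; exact (hder Y).continuousAt.continuousWithinAt
      · intro Y _; exact (hder Y).differentiableAt.differentiableWithinAt
      · intro Y hY
        rw [interior_Ici] at hY
        rw [(hder Y).deriv, Sl_eq b (by have : Y0 < Y := hY; linarith)]
        have h2 := (hY0 Y (le_of_lt hY)).1
        have h3 : 0 ≤ Y := by have : Y0 < Y := hY; linarith
        nlinarith
    have hlow : ∀ᶠ Y in atTop, (g - ε) + (Sq b Y0 - Y0 ^ 2 * (g - ε)) / Y ^ 2 + 2 * M / Y ≤ Sq b L / L ^ 2 + 2 * M / L := by
      filter_upwards [eventually_ge_atTop Y0] with Y hY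
      have h2 := hE (show L ∈ Set.Ici (1:ℝ) from hL) (show Y ∈ Set.Ici (1:ℝ) from hY1.trans hY)
        (((le_max_right _ _).trans hY01).trans hY)
      have h3 := hmono (Set.mem_Ici.mpr (le_refl Y0)) (show Y ∈ Set.Ici Y0 from hY) hY
      simp only at h2 h3
      refine le_trans ?_ h2
      have hYp : 0 < Y ^ 2 := by have : 0 < Y := by linarith
                                 positivity
      have : (g - ε) + (Sq b Y0 - Y0 ^ 2 * (g - ε)) / Y ^ 2 ≤ Sq b Y / Y ^ 2 := by
        rw [← sub_nonneg]
        have : Sq b Y / Y ^ 2 - (g - ε + (Sq b Y0 - Y0 ^ 2 * (g - ε)) / Y ^ 2) =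
          ((Sq b Y - Y ^ 2 * (g - ε)) - (Sq b Y0 - Y0 ^ 2 * (g - ε))) / Y ^ 2 := by
          have hYne : Y ≠ 0 := by linarith
          field_simp; ring
        rw [this]
        exact div_nonneg (by linarith) hYp.le
      linarith
    have hlim : Tendsto (fun Y : ℝ => (g - ε) + (Sq b Y0 - Y0 ^ 2 * (g - ε)) / Y ^ 2 + 2 * M / Y) atTop (𝓝 (g - ε + 0 + 0)) := by
      refine (tendsto_const_nhds.add ?_).add ?_
      · exact tendsto_const_nhds.div_atTop (tendsto_pow_atTop (by norm_num))
      · exact tendsto_const_nhds.div_atTop tendsto_id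
    have := le_of_tendsto hlim hlow
    linarith
  refine le_of_forall_pos_le_add fun ε hε => ?_
  linarith [key ε hε]

/-! kernel at a=1 on imaginary axis -/

noncomputable def rk (v : ℝ) : ℝ := (Fk 1 (v * I)).re

lemma rk_eq (v : ℝ) : Fk 1 (v * I) = (rk v : ℂ) := by
  obtain ⟨r, _, h⟩ := Fk_imag 1 one_pos v
  unfold rk
  rw [h]; simp

lemma rk_nonneg (v : ℝ) : 0 ≤ rk v := by
  obtain ⟨r, h0, h⟩ := Fk_imag 1 one_pos v
  unfold rk
  rw [h]; simpa using h0

lemma rk_le (v : ℝ) : rk v ≤ 12 * (1 + |v|) ^ (-2 : ℝ) := by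
  have := Fk_bound (a := 1) one_pos (z := v * I) (R := 0) (by simp)
  have h2 := (Complex.re_le_norm (Fk 1 (v * I))).trans this
  have him : ((v:ℂ) * I).im = v := by simp
  rw [him] at h2
  norm_num at h2 ⊢
  exact h2

lemma rk_continuous : Continuous rk := by
  unfold rk
  have := Fk_continuous 1
  fun_prop

lemma rk_integral : ∫ v, rk v = 2 * π := by
  have := Fk_inversion (a := 1) one_pos 0 0
  simp only [Complex.ofReal_zero, zero_add, mul_zero, neg_zero, Complex.exp_zero, mul_one, rk_eq] at this
  rw [integral_complex_ofReal] at this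
  have h2 : tri 1 0 = 1 := by simp [tri]
  rw [h2, Complex.ofReal_one, mul_one] at this
  exact_mod_cast this

lemma scale_int {a : ℝ} (ha : 0 < a) (D : ℂ → ℂ) :
    ∫ τ : ℝ, D (τ * I) * Fk a (τ * I) = ∫ v : ℝ, D (((v / a : ℝ) : ℂ) * I) * rk v := by
  have := MeasureTheory.Measure.integral_comp_div (fun τ : ℝ => D (τ * I) * Fk a (τ * I)) a
  rw [abs_of_pos ha] at this
  have ha' : (a:ℂ) ≠ 0 := by exact_mod_cast ha.ne'
  have e : ∀ v : ℝ, D (((v / a : ℝ) : ℂ) * I) * Fk a (((v / a : ℝ) : ℂ) * I) = a * (D (((v / a : ℝ) : ℂ) * I) * rk v) := by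
    intro v
    rw [← rk_eq]
    have : ((v / a : ℝ) : ℂ) * I = (v * I) / a := by push_cast; ring
    rw [this, Fk_scale a ha]; ring
  simp_rw [e] at this
  rw [MeasureTheory.integral_const_mul, Complex.real_smul] at this
  exact (mul_left_cancel₀ ha' this).symm

lemma tri_shift0 {D : ℂ → ℂ} {f : ℕ → ℂ} {w : ℂ} {σ1 K : ℝ} (h01 : 0 ≤ σ1)
    (hD : ∀ z : ℂ, 0 ≤ z.re → z.re ≤ σ1 → DifferentiableAt ℂ D z) (hK : 0 ≤ K)
    (hb : ∀ z : ℂ, 0 ≤ z.re → z.re ≤ σ1 → ‖D z‖ ≤ K * (1 + |z.im|) ^ (1 / 2 : ℝ))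
    (hs : LSeriesSummable f (w + σ1))
    (hr : ∀ τ : ℝ, D (σ1 + τ * I) = LSeries f (w + (σ1 + τ * I))) {a : ℝ} (ha : 1 ≤ a) :
    MeasureTheory.Integrable (fun v : ℝ => (D (((v / a : ℝ) : ℂ) * I)).re * rk v) ∧
    ∫ v : ℝ, (D (((v / a : ℝ) : ℂ) * I)).re * rk v =
      2 * π * ∑' n, (LSeries.term f w n).re * tri a (Real.log n) := by
  have ha0 : 0 < a := by linarith
  have hDc : ∀ τ : ℝ, ContinuousAt D (τ * I) := fun τ => (hD _ (by simp) (by simpa using h01)).continuousAt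
  have hDc' : Continuous fun v : ℝ => D (((v / a : ℝ) : ℂ) * I) := by
    rw [continuous_iff_continuousAt]
    intro v
    exact ContinuousAt.comp (f := fun v : ℝ => (((v / a : ℝ) : ℂ) * I)) (hDc _) (by fun_prop)
  have hintg : MeasureTheory.Integrable (fun v : ℝ => D (((v / a : ℝ) : ℂ) * I) * (rk v : ℂ)) := by
    refine (integrable_pow_aux (r := 3 / 2) (by norm_num) (K * 12)).mono' ?_ ?_
    · have := rk_continuous
      exact (hDc'.mul (by fun_prop)).aestronglyMeasurable
    · refine Filter.Eventually.of_forall fun v => ?_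
      rw [norm_mul, Complex.norm_real, Real.norm_eq_abs, abs_of_nonneg (rk_nonneg v)]
      have h1 := hb (((v / a : ℝ) : ℂ) * I) (by simp) (by simpa using h01)
      have him : (((v / a : ℝ) : ℂ) * I).im = v / a := by simp
      rw [him] at h1
      have h2 : |v / a| ≤ |v| := by
        rw [abs_div, abs_of_pos ha0]
        exact div_le_self (abs_nonneg v) ha
      have h3 : ‖D (((v / a : ℝ) : ℂ) * I)‖ ≤ K * (1 + |v|) ^ (1 / 2 : ℝ) := by
        refine h1.trans ?_
        gcongr
      have := rpow_combine (abs_nonneg v) h3 (norm_nonneg _) (rk_nonneg v) (rk_le v)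
      norm_num at this ⊢
      exact this
  have hre : ∀ v : ℝ, (D (((v / a : ℝ) : ℂ) * I)).re * rk v = (D (((v / a : ℝ) : ℂ) * I) * (rk v : ℂ)).re := by
    intro v; simp
  simp_rw [hre]
  refine ⟨hintg.re, ?_⟩
  have e1 : ∫ v : ℝ, (D (((v / a : ℝ) : ℂ) * I) * (rk v : ℂ)).re = (∫ v : ℝ, D (((v / a : ℝ) : ℂ) * I) * (rk v : ℂ)).re :=
    Complex.reCLM.integral_comp_comm hintg
  rw [e1, ← scale_int ha0]
  have hsh := (tri_shift (σ0 := 0) ha0 h01 hD (K := K) ?_ ?_ hs hr).2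
  · simp only [Complex.ofReal_zero, zero_add] at hsh
    rw [hsh]
    set N := ⌈Real.exp a⌉₊
    have hN : Real.exp a ≤ N := Nat.le_ceil _
    have hz : ∀ n : ℕ, a ≤ Real.log n → tri a (Real.log n) = 0 := by
      intro n hn
      exact tri_eq_zero ha0 (by rw [abs_of_nonneg (Real.log_natCast_nonneg n)]; exact hn)
    rw [tsum_cut (Y := a) hN (fun n hn => by rw [hz n hn, mul_zero]), tsum_eq_sum (s := range N)]
    · have : (2 * (π:ℂ)) = ((2 * π : ℝ) : ℂ) := by push_cast; ring
      rw [this, Complex.re_ofReal_mul, Complex.re_sum]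
      congr 1
      refine Finset.sum_congr rfl fun n _ => ?_
      simp
    · intro n hn
      rw [Finset.mem_range, not_lt] at hn
      have h1 : (N:ℝ) ≤ n := by exact_mod_cast hn
      rw [hz n, Complex.ofReal_zero, mul_zero]
      rw [Real.le_log_iff_exp_le (lt_of_lt_of_le (Real.exp_pos a) (hN.trans h1))]
      exact hN.trans h1
  · intro z h0 h1
    refine (hb z h0 h1).trans ?_
    have : 1 ≤ 1 + |z.im| := by linarith [abs_nonneg z.im]
    gcongr
    norm_num
  · intro τ
    have := hb ((0:ℝ) + τ * I) (by simp) (by simpa using h01)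
    simpa using this


/-! ### Part 3f : assembling the upper bound for log |L| -/

lemma log_QQ_growth (q : ℕ) [NeZero q] (t u : ℝ) :
    Real.log (QQ q (t + u)) ≤ (Real.log (QQ q t) + 2) * (1 + |u|) ^ (1 / 2 : ℝ) := by
  have h1 := log_QQ_add q t u
  have h2 := log_QQ_pos q t
  have h3 : Real.log (1 + |u|) ≤ (1 + |u|) ^ (1 / 2 : ℝ) / (1 / 2) :=
    Real.log_le_rpow_div (by positivity) (by norm_num)
  have h4 : 1 ≤ (1 + |u|) ^ (1 / 2 : ℝ) := Real.one_le_rpow (by linarith [abs_nonneg u]) (by norm_num)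
  nlinarith

noncomputable def Jc : ℝ := ∫ v : ℝ, Real.log (1 + |v|) * rk v

lemma Jc_integrable : MeasureTheory.Integrable (fun v : ℝ => Real.log (1 + |v|) * rk v) := by
  refine (integrable_pow_aux (r := 3 / 2) (by norm_num) (2 * 12)).mono' ?_ ?_
  · have h1 := rk_continuous
    have h2 : Continuous fun v : ℝ => Real.log (1 + |v|) :=
      Continuous.log (by fun_prop) (fun v => by positivity)
    exact (h2.mul h1).aestronglyMeasurable
  · refine Filter.Eventually.of_forall fun v => ?_
    have h0 : 0 ≤ Real.log (1 + |v|) := Real.log_nonneg (by linarith [abs_nonneg v])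
    rw [Real.norm_eq_abs, abs_of_nonneg (mul_nonneg h0 (rk_nonneg v))]
    have h3 : Real.log (1 + |v|) ≤ 2 * (1 + |v|) ^ (1 / 2 : ℝ) := by
      have : Real.log (1 + |v|) ≤ (1 + |v|) ^ (1 / 2 : ℝ) / (1 / 2) :=
        Real.log_le_rpow_div (by positivity) (by norm_num)
      linarith
    have := rpow_combine (abs_nonneg v) h3 h0 (rk_nonneg v) (rk_le v)
    norm_num at this ⊢
    exact this

lemma Jc_nonneg : 0 ≤ Jc := by
  unfold Jc
  refine MeasureTheory.integral_nonneg fun v => ?_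
  exact mul_nonneg (Real.log_nonneg (by linarith [abs_nonneg v])) (rk_nonneg v)

lemma rk_integrable : MeasureTheory.Integrable rk := by
  refine (integrable_pow_aux (r := 2) (by norm_num) 12).mono' rk_continuous.aestronglyMeasurable ?_
  refine Filter.Eventually.of_forall fun v => ?_
  rw [Real.norm_eq_abs, abs_of_nonneg (rk_nonneg v)]
  exact rk_le v

/-- real parts of the terms of log L -/
noncomputable def bt {q : ℕ} (χ : DirichletCharacter ℂ q) (s : ℂ) (n : ℕ) : ℝ :=
  (LSeries.term (bc χ) s n).re

lemma bt_log {q : ℕ} (χ : DirichletCharacter ℂ q) (s : ℂ) (n : ℕ) :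
    (LSeries.term (LSeries.logMul (bc χ)) s n).re = bt χ s n * Real.log n := by
  unfold bt
  rcases eq_or_ne n 0 with rfl | hn
  · simp
  · rw [LSeries.term_of_ne_zero hn, LSeries.term_of_ne_zero hn, LSeries.logMul, ← Complex.natCast_log,
      mul_div_assoc, Complex.re_ofReal_mul, mul_comm]

lemma D_upper {q : ℕ} [NeZero q] {χ : DirichletCharacter ℂ q} (hχ : χ ≠ 1) {G : ℂ → ℂ}
    (hG : IsLogL χ G) {c : ℝ} (hc : 1 / 2 < c) (hc1 : c ≤ 3 / 4) (t : ℝ) {a : ℝ} (ha : 1 ≤ a) :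
    ∑' n : ℕ, bt χ ⟨c, t⟩ n * Real.log n * tri a (Real.log n) ≤
      6000 * (1 + 3 / 2 * Jc) * Real.log (QQ q t) := by
  set w : ℂ := ⟨c, t⟩ with hw
  have hwre : w.re = c := rfl
  have hwim : w.im = t := rfl
  have hlq := log_QQ_pos q t
  have hUo : IsOpen {s : ℂ | 1 / 2 < s.re} := isOpen_lt continuous_const Complex.continuous_re
  have hab : ∀ s : ℂ, 1 < s.re → LSeries.abscissaOfAbsConv (bc χ) < s.re := fun s hs =>
    lt_of_le_of_lt (bc_abscissa χ) (by exact_mod_cast hs)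
  have hη : 0 < (c - 1 / 2) / 2 := by linarith
  have key := tri_shift0 (D := fun z => - deriv G (w + z)) (f := LSeries.logMul (bc χ)) (w := w) (σ1 := 2)
    (K := 54 / ((c - 1 / 2) / 2) ^ 2 * (Real.log (QQ q t) + 2)) (by norm_num) ?_ (by positivity) ?_ ?_ ?_ ha
  · obtain ⟨ki, ke⟩ := key
    simp_rw [bt_log] at ke
    have hle : ∫ v : ℝ, (- deriv G (w + ((v / a : ℝ) : ℂ) * I)).re * rk v ≤
        ∫ v : ℝ, (6000 * Real.log (QQ q t) * rk v + 6000 * (Real.log (1 + |v|) * rk v)) := by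
      refine MeasureTheory.integral_mono ki ((rk_integrable.const_mul _).add (Jc_integrable.const_mul _)) fun v => ?_
      have h1 := psi_re_lower hχ hG hc hc1 (t + v / a)
      have e : w + ((v / a : ℝ) : ℂ) * I = ⟨c, t + v / a⟩ := by
        apply Complex.ext <;> simp [hwre, hwim]
      have h2 := log_QQ_add q t (v / a)
      have h3 : Real.log (1 + |v / a|) ≤ Real.log (1 + |v|) := by
        apply Real.log_le_log (by positivity)
        rw [abs_div, abs_of_pos (by linarith : 0 < a)]
        linarith [div_le_self (abs_nonneg v) ha]
      simp only [e, Complex.neg_re]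
      have h4 : -(deriv G ⟨c, t + v / a⟩).re ≤ 6000 * Real.log (QQ q t) + 6000 * Real.log (1 + |v|) := by linarith
      have := mul_le_mul_of_nonneg_right h4 (rk_nonneg v)
      linarith
    rw [ke, MeasureTheory.integral_add (rk_integrable.const_mul _) (Jc_integrable.const_mul _),
      MeasureTheory.integral_const_mul, MeasureTheory.integral_const_mul, rk_integral] at hle
    change _ ≤ _ + 6000 * Jc at hle
    have hJ := Jc_nonneg
    have hpi : 3 < π := Real.pi_gt_three
    have h5 : 6000 * Jc ≤ 2 * π * (6000 * (3 / 2 * Jc) * Real.log (QQ q t)) := by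
      have h6 : Jc ≤ 3 / 2 * Jc * Real.log (QQ q t) := by nlinarith
      have h7 : 0 ≤ 3 / 2 * Jc * Real.log (QQ q t) := by positivity
      nlinarith
    have h8 : 2 * π * ∑' n : ℕ, bt χ w n * Real.log n * tri a (Real.log n) ≤ 2 * π * (6000 * (1 + 3 / 2 * Jc) * Real.log (QQ q t)) := by
      linarith
    exact le_of_mul_le_mul_left h8 (by positivity)
  · intro z h0 h1
    have hd : DifferentiableOn ℂ (deriv G) {s : ℂ | 1 / 2 < s.re} := hG.1.deriv hUo
    have hd2 : DifferentiableAt ℂ (deriv G) (w + z) :=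
      hd.differentiableAt (hUo.mem_nhds (by simp only [Set.mem_ofPred_eq, Complex.add_re, hwre]; linarith))
    exact (hd2.comp z (differentiableAt_id.const_add w)).neg
  · intro z h0 h1
    rw [norm_neg]
    have := psi_bound hχ hG hη (by linarith) (s := w + z) (by rw [Complex.add_re, hwre]; linarith)
    refine this.trans ?_
    rw [Complex.add_im, hwim, mul_assoc]
    gcongr
    exact log_QQ_growth q t z.im
  · refine LSeriesSummable_of_abscissaOfAbsConv_lt_re ?_
    rw [LSeries.abscissaOfAbsConv_logMul]
    exact hab _ (by simp [hwre]; linarith)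
  · intro τ
    have hs : 1 < (w + ((2:ℝ) + τ * I)).re := by simp [hwre]; linarith
    have e1 : deriv G (w + ((2:ℝ) + τ * I)) = deriv (LSeries (bc χ)) (w + ((2:ℝ) + τ * I)) := by
      apply Filter.EventuallyEq.deriv_eq
      filter_upwards [(isOpen_lt continuous_const Complex.continuous_re).mem_nhds hs] with s hs
      exact hG.2.2 s hs
    rw [e1, LSeries_deriv (hab _ hs), neg_neg]

open Filter Topology in
lemma T_tendsto {q : ℕ} [NeZero q] {χ : DirichletCharacter ℂ q} (hχ : χ ≠ 1) {G : ℂ → ℂ}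
    (hG : IsLogL χ G) {c : ℝ} (hc : 1 / 2 < c) (hc1 : c ≤ 3 / 4) (t : ℝ) :
    Tendsto (fun a => ∑' n : ℕ, bt χ ⟨c, t⟩ n * tri a (Real.log n)) atTop (𝓝 (G ⟨c, t⟩).re) := by
  set w : ℂ := ⟨c, t⟩ with hw
  have hwre : w.re = c := rfl
  have hwim : w.im = t := rfl
  have hlq := log_QQ_pos q t
  have hUo : IsOpen {s : ℂ | 1 / 2 < s.re} := isOpen_lt continuous_const Complex.continuous_re
  have hab : ∀ s : ℂ, 1 < s.re → LSeries.abscissaOfAbsConv (bc χ) < s.re := fun s hs =>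
    lt_of_le_of_lt (bc_abscissa χ) (by exact_mod_cast hs)
  have hη : 0 < (c - 1 / 2) := by linarith
  set K := 18 / (c - 1 / 2) * (Real.log (QQ q t) + 2) with hK
  have hdiff : ∀ z : ℂ, 0 ≤ z.re → DifferentiableAt ℂ (fun z => G (w + z)) z := by
    intro z h0
    have hd2 : DifferentiableAt ℂ G (w + z) :=
      hG.1.differentiableAt (hUo.mem_nhds (by simp only [Set.mem_ofPred_eq, Complex.add_re, hwre]; linarith))
    exact (hd2.comp z (differentiableAt_id.const_add w))
  have hbd : ∀ z : ℂ, 0 ≤ z.re → ‖G (w + z)‖ ≤ K * (1 + |z.im|) ^ (1 / 2 : ℝ) := by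
    intro z h0
    have := logL_bound hχ hG hη (by linarith) (s := w + z) (by rw [Complex.add_re, hwre]; linarith)
    refine this.trans ?_
    rw [Complex.add_im, hwim, hK, mul_assoc]
    gcongr
    exact log_QQ_growth q t z.im
  have key : ∀ a : ℝ, 1 ≤ a → MeasureTheory.Integrable (fun v : ℝ => (G (w + ((v / a : ℝ) : ℂ) * I)).re * rk v) ∧
    ∫ v : ℝ, (G (w + ((v / a : ℝ) : ℂ) * I)).re * rk v =
      2 * π * ∑' n, (LSeries.term (bc χ) w n).re * tri a (Real.log n) := by
    intro a ha
    refine tri_shift0 (D := fun z => G (w + z)) (f := (bc χ)) (w := w) (σ1 := 2)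
      (K := K) (by norm_num) (fun z h0 _ => hdiff z h0) (by positivity) (fun z h0 _ => hbd z h0) ?_ ?_ ha
    · exact LSeriesSummable_of_abscissaOfAbsConv_lt_re (hab _ (by simp [hwre]; linarith))
    · intro τ
      exact hG.2.2 _ (by simp [hwre]; linarith)
  have hlim : Tendsto (fun a : ℝ => ∫ v : ℝ, (G (w + ((v / a : ℝ) : ℂ) * I)).re * rk v) atTop
      (𝓝 (∫ v : ℝ, (G w).re * rk v)) := by
    refine MeasureTheory.tendsto_integral_filter_of_dominated_convergence
      (fun v => K * 12 * (1 + |v|) ^ (-(3 / 2) : ℝ)) ?_ ?_ (integrable_pow_aux (by norm_num) _) ?_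
    · filter_upwards [eventually_ge_atTop 1] with a ha using (key a ha).1.aestronglyMeasurable
    · filter_upwards [eventually_ge_atTop 1] with a ha
      refine Filter.Eventually.of_forall fun v => ?_
      rw [norm_mul, Real.norm_eq_abs, Real.norm_eq_abs, abs_of_nonneg (rk_nonneg v)]
      have h1 := (Complex.abs_re_le_norm _).trans (hbd (((v / a : ℝ) : ℂ) * I) (by simp))
      have him : (((v / a : ℝ) : ℂ) * I).im = v / a := by simp
      rw [him] at h1
      have h2 : |v / a| ≤ |v| := by
        rw [abs_div, abs_of_pos (by linarith : 0 < a)]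
        exact div_le_self (abs_nonneg v) ha
      have h3 := h1.trans (show _ ≤ K * (1 + |v|) ^ (1 / 2 : ℝ) by gcongr)
      have := rpow_combine (abs_nonneg v) h3 (abs_nonneg _) (rk_nonneg v) (rk_le v)
      norm_num at this ⊢
      exact this
    · refine Filter.Eventually.of_forall fun v => ?_
      refine Tendsto.mul_const _ ?_
      have hc0 : ContinuousAt (fun z => (G (w + z)).re) 0 :=
        Complex.continuous_re.continuousAt.comp (hdiff 0 (by simp)).continuousAt
      have h1 : Tendsto (fun a : ℝ => ((v / a : ℝ) : ℂ) * I) atTop (𝓝 0) := by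
        have : Tendsto (fun a : ℝ => v / a) atTop (𝓝 0) := tendsto_const_nhds.div_atTop tendsto_id
        have := ((Complex.continuous_ofReal.tendsto 0).comp this).mul_const I
        simpa [Function.comp_def] using this
      have := hc0.tendsto.comp h1
      simpa [Function.comp_def] using this
  rw [MeasureTheory.integral_const_mul, rk_integral] at hlim
  have h2 := hlim.const_mul (2 * π)⁻¹
  have e : (2 * π)⁻¹ * ((G w).re * (2 * π)) = (G w).re := by field_simp
  rw [e] at h2
  refine h2.congr' ?_
  filter_upwards [eventually_ge_atTop 1] with a ha
  rw [(key a ha).2]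
  simp only [bt]
  rw [← mul_assoc, inv_mul_cancel₀ (by positivity), one_mul]

lemma logL_upper : ∃ C1 : ℝ, 1 ≤ C1 ∧ ∀ (q : ℕ) [NeZero q] (χ : DirichletCharacter ℂ q) (_ : χ ≠ 1) (G : ℂ → ℂ)
    (_ : IsLogL χ G) (c : ℝ) (_ : 1 / 2 < c) (_ : c ≤ 3 / 4) (t L : ℝ) (_ : 1 ≤ L),
    (G ⟨c, t⟩).re ≤ Sq (bt χ ⟨c, t⟩) L / L ^ 2 + C1 * Real.log (QQ q t) / L := by
  have hJ := Jc_nonneg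
  refine ⟨2 * (6000 * (1 + 3 / 2 * Jc)), by linarith, ?_⟩
  intro q _ χ hχ G hG c hc hc1 t L hL
  have := sq_compare (bt χ ⟨c, t⟩) (6000 * (1 + 3 / 2 * Jc) * Real.log (QQ q t)) (G ⟨c, t⟩).re
    (fun Y hY => D_upper hχ hG hc hc1 t hY) (T_tendsto hχ hG hc hc1 t) L hL
  refine this.trans (le_of_eq ?_)
  ring


/-! ### Part 3g : sums over primes -/

lemma zeta_le {δ : ℝ} (hδ : 0 < δ) : ∑' n : ℕ, ((n : ℝ) ^ (1 + δ))⁻¹ ≤ 1 + 1 / δ := by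
  have hs : Summable (fun n : ℕ => ((n : ℝ) ^ (1 + δ))⁻¹) := Real.summable_nat_rpow_inv.2 (by linarith)
  have h := AntitoneOn.tsum_comp_add_le_integral (f := fun x : ℝ => x ^ (-(1 + δ))) 1 ?_ ?_ ?_
  · rw [← hs.sum_add_tsum_nat_add 2]
    have e : ∑ i ∈ range 2, ((i : ℝ) ^ (1 + δ))⁻¹ = 1 := by
      rw [Finset.sum_range_succ, Finset.sum_range_one]
      rw [Nat.cast_zero, Real.zero_rpow (by linarith)]; simp
    rw [e]
    gcongr
    rw [integral_Ioi_rpow_of_lt (by linarith) (by norm_num)] at h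
    refine le_trans (le_of_eq ?_) (h.trans (le_of_eq ?_))
    · refine tsum_congr fun n => ?_
      rw [Real.rpow_neg (by positivity)]
    · simp only [Nat.cast_one, Real.one_rpow]
      have : -(1 + δ) + 1 = -δ := by ring
      rw [this, neg_div_neg_eq]
  · intro a ha b hb hab
    simp only [Nat.cast_one, Set.mem_Ici] at ha hb
    exact Real.rpow_le_rpow_of_nonpos (by linarith) hab (by linarith)
  · exact integrableOn_Ioi_rpow_of_lt (by linarith) (by norm_num)
  · intro t ht
    simp only [Nat.cast_one, Set.mem_Ioi] at ht
    positivity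

lemma prime_sum_le {δ : ℝ} (hδ : 0 < δ) (P : Finset ℕ) (hP : ∀ p ∈ P, p.Prime) :
    ∑ p ∈ P, ((p : ℝ) ^ (1 + δ))⁻¹ ≤ Real.log (1 + 1 / δ) := by
  let f : ℕ →* ℝ :=
    { toFun := fun n => ((n : ℝ) ^ (1 + δ))⁻¹
      map_one' := by simp
      map_mul' := fun a b => by
        simp only [Nat.cast_mul]
        rw [Real.mul_rpow (by positivity) (by positivity), mul_inv] }
  have hf : ∀ n, f n = ((n : ℝ) ^ (1 + δ))⁻¹ := fun n => rfl
  have hs : Summable f := Real.summable_nat_rpow_inv.2 (by linarith)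
  have h := EulerProduct.prod_filter_prime_geometric_eq_tsum_factoredNumbers hs P
  rw [Finset.filter_true_of_mem hP] at h
  have h2 : ∑' m : Nat.factoredNumbers P, f m ≤ ∑' n, f n :=
    Summable.tsum_subtype_le f _ (fun n => by rw [hf]; positivity) hs
  have h3 : ∏ p ∈ P, (1 - f p)⁻¹ ≤ 1 + 1 / δ := h ▸ h2.trans (zeta_le hδ)
  have hlt : ∀ p ∈ P, 0 < 1 - f p := fun p hp => by
    rw [hf, sub_pos]
    apply inv_lt_one_of_one_lt₀
    exact Real.one_lt_rpow (by exact_mod_cast (hP p hp).one_lt) (by linarith)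
  have h4 := Real.log_le_log (Finset.prod_pos fun p hp => inv_pos.2 (hlt p hp)) h3
  rw [Real.log_prod (fun p hp => (inv_pos.2 (hlt p hp)).ne')] at h4
  refine le_trans (Finset.sum_le_sum fun p hp => ?_) h4
  rw [Real.log_inv]
  have := Real.log_le_sub_one_of_pos (hlt p hp)
  rw [← hf]
  linarith

lemma mertens2 {η : ℝ} (hη : 0 < η) : ∃ C : ℝ, 0 ≤ C ∧ ∀ L : ℝ, 1 ≤ L → ∀ P : Finset ℕ,
    (∀ p ∈ P, p.Prime ∧ (p : ℝ) ≤ Real.exp L) → ∑ p ∈ P, (1 / p : ℝ) ≤ (1 + η) * Real.log L + C := by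
  set μ := Real.log (1 + η) with hμ
  have hμ0 : 0 < μ := Real.log_pos (by linarith)
  refine ⟨(1 + η) * Real.log (1 + 1 / μ), mul_nonneg (by linarith) (Real.log_nonneg (by
    have : 0 < 1 / μ := by positivity
    linarith)), ?_⟩
  intro L hL P hP
  have hδ : 0 < μ / L := by positivity
  have h := prime_sum_le hδ P (fun p hp => (hP p hp).1)
  have h1 : ∑ p ∈ P, (1 / p : ℝ) ≤ (1 + η) * ∑ p ∈ P, ((p : ℝ) ^ (1 + μ / L))⁻¹ := by
    rw [Finset.mul_sum]
    refine Finset.sum_le_sum fun p hp => ?_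
    have hp0 : (0:ℝ) < p := by exact_mod_cast (hP p hp).1.pos
    rw [Real.rpow_add hp0, Real.rpow_one, mul_inv, one_div]
    have h5 : (p:ℝ) ^ (μ / L) ≤ 1 + η := by
      calc (p:ℝ) ^ (μ / L) ≤ (Real.exp L) ^ (μ / L) := by gcongr; exact (hP p hp).2
        _ = 1 + η := by
          rw [← Real.exp_mul, mul_div_cancel₀ _ (by positivity), hμ, Real.exp_log (by linarith)]
    have h6 : 0 < (p:ℝ) ^ (μ / L) := by positivity
    have h7 : 1 ≤ (1 + η) * ((p:ℝ) ^ (μ / L))⁻¹ := by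
      rw [← div_eq_mul_inv, le_div_iff₀ h6]; linarith
    have h8 : (0:ℝ) < (p:ℝ)⁻¹ := by positivity
    nlinarith
  refine h1.trans ?_
  rw [← mul_add]
  have : Real.log (1 + 1 / (μ / L)) ≤ Real.log L + Real.log (1 + 1 / μ) := by
    rw [← Real.log_mul (by positivity) (by positivity)]
    apply Real.log_le_log (by positivity)
    rw [one_div_div]
    have : L * (1 + 1 / μ) = L + L / μ := by ring
    linarith
  gcongr
  linarith

lemma mertens1 (N : ℕ) (hN : 1 ≤ N) :
    ∑ p ∈ Nat.primesLE N, Real.log p / p ≤ Real.log N + 2 := by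
  have hN0 : (0:ℝ) < N := by exact_mod_cast hN
  have hpr : ∀ p ∈ Nat.primesLE N, p.Prime := fun p hp => (Nat.mem_primesLE.1 hp).2
  have hle : ∀ p ∈ Nat.primesLE N, p ≤ N := fun p hp => (Nat.mem_primesLE.1 hp).1
  have h1 : ∀ e ∈ range N, ∑ p ∈ Nat.primesLE N, (if p ∣ e + 1 then Real.log p else 0) ≤ Real.log N := by
    intro e he
    rw [← Finset.sum_filter]
    have hsub : (Nat.primesLE N).filter (fun p => p ∣ e + 1) ⊆ (e + 1).primeFactors := by
      intro p hp
      rw [Finset.mem_filter] at hp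
      exact Nat.mem_primeFactors.2 ⟨hpr p hp.1, hp.2, by omega⟩
    calc _ ≤ ∑ p ∈ (e+1).primeFactors, Real.log p :=
          Finset.sum_le_sum_of_subset_of_nonneg hsub fun p _ _ => Real.log_natCast_nonneg p
      _ = Real.log ((∏ p ∈ (e+1).primeFactors, p : ℕ) : ℝ) := by
          rw [Nat.cast_prod, Real.log_prod]
          intro p hp
          exact_mod_cast (Nat.prime_of_mem_primeFactors hp).ne_zero
      _ ≤ Real.log N := by
          apply Real.log_le_log
          · exact_mod_cast Finset.prod_pos fun p hp => (Nat.prime_of_mem_primeFactors hp).pos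
          · have := Nat.le_of_dvd (by omega) (Nat.prod_primeFactors_dvd (e+1))
            have h2 := Finset.mem_range.1 he
            exact_mod_cast this.trans h2
  have h2 := Finset.sum_le_sum h1
  rw [Finset.sum_comm, Finset.sum_const, Finset.card_range, nsmul_eq_mul] at h2
  have h3 : ∑ p ∈ Nat.primesLE N, (Real.log p * (N / p) - Real.log p) ≤
      ∑ p ∈ Nat.primesLE N, ∑ e ∈ range N, (if p ∣ e + 1 then Real.log p else 0) := by
    refine Finset.sum_le_sum fun p hp => ?_
    rw [← Finset.sum_filter, Finset.sum_const, Nat.card_multiples, nsmul_eq_mul]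
    have := Nat.lt_floor_add_one ((N:ℝ) / p)
    rw [Nat.floor_div_eq_div] at this
    have hl := Real.log_natCast_nonneg p
    nlinarith
  have h4 := h3.trans h2
  rw [Finset.sum_sub_distrib, ← Chebyshev.theta_eq_sum_primesLE_log] at h4
  have h5 := Chebyshev.theta_le_log4_mul_x hN0.le
  have h6 : Real.log 4 ≤ 2 := by
    have : (4:ℝ) = 2 ^ 2 := by norm_num
    rw [this, Real.log_pow]
    have := Real.log_two_lt_d9
    push_cast; linarith
  have h7 : ∑ p ∈ Nat.primesLE N, Real.log p * (N / p) = N * ∑ p ∈ Nat.primesLE N, Real.log p / p := by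
    rw [Finset.mul_sum]; exact Finset.sum_congr rfl fun p _ => by ring
  rw [h7] at h4
  have h8 : N * ∑ p ∈ Nat.primesLE N, Real.log p / p ≤ N * (Real.log N + 2) := by nlinarith
  exact le_of_mul_le_mul_left h8 hN0

lemma prime_interval {L Lz : ℝ} (hL : 1 ≤ L) (hz : 0 < Lz) (P : Finset ℕ)
    (hP : ∀ p ∈ P, p.Prime ∧ (p : ℝ) ≤ Real.exp L ∧ Lz < Real.log p) :
    ∑ p ∈ P, (1 / p : ℝ) ≤ 3 * L / Lz := by
  have hN : 1 ≤ ⌊Real.exp L⌋₊ := Nat.one_le_floor_iff _ |>.2 (Real.one_le_exp (by linarith))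
  have h := mertens1 ⌊Real.exp L⌋₊ hN
  have hlog : Real.log (⌊Real.exp L⌋₊ : ℕ) ≤ L := by
    rw [Real.log_le_iff_le_exp (by exact_mod_cast hN)]
    exact Nat.floor_le (Real.exp_nonneg _)
  have h1 : ∑ p ∈ P, Real.log p / p ≤ ∑ p ∈ Nat.primesLE ⌊Real.exp L⌋₊, Real.log p / p := by
    refine Finset.sum_le_sum_of_subset_of_nonneg (fun p hp => Nat.mem_primesLE.2 ⟨Nat.le_floor (hP p hp).2.1, (hP p hp).1⟩)
      fun p _ _ => div_nonneg (Real.log_natCast_nonneg p) (by positivity)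
  have h2 : Lz * ∑ p ∈ P, (1 / p : ℝ) ≤ ∑ p ∈ P, Real.log p / p := by
    rw [Finset.mul_sum]
    refine Finset.sum_le_sum fun p hp => ?_
    rw [mul_one_div]
    gcongr
    exact (hP p hp).2.2.le
  rw [le_div_iff₀ hz]
  linarith


/-! ### Part 3h : splitting the prime power sum -/

noncomputable def wt (L : ℝ) (n : ℕ) : ℝ := (max 0 (L - Real.log n)) ^ 2 / L ^ 2

lemma wt_nonneg (L : ℝ) (n : ℕ) : 0 ≤ wt L n := by unfold wt; positivity

lemma wt_le_one {L : ℝ} (hL : 1 ≤ L) (n : ℕ) : wt L n ≤ 1 := by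
  unfold wt
  apply div_le_one_of_le₀ _ (by positivity)
  have := Real.log_natCast_nonneg n
  gcongr
  exact max_le (by linarith) (by linarith)

noncomputable def a1 (L : ℝ) (s : ℂ) (p : ℕ) : ℂ := (wt L p : ℂ) / (p : ℂ) ^ s
noncomputable def a2 (L : ℝ) (s : ℂ) (p : ℕ) : ℂ := (wt L (p ^ 2) : ℂ) / 2 / ((p ^ 2 : ℕ) : ℂ) ^ s

lemma norm_a1_sq {L : ℝ} (hL : 1 ≤ L) {s : ℂ} (hs : 1 / 2 ≤ s.re) {p : ℕ} (hp : p.Prime) :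
    ‖a1 L s p‖ ^ 2 ≤ 1 / p := by
  have hp0 : (0:ℝ) < p := by exact_mod_cast hp.pos
  have hp1 : (1:ℝ) ≤ p := by exact_mod_cast hp.one_lt.le
  rw [a1, norm_div, Complex.norm_real, Real.norm_eq_abs, abs_of_nonneg (wt_nonneg L p),
    Complex.norm_natCast_cpow_of_pos hp.pos, div_pow]
  have h1 : (p:ℝ) ≤ ((p:ℝ) ^ s.re) ^ 2 := by
    rw [← Real.rpow_natCast, ← Real.rpow_mul hp0.le]
    conv_lhs => rw [← Real.rpow_one (p:ℝ)]
    apply Real.rpow_le_rpow_of_exponent_le hp1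
    push_cast; linarith
  have h2 : wt L p ^ 2 ≤ 1 := pow_le_one₀ (wt_nonneg L p) (wt_le_one hL p)
  gcongr

lemma norm_a2_sq {L : ℝ} (hL : 1 ≤ L) {s : ℂ} (hs : 1 / 2 ≤ s.re) {p : ℕ} (hp : p.Prime) :
    ‖a2 L s p‖ ^ 2 ≤ 1 / (p : ℝ) ^ (2:ℝ) := by
  have hp0 : (0:ℝ) < p := by exact_mod_cast hp.pos
  have hp1 : (1:ℝ) ≤ p := by exact_mod_cast hp.one_lt.le
  rw [a2, norm_div, norm_div, Complex.norm_real, Real.norm_eq_abs, abs_of_nonneg (wt_nonneg L _),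
    Complex.norm_natCast_cpow_of_pos (pow_pos hp.pos 2), div_pow]
  have h1 : (p:ℝ) ^ (2:ℝ) ≤ (((p^2 : ℕ):ℝ) ^ s.re) ^ 2 := by
    rw [← Real.rpow_natCast _ 2, Nat.cast_pow, ← Real.rpow_natCast _ 2, ← Real.rpow_mul hp0.le, ← Real.rpow_mul hp0.le]
    apply Real.rpow_le_rpow_of_exponent_le hp1
    push_cast; linarith
  have h2 : (wt L (p ^ 2) / ‖(2:ℂ)‖) ^ 2 ≤ 1 := by
    apply pow_le_one₀ (div_nonneg (wt_nonneg L _) (by positivity))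
    have := wt_le_one hL (p ^ 2)
    rw [Complex.norm_ofNat]
    linarith
  gcongr

lemma sum_a2_sq {L : ℝ} (hL : 1 ≤ L) {s : ℂ} (hs : 1 / 2 ≤ s.re) (P : Finset ℕ) (hP : ∀ p ∈ P, p.Prime) :
    ∑ p ∈ P, ‖a2 L s p‖ ^ 2 ≤ 2 := by
  have h := zeta_le (δ := 1) (by norm_num)
  have hs' : Summable (fun n : ℕ => ((n : ℝ) ^ (1 + 1 : ℝ))⁻¹) := Real.summable_nat_rpow_inv.2 (by norm_num)
  have h2 := hs'.sum_le_tsum P (fun n _ => by positivity)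
  refine le_trans (Finset.sum_le_sum fun p hp => norm_a2_sq hL hs (hP p hp)) ?_
  refine le_trans (le_of_eq ?_) (h2.trans (h.trans (by norm_num)))
  exact Finset.sum_congr rfl fun p _ => by norm_num

lemma bt_abs_le {q : ℕ} (χ : DirichletCharacter ℂ q) {s : ℂ} (hs : 1 / 2 ≤ s.re) {n : ℕ} (hn : 0 < n) :
    |bt χ s n| ≤ ((n:ℝ) ^ (1/2:ℝ))⁻¹ := by
  unfold bt
  refine (Complex.abs_re_le_norm _).trans ?_
  rw [LSeries.norm_term_eq, if_neg hn.ne', ← one_div]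
  have hn1 : (1:ℝ) ≤ n := by exact_mod_cast hn
  gcongr
  exact norm_bc_le χ n

lemma bt_prime {q : ℕ} (χ : DirichletCharacter ℂ q) (s : ℂ) (L : ℝ) {p : ℕ} (hp : p.Prime) :
    bt χ s p * wt L p = (a1 L s p * χ ((p ^ 1 : ℕ) : ZMod q)).re := by
  have hl : (Real.log p : ℝ) ≠ 0 := (Real.log_pos (by exact_mod_cast hp.one_lt)).ne'
  unfold bt a1
  rw [LSeries.term_of_ne_zero hp.ne_zero, bc, ArithmeticFunction.vonMangoldt_apply_prime hp,
    div_self hl, pow_one, ← Complex.re_mul_ofReal]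
  congr 1
  push_cast
  ring

lemma bt_prime_sq {q : ℕ} (χ : DirichletCharacter ℂ q) (s : ℂ) (L : ℝ) {p : ℕ} (hp : p.Prime) :
    bt χ s (p ^ 2) * wt L (p ^ 2) = (a2 L s p * χ ((p ^ 2 : ℕ) : ZMod q)).re := by
  have hl : (Real.log p : ℝ) ≠ 0 := (Real.log_pos (by exact_mod_cast hp.one_lt)).ne'
  unfold bt a2
  have h0 : p ^ 2 ≠ 0 := pow_ne_zero _ hp.ne_zero
  rw [LSeries.term_of_ne_zero h0, bc, ArithmeticFunction.vonMangoldt_apply_pow (by norm_num),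
    ArithmeticFunction.vonMangoldt_apply_prime hp]
  have : Real.log p / Real.log ((p ^ 2 : ℕ):ℝ) = 1 / 2 := by
    rw [Nat.cast_pow, Real.log_pow]; push_cast; field_simp
  rw [this, ← Complex.re_mul_ofReal]
  congr 1
  push_cast
  ring

lemma pow_rest {p : ℕ} (hp : p.Prime) (N : ℕ) :
    ∑ k ∈ Icc 3 N, (((p ^ k : ℕ):ℝ) ^ (1/2:ℝ))⁻¹ ≤ 4 * ((p:ℝ) ^ (1 + 1/2 : ℝ))⁻¹ := by
  have hp2 : (2:ℝ) ≤ p := by exact_mod_cast hp.two_le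
  have hp0 : (0:ℝ) < p := by linarith
  set r : ℝ := ((p:ℝ) ^ (1/2:ℝ))⁻¹ with hr
  have hr0 : 0 < r := by positivity
  have hsq : r ^ 2 = (p:ℝ)⁻¹ := by
    rw [hr, inv_pow, ← Real.rpow_natCast, ← Real.rpow_mul hp0.le]; norm_num
  have hr2 : r ^ 2 ≤ 1 / 2 := by rw [hsq, ← one_div]; gcongr
  have hr1 : r ≤ 3 / 4 := by nlinarith
  have e : ∀ k : ℕ, (((p ^ k : ℕ):ℝ) ^ (1/2:ℝ))⁻¹ = r ^ k := by
    intro k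
    rw [hr, inv_pow, Nat.cast_pow, ← Real.rpow_natCast, ← Real.rpow_natCast, ← Real.rpow_mul hp0.le, ← Real.rpow_mul hp0.le]
    congr 2; ring
  have e3 : ((p:ℝ) ^ (1 + 1/2 : ℝ))⁻¹ = r ^ 3 := by
    rw [← e 3, Nat.cast_pow, ← Real.rpow_natCast, ← Real.rpow_mul hp0.le]; norm_num
  rw [e3]
  simp_rw [e]
  have : Icc 3 N = Ico 3 (N + 1) := by ext; simp [Order.lt_add_one_iff]
  rw [this]
  have h1 := Finset.sum_Ico_eq_sum_range (fun k => r ^ k) 3 (N + 1)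
  rw [h1]
  simp_rw [pow_add]
  rw [← Finset.mul_sum, mul_comm (4:ℝ)]
  gcongr
  have h2 := (summable_geometric_of_lt_one hr0.le (by linarith)).sum_le_tsum (range (N + 1 - 3)) (fun i _ => by positivity)
  rw [tsum_geometric_of_lt_one hr0.le (by linarith)] at h2
  refine h2.trans ?_
  rw [inv_le_comm₀ (by linarith) (by norm_num)]
  linarith

lemma bt_not_primePow {q : ℕ} (χ : DirichletCharacter ℂ q) (s : ℂ) {n : ℕ} (hn : ¬ IsPrimePow n) : bt χ s n = 0 := by
  unfold bt
  rcases eq_or_ne n 0 with rfl | h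
  · simp
  · rw [LSeries.term_of_ne_zero h, bc, ArithmeticFunction.vonMangoldt_eq_zero_iff.2 hn]; simp

lemma sq_split {q : ℕ} (χ : DirichletCharacter ℂ q) {s : ℂ} (hs : 1 / 2 ≤ s.re) {L : ℝ} (hL : 1 ≤ L) :
    Sq (bt χ s) L / L ^ 2 ≤
      ‖∑ p ∈ Nat.primesLE ⌊Real.exp L⌋₊, a1 L s p * χ ((p ^ 1 : ℕ) : ZMod q)‖ +
      ‖∑ p ∈ Nat.primesLE ⌊(Real.exp L) ^ (1/2:ℝ)⌋₊, a2 L s p * χ ((p ^ 2 : ℕ) : ZMod q)‖ + 12 := by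
  set x := Real.exp L with hx
  have hx1 : 1 ≤ x := Real.one_le_exp (by linarith)
  set f : ℕ → ℝ := fun n => bt χ s n * wt L n with hf
  have h1 : Sq (bt χ s) L / L ^ 2 = ∑ n ∈ Ioc 0 ⌊x⌋₊ with IsPrimePow n, f n := by
    have hcut := tsum_cut (g := f) (Y := L) (N := ⌊x⌋₊ + 1) (by
      push_cast; exact (Nat.lt_floor_add_one _).le) (by
      intro n hn
      simp only [hf, wt]
      rw [max_eq_left (by linarith)]; simp)
    have : Sq (bt χ s) L / L ^ 2 = ∑' n, f n := by
      rw [Sq, ← tsum_div_const]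
      exact tsum_congr fun n => by simp only [hf, wt]; ring
    rw [this, hcut]
    symm
    apply Finset.sum_subset
    · intro n hn
      simp only [Finset.mem_filter, Finset.mem_Ioc, Finset.mem_range] at hn ⊢
      omega
    · intro n hn hn2
      simp only [Finset.mem_filter, Finset.mem_Ioc, Finset.mem_range] at hn hn2
      by_cases hpp : IsPrimePow n
      · have := hpp.pos
        exact absurd ⟨⟨this, by omega⟩, hpp⟩ hn2
      · simp only [hf]; rw [bt_not_primePow χ s hpp, zero_mul]
  have hset : ∀ X : ℕ, (Ioc 0 X).filter Nat.Prime = Nat.primesLE X := by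
    intro X; ext p
    simp only [Finset.mem_filter, Finset.mem_Ioc, Nat.mem_primesLE]
    constructor
    · rintro ⟨⟨_, h⟩, h2⟩; exact ⟨h, h2⟩
    · rintro ⟨h, h2⟩; exact ⟨⟨h2.pos, h⟩, h2⟩
  set N := max 2 ⌊Real.log x / Real.log 2⌋₊ with hN
  have hN2 : 2 ≤ N := le_max_left _ _
  rw [h1, Chebyshev.sum_PrimePow_eq_sum_sum' f (by linarith) (le_max_right 2 _), ← hN]
  have hI : Icc 1 N = insert 1 (insert 2 (Icc 3 N)) := by
    ext k; simp only [Finset.mem_Icc, Finset.mem_insert]; omega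
  rw [hI, Finset.sum_insert (by simp), Finset.sum_insert (by simp)]
  simp_rw [hset]
  rw [← add_assoc]
  refine add_le_add (add_le_add ?_ ?_) ?_
  · simp only [Nat.cast_one, div_one, Real.rpow_one]
    refine le_trans (le_of_eq ?_) (Complex.re_le_norm _)
    rw [Complex.re_sum]
    refine Finset.sum_congr rfl fun p hp => ?_
    rw [← bt_prime χ s L (Nat.mem_primesLE.1 hp).2, pow_one]
  · refine le_trans (le_of_eq ?_) (Complex.re_le_norm _)
    rw [Complex.re_sum]
    push_cast
    refine Finset.sum_congr rfl fun p hp => ?_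
    have := bt_prime_sq χ s L (Nat.mem_primesLE.1 hp).2
    push_cast at this
    rw [← this]
  · have hb : ∀ k ∈ Icc 3 N, ∑ p ∈ Nat.primesLE ⌊x ^ ((1:ℝ)/(k:ℕ))⌋₊, f (p ^ k) ≤
        ∑ p ∈ Nat.primesLE ⌊x⌋₊, (((p ^ k : ℕ):ℝ) ^ (1/2:ℝ))⁻¹ := by
      intro k hk
      have hk3 : (3:ℝ) ≤ k := by exact_mod_cast (Finset.mem_Icc.1 hk).1
      have hsub : Nat.primesLE ⌊x ^ ((1:ℝ)/(k:ℕ))⌋₊ ⊆ Nat.primesLE ⌊x⌋₊ := by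
        intro p hp
        rw [Nat.mem_primesLE] at hp ⊢
        refine ⟨hp.1.trans (Nat.floor_mono ?_), hp.2⟩
        conv_rhs => rw [← Real.rpow_one x]
        apply Real.rpow_le_rpow_of_exponent_le hx1
        rw [div_le_one (by linarith)]; linarith
      refine le_trans (Finset.sum_le_sum fun p hp => ?_)
        (Finset.sum_le_sum_of_subset_of_nonneg hsub fun p _ _ => by positivity)
      have hp0 := pow_pos (Nat.mem_primesLE.1 hp).2.pos k
      have h3 := bt_abs_le χ hs hp0
      calc f (p ^ k) ≤ |bt χ s (p ^ k) * wt L (p ^ k)| := le_abs_self _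
        _ = |bt χ s (p ^ k)| * wt L (p ^ k) := by rw [abs_mul, abs_of_nonneg (wt_nonneg L _)]
        _ ≤ |bt χ s (p ^ k)| * 1 := by gcongr; exact wt_le_one hL _
        _ ≤ _ := by rw [mul_one]; exact h3
    refine (Finset.sum_le_sum hb).trans ?_
    rw [Finset.sum_comm]
    refine (Finset.sum_le_sum fun p hp => pow_rest (Nat.mem_primesLE.1 hp).2 N).trans ?_
    rw [← Finset.mul_sum]
    have hs' : Summable (fun n : ℕ => ((n : ℝ) ^ (1 + 1/2 : ℝ))⁻¹) := Real.summable_nat_rpow_inv.2 (by norm_num)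
    have h4 := hs'.sum_le_tsum (Nat.primesLE ⌊x⌋₊) (fun n _ => by positivity)
    have h5 := zeta_le (δ := 1/2) (by norm_num)
    norm_num at h4 h5 ⊢
    linarith


/-! ### Part 4a : large values -/

noncomputable def PS {q : ℕ} (χ : DirichletCharacter ℂ q) (P : Finset ℕ) (a : ℕ → ℂ) (e : ℕ) : ℂ :=
  ∑ p ∈ P, a p * χ ((p ^ e : ℕ) : ZMod q)

open Classical in
lemma count_bound {q : ℕ} [NeZero q] (P : Finset ℕ) (hP : ∀ p ∈ P, p.Prime)
    (e : ℕ) (he : e ≠ 0) (a : ℕ → ℂ) {L u σ U R : ℝ} (hL0 : 0 ≤ L) (hL : ∀ p ∈ P, (p : ℝ) ^ e ≤ Real.exp L)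
    (hu : 0 ≤ u) (huL : u * L < Real.log q) (hσ : ∑ p ∈ P, ‖a p‖ ^ 2 ≤ σ) (hU : 0 < U) (hR : 0 ≤ R)
    (h : u * σ ≤ U ^ 2 * Real.exp (-R)) :
    ((Finset.univ.filter fun χ : DirichletCharacter ℂ q => U ≤ ‖PS χ P a e‖).card : ℝ)
      ≤ Nat.totient q * Real.exp (R - R * u) := by
  set l := ⌊u⌋₊ with hl
  have hlu : (l:ℝ) ≤ u := Nat.floor_le hu
  have hlu2 : u < l + 1 := Nat.lt_floor_add_one u
  have hq0 : (0:ℝ) < q := by exact_mod_cast NeZero.pos q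
  have hσ0 : 0 ≤ σ := (Finset.sum_nonneg fun p _ => by positivity).trans hσ
  have hX : Real.exp L ^ l < q := by
    rw [← Real.exp_nat_mul, ← Real.lt_log_iff_exp_lt hq0]
    exact lt_of_le_of_lt (by gcongr) huL
  have h1 := prime_moment l P hP e he a (Real.exp L) hL hX
  have h2 : ((Finset.univ.filter fun χ : DirichletCharacter ℂ q => U ≤ ‖PS χ P a e‖).card : ℝ) * U ^ (2 * l)
      ≤ ∑ χ : DirichletCharacter ℂ q, ‖∑ p ∈ P, a p * χ ((p ^ e : ℕ) : ZMod q)‖ ^ (2 * l) := by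
    rw [← nsmul_eq_mul, ← Finset.sum_const]
    refine le_trans (Finset.sum_le_sum (g := fun χ => ‖PS χ P a e‖ ^ (2 * l)) fun χ hχ => ?_)
      (Finset.sum_le_sum_of_subset_of_nonneg (Finset.filter_subset _ _) fun χ _ _ => by positivity)
    have := (Finset.mem_filter.1 hχ).2
    gcongr
  have h3 : (l.factorial : ℝ) * (∑ p ∈ P, ‖a p‖ ^ 2) ^ l ≤ U ^ (2 * l) * Real.exp (R - R * u) := by
    calc (l.factorial : ℝ) * (∑ p ∈ P, ‖a p‖ ^ 2) ^ l ≤ (l:ℝ) ^ l * σ ^ l := by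
          gcongr
          exact_mod_cast Nat.factorial_le_pow l
      _ = ((l:ℝ) * σ) ^ l := by rw [mul_pow]
      _ ≤ (U ^ 2 * Real.exp (-R)) ^ l := by
          refine pow_le_pow_left₀ (by positivity) (le_trans ?_ h) _
          gcongr
      _ = U ^ (2 * l) * Real.exp (-(R * l)) := by
          rw [mul_pow, ← pow_mul, ← Real.exp_nat_mul]; congr 2; ring
      _ ≤ U ^ (2 * l) * Real.exp (R - R * u) := by
          gcongr
          nlinarith
  have hUp : 0 < U ^ (2 * l) := by positivity
  have hN : (0:ℝ) ≤ Nat.totient q := by positivity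
  have h4 := h2.trans (h1.trans (mul_le_mul_of_nonneg_left h3 hN))
  rw [mul_comm (U ^ (2*l)), ← mul_assoc] at h4
  exact le_of_mul_le_mul_right h4 hUp

lemma sum_a1_sq {L : ℝ} (hL : 1 ≤ L) {s : ℂ} (hs : 1 / 2 ≤ s.re) {σ : ℝ} (P : Finset ℕ)
    (hP : ∀ p ∈ P, p.Prime) (h : ∑ p ∈ P, (1 / p : ℝ) ≤ σ) : ∑ p ∈ P, ‖a1 L s p‖ ^ 2 ≤ σ :=
  (Finset.sum_le_sum fun p hp => norm_a1_sq hL hs (hP p hp)).trans h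

/-- the pointwise upper bound property used below. -/
def UpB {q : ℕ} (s : ℂ) (C ℓ : ℝ) (V : DirichletCharacter ℂ q → ℝ) : Prop :=
  ∀ χ, χ ≠ 1 → V χ ≤ 6 * ℓ ∧ ∀ L : ℝ, 1 ≤ L → V χ ≤ ‖PS χ (Nat.primesLE ⌊Real.exp L⌋₊) (a1 L s) 1‖ +
    ‖PS χ (Nat.primesLE ⌊(Real.exp L) ^ (1/2:ℝ)⌋₊) (a2 L s) 2‖ + 12 + C * ℓ / L

lemma primesLE_exp {L : ℝ} {p : ℕ} (hp : p ∈ Nat.primesLE ⌊Real.exp L⌋₊) : (p:ℝ) ^ 1 ≤ Real.exp L := by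
  rw [pow_one]
  exact (Nat.le_floor_iff (Real.exp_nonneg _)).1 (Nat.mem_primesLE.1 hp).1

lemma primesLE_exp2 {L : ℝ} {p : ℕ} (hp : p ∈ Nat.primesLE ⌊(Real.exp L) ^ (1/2:ℝ)⌋₊) :
    (p:ℝ) ^ 2 ≤ Real.exp L := by
  have := (Nat.le_floor_iff (by positivity)).1 (Nat.mem_primesLE.1 hp).1
  calc (p:ℝ) ^ 2 ≤ ((Real.exp L) ^ (1/2:ℝ)) ^ 2 := by gcongr
    _ = Real.exp L := by rw [← Real.rpow_natCast, ← Real.rpow_mul (Real.exp_nonneg _)]; norm_num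

open Classical in
lemma large_values {K C : ℝ} (hK : 0 < K) (hC : 1 ≤ C) : ∃ B0 C2 ω0 : ℝ, 0 < B0 ∧ 0 < C2 ∧
    ∀ (q : ℕ) [NeZero q], ∀ ℓ ω : ℝ, ℓ = Real.log q → ω = Real.log ℓ → 0 < ℓ → ω0 ≤ ω →
    ∀ s : ℂ, 1 / 2 ≤ s.re → ∀ V : DirichletCharacter ℂ q → ℝ, UpB s C ℓ V →
    ∑ χ ∈ Finset.univ.filter (fun χ : DirichletCharacter ℂ q => χ ≠ 1 ∧ B0 * ω + 1 ≤ V χ), Real.exp (K * V χ)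
      ≤ C2 * Nat.totient q := by
  obtain ⟨Cm, hCm, hmert⟩ := mertens2 (η := 1) one_pos
  set A : ℝ := 8 * C with hA
  have hA8 : 8 ≤ A := by linarith
  set R : ℝ := 2 * A * (K + 1) with hR
  have hR0 : 0 < R := by positivity
  have hB0 : 0 < 6 * Real.exp R / A + A + 96 := by positivity
  refine ⟨6 * Real.exp R / A + A + 96, 2 * Real.exp (R + K) * 2, max 3 Cm, hB0, by positivity, ?_⟩
  intro q _ ℓ ω hℓ hω hℓ0 hω0 s hs V hV
  set B0 := 6 * Real.exp R / A + A + 96 with hB0d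
  have hω3 : 3 ≤ ω := (le_max_left _ _).trans hω0
  have hωC : Cm ≤ ω := (le_max_right _ _).trans hω0
  have hN : (0:ℝ) ≤ Nat.totient q := by positivity
  set M := ⌊6 * ℓ⌋₊ + 1 with hM
  have hcount : ∀ v : ℕ, v ∈ range M → B0 * ω ≤ v →
      ((Finset.univ.filter fun χ : DirichletCharacter ℂ q => χ ≠ 1 ∧ (v:ℝ) ≤ V χ).card : ℝ)
        ≤ 2 * (Nat.totient q * Real.exp (R - (K + 1) * v)) := by
    intro v hv hBv
    have hv6 : (v:ℝ) ≤ 6 * ℓ := by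
      rw [← Nat.le_floor_iff (by positivity)]
      have := Finset.mem_range.1 hv
      omega
    have e1 : (0:ℝ) ≤ 6 * Real.exp R / A * ω := by positivity
    have e2 : B0 * ω = 6 * Real.exp R / A * ω + A * ω + 96 * ω := by rw [hB0d]; ring
    have hv1 : 6 * Real.exp R / A * ω ≤ v := by nlinarith
    have hv2 : A ≤ v := by nlinarith
    have hv3 : 96 ≤ (v:ℝ) := by nlinarith
    have hv0 : (0:ℝ) < v := by linarith
    have hL1 : 1 ≤ A * ℓ / v := by
      rw [le_div_iff₀ hv0]; nlinarith
    have hLℓ : A * ℓ / v ≤ ℓ := by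
      rw [div_le_iff₀ hv0]; nlinarith
    set L := A * ℓ / v with hL
    have huL : v / (2 * A) * L = ℓ / 2 := by rw [hL]; field_simp
    have hu0 : 0 ≤ v / (2 * A) := by positivity
    have hRu : R - R * (v / (2 * A)) = R - (K + 1) * v := by rw [hR]; field_simp
    have c1 := count_bound (q := q) (Nat.primesLE ⌊Real.exp L⌋₊) (fun p hp => (Nat.mem_primesLE.1 hp).2) 1 (by norm_num)
      (a1 L s) (L := L) (u := v / (2 * A)) (σ := 3 * ω) (U := v / 2) (R := R) (by linarith) (fun p hp => primesLE_exp hp)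
      hu0 (by rw [huL, ← hℓ]; linarith) (by
        refine sum_a1_sq hL1 hs _ (fun p hp => (Nat.mem_primesLE.1 hp).2) ?_
        refine (hmert L hL1 _ fun p hp => ⟨(Nat.mem_primesLE.1 hp).2, by simpa using primesLE_exp hp⟩).trans ?_
        have := Real.log_le_log (by linarith) hLℓ
        rw [← hω] at this
        linarith) (by positivity) hR0.le (by
        rw [Real.exp_neg]
        have h6 : 6 * Real.exp R * ω ≤ v * A := by
          have : 6 * Real.exp R / A * ω = 6 * Real.exp R * ω / A := by ring
          rw [this, div_le_iff₀ (by positivity)] at hv1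
          exact hv1
        have : v / (2 * A) * (3 * ω) = v * (6 * Real.exp R * ω) / (4 * A * Real.exp R) := by field_simp; ring
        rw [this, div_le_iff₀ (by positivity)]
        have : (v / 2 : ℝ) ^ 2 * (Real.exp R)⁻¹ * (4 * A * Real.exp R) = v * (v * A) := by field_simp; ring
        rw [this]
        gcongr)
    have c2 := count_bound (q := q) (Nat.primesLE ⌊(Real.exp L) ^ (1/2:ℝ)⌋₊) (fun p hp => (Nat.mem_primesLE.1 hp).2) 2 (by norm_num)
      (a2 L s) (L := L) (u := v / (2 * A)) (σ := 2) (U := v / 4) (R := R) (by linarith) (fun p hp => primesLE_exp2 hp)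
      hu0 (by rw [huL, ← hℓ]; linarith) (sum_a2_sq hL1 hs _ (fun p hp => (Nat.mem_primesLE.1 hp).2)) (by positivity) hR0.le (by
        rw [Real.exp_neg]
        have h6 : 16 * Real.exp R ≤ v * A := by
          have : 6 * Real.exp R / A * ω = 6 * Real.exp R * ω / A := by ring
          rw [this, div_le_iff₀ (by positivity)] at hv1
          nlinarith [Real.exp_pos R]
        have : v / (2 * A) * 2 = v * (16 * Real.exp R) / (16 * A * Real.exp R) := by field_simp
        rw [this, div_le_iff₀ (by positivity)]
        have : (v / 4 : ℝ) ^ 2 * (Real.exp R)⁻¹ * (16 * A * Real.exp R) = v * (v * A) := by field_simp; ring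
        rw [this]
        gcongr)
    rw [hRu] at c1 c2
    rw [two_mul]
    refine le_trans ?_ (add_le_add c1 c2)
    rw [← Nat.cast_add]
    refine Nat.cast_le.2 (le_trans (Finset.card_le_card ?_) (Finset.card_union_le _ _))
    intro χ hχ
    obtain ⟨_, hχ1, hvV⟩ := Finset.mem_filter.1 hχ
    have hb := (hV χ hχ1).2 L hL1
    have hCL : C * ℓ / L = v / 8 := by rw [hL, hA]; field_simp
    rw [hCL] at hb
    rw [Finset.mem_union, Finset.mem_filter, Finset.mem_filter]
    by_contra hcon
    push Not at hcon
    have g1 := hcon.1 (Finset.mem_univ _)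
    have g2 := hcon.2 (Finset.mem_univ _)
    linarith
  have hpt : ∀ χ ∈ Finset.univ.filter (fun χ : DirichletCharacter ℂ q => χ ≠ 1 ∧ B0 * ω + 1 ≤ V χ),
      Real.exp (K * V χ) ≤ ∑ v ∈ range M, if (B0 * ω ≤ v ∧ (v:ℝ) ≤ V χ) then Real.exp (K * (v + 1)) else 0 := by
    intro χ hχ
    obtain ⟨_, hχ1, hvV⟩ := Finset.mem_filter.1 hχ
    have hV0 : 0 ≤ V χ := by nlinarith
    have hf1 := Nat.floor_le hV0
    have hf2 := Nat.lt_floor_add_one (V χ)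
    have hmem : ⌊V χ⌋₊ ∈ range M := by
      rw [Finset.mem_range, hM]
      exact Nat.lt_succ_of_le (Nat.floor_mono (hV χ hχ1).1)
    refine le_trans ?_ (Finset.single_le_sum (fun v _ => ?_) hmem)
    · rw [if_pos ⟨by linarith, hf1⟩]
      gcongr
    · split_ifs <;> positivity
  refine (Finset.sum_le_sum hpt).trans ?_
  rw [Finset.sum_comm]
  have hsum : ∀ v ∈ range M, ∑ χ ∈ Finset.univ.filter (fun χ : DirichletCharacter ℂ q => χ ≠ 1 ∧ B0 * ω + 1 ≤ V χ),
      (if (B0 * ω ≤ v ∧ (v:ℝ) ≤ V χ) then Real.exp (K * (v + 1)) else 0) ≤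
      2 * Real.exp (R + K) * Nat.totient q * (Real.exp (-1)) ^ v := by
    intro v hv
    by_cases hBv : B0 * ω ≤ v
    · simp only [hBv, true_and]
      rw [← Finset.sum_filter, Finset.sum_const, nsmul_eq_mul]
      have hc := hcount v hv hBv
      calc _ ≤ (2 * (Nat.totient q * Real.exp (R - (K + 1) * v))) * Real.exp (K * (v + 1)) := by
            gcongr
            refine le_trans (Nat.cast_le.2 (Finset.card_le_card ?_)) hc
            intro χ hχ
            simp only [Finset.mem_filter, Finset.mem_univ, true_and] at hχ ⊢
            exact ⟨hχ.1.1, hχ.2⟩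
        _ = 2 * Real.exp (R + K) * Nat.totient q * (Real.exp (-1)) ^ v := by
            have : Real.exp (R - (K + 1) * v) * Real.exp (K * (v + 1)) = Real.exp (R + K) * (Real.exp (-1)) ^ v := by
              rw [← Real.exp_nat_mul, ← Real.exp_add, ← Real.exp_add]; congr 1; ring
            rw [mul_assoc, mul_assoc, this]; ring
    · simp only [hBv, false_and, if_false, Finset.sum_const_zero]
      positivity
  refine (Finset.sum_le_sum hsum).trans ?_
  rw [← Finset.mul_sum]
  have he1 : Real.exp (-1) ≤ 1 / 2 := by
    rw [Real.exp_neg, one_div]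
    have := Real.add_one_le_exp (1:ℝ)
    gcongr; linarith
  have h2 := (summable_geometric_of_lt_one (Real.exp_nonneg (-1)) (by linarith)).sum_le_tsum (range M) (fun i _ => by positivity)
  rw [tsum_geometric_of_lt_one (Real.exp_nonneg _) (by linarith)] at h2
  have h3 : (1 - Real.exp (-1))⁻¹ ≤ 2 := by
    rw [inv_le_comm₀ (by linarith) (by norm_num)]; linarith
  calc _ ≤ 2 * Real.exp (R + K) * Nat.totient q * 2 := by gcongr; linarith
    _ = _ := by ring


/-! ### Part 4b : the moment bound at a fixed height -/

lemma exp_trunc {x : ℝ} {J : ℕ} (hx : 0 ≤ x) (hxJ : x ≤ J) :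
    Real.exp x ≤ 4 * ∑ j ∈ range (J + 1), x ^ (2 * j) / (2 * j).factorial := by
  set t : ℕ → ℝ := fun j => x ^ (2 * j) / (2 * j).factorial with ht
  have ht0 : ∀ j, 0 ≤ t j := fun j => by simp only [ht]; positivity
  have hc : HasSum t (Real.cosh x) := Real.hasSum_cosh x
  have hstep : ∀ i : ℕ, t (i + J + 1) ≤ t J * (1 / 2) ^ (i + 1) := by
    have h1 : ∀ j, J ≤ j → t (j + 1) ≤ t j * (1 / 2) := by
      intro j hj
      have e : t (j + 1) = t j * (x ^ 2 / ((2 * j + 1) * (2 * j + 2))) := by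
        simp only [ht]
        rw [show 2 * (j + 1) = 2 * j + 1 + 1 by ring, Nat.factorial_succ, Nat.factorial_succ]
        push_cast
        field_simp
        ring
      rw [e]
      refine mul_le_mul_of_nonneg_left ?_ (ht0 j)
      rw [div_le_div_iff₀ (by positivity) (by norm_num)]
      have hjx : x ≤ j := hxJ.trans (by exact_mod_cast hj)
      nlinarith
    intro i
    induction i with
    | zero => simpa using h1 J le_rfl
    | succ i ih =>
      have := h1 (i + J + 1) (by omega)
      rw [show i + 1 + J + 1 = i + J + 1 + 1 by ring, pow_succ]
      linarith
  have hs := hc.summable.sum_add_tsum_nat_add (J + 1)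
  have hgeo : Summable (fun i : ℕ => t J * (1 / 2 : ℝ) ^ (i + 1)) :=
    ((summable_nat_add_iff 1).2 (summable_geometric_of_lt_one (by norm_num) (by norm_num))).mul_left _
  have hgs : ∑' i : ℕ, t J * (1 / 2 : ℝ) ^ (i + 1) = t J := by
    rw [tsum_mul_left]
    simp_rw [pow_succ]
    rw [tsum_mul_right, tsum_geometric_of_lt_one (by norm_num) (by norm_num)]; norm_num
  have htail : ∑' i, t (i + (J + 1)) ≤ t J := by
    rw [← hgs]
    exact Summable.tsum_le_tsum hstep ((summable_nat_add_iff (J + 1)).2 hc.summable) hgeo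
  have hJ : t J ≤ ∑ j ∈ range (J + 1), t j := Finset.single_le_sum (fun j _ => ht0 j) (Finset.mem_range.2 (by omega))
  have hcosh : Real.exp x ≤ 2 * Real.cosh x := by
    rw [Real.cosh_eq]; have := Real.exp_pos (-x); linarith
  rw [hc.tsum_eq] at hs
  linarith

lemma moment_exp {q : ℕ} [NeZero q] (P : Finset ℕ) (hP : ∀ p ∈ P, p.Prime) (a : ℕ → ℂ) {Lz σ K : ℝ} {J : ℕ}
    (hK : 0 ≤ K) (hL0 : 0 ≤ Lz) (hL : ∀ p ∈ P, (p : ℝ) ^ 1 ≤ Real.exp Lz) (hJ : J * Lz < Real.log q)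
    (hσ : ∑ p ∈ P, ‖a p‖ ^ 2 ≤ σ) :
    ∑ χ : DirichletCharacter ℂ q, (if K * ‖PS χ P a 1‖ ≤ J then Real.exp (K * ‖PS χ P a 1‖) else 0)
      ≤ 4 * Nat.totient q * ((2 * J + 1) * Real.exp (K ^ 2 / 4 * σ)) := by
  have hq0 : (0:ℝ) < q := by exact_mod_cast NeZero.pos q
  have hσ0 : 0 ≤ σ := (Finset.sum_nonneg fun p _ => by positivity).trans hσ
  have h1 : ∀ χ : DirichletCharacter ℂ q, (if K * ‖PS χ P a 1‖ ≤ J then Real.exp (K * ‖PS χ P a 1‖) else 0)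
      ≤ 4 * ∑ j ∈ range (J + 1), (K * ‖PS χ P a 1‖) ^ (2 * j) / (2 * j).factorial := by
    intro χ
    split_ifs with h
    · exact exp_trunc (by positivity) h
    · positivity
  refine (Finset.sum_le_sum fun χ _ => h1 χ).trans ?_
  rw [← Finset.mul_sum, Finset.sum_comm, mul_assoc]
  gcongr
  have h2 : ∀ j ∈ range (J + 1), ∑ χ : DirichletCharacter ℂ q, (K * ‖PS χ P a 1‖) ^ (2 * j) / (2 * j).factorial
      ≤ Nat.totient q * ((2 * J + 1) * ((K ^ 2 / 4 * σ) ^ j / j.factorial)) := by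
    intro j hj
    have hjJ : j ≤ J := by have := Finset.mem_range.1 hj; omega
    have hjJ' : (j:ℝ) ≤ J := by exact_mod_cast hjJ
    have hX : Real.exp Lz ^ j < q := by
      rw [← Real.exp_nat_mul, ← Real.lt_log_iff_exp_lt hq0]
      exact lt_of_le_of_lt (by gcongr) hJ
    have hm := prime_moment j P hP 1 one_ne_zero a (Real.exp Lz) hL hX
    have e : ∑ χ : DirichletCharacter ℂ q, (K * ‖PS χ P a 1‖) ^ (2 * j) / (2 * j).factorial =
        K ^ (2 * j) / (2 * j).factorial * ∑ χ : DirichletCharacter ℂ q, ‖PS χ P a 1‖ ^ (2 * j) := by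
      rw [Finset.mul_sum]; exact Finset.sum_congr rfl fun χ _ => by rw [mul_pow]; ring
    rw [e]
    have hfac : (4:ℝ) ^ j * (j.factorial * j.factorial) ≤ (2 * J + 1) * (2 * j).factorial := by
      rcases Nat.eq_zero_or_pos j with rfl | hj0
      · simp
      · have h4 := Nat.four_pow_le_two_mul_self_mul_centralBinom j hj0
        have h5 := Nat.choose_mul_factorial_mul_factorial (n := 2 * j) (k := j) (by omega)
        rw [show 2 * j - j = j by omega, ← Nat.centralBinom_eq_two_mul_choose] at h5
        have h4' : (4:ℝ) ^ j ≤ 2 * j * Nat.centralBinom j := by exact_mod_cast h4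
        have h5' : (Nat.centralBinom j : ℝ) * j.factorial * j.factorial = (2 * j).factorial := by exact_mod_cast h5
        rw [← h5']
        calc (4:ℝ) ^ j * (j.factorial * j.factorial) ≤ (2 * j * Nat.centralBinom j) * (j.factorial * j.factorial) := by gcongr
          _ ≤ ((2 * J + 1) * Nat.centralBinom j) * (j.factorial * j.factorial) := by
            gcongr; linarith
          _ = _ := by ring
    have hf0 : (0:ℝ) < j.factorial := by positivity
    have hf1 : (0:ℝ) < (2 * j).factorial := by positivity
    calc K ^ (2 * j) / (2 * j).factorial * ∑ χ : DirichletCharacter ℂ q, ‖PS χ P a 1‖ ^ (2 * j)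
        ≤ K ^ (2 * j) / (2 * j).factorial * (Nat.totient q * (j.factorial * σ ^ j)) := by
          gcongr
          refine hm.trans ?_
          gcongr
      _ = Nat.totient q * (K ^ (2 * j) * σ ^ j * (j.factorial / (2 * j).factorial)) := by ring
      _ ≤ Nat.totient q * (K ^ (2 * j) * σ ^ j * ((2 * J + 1) / (4 ^ j * j.factorial))) := by
          gcongr ?_ * (?_ * ?_)
          rw [div_le_div_iff₀ hf1 (by positivity)]
          linarith
      _ = _ := by
          rw [mul_pow, div_pow, ← pow_mul]; field_simp
  refine (Finset.sum_le_sum h2).trans ?_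
  rw [← Finset.mul_sum, ← Finset.mul_sum]
  gcongr
  exact Real.sum_le_exp_of_nonneg (by positivity) _

set_option maxHeartbeats 2000000 in
open Classical in
lemma main_moment {K C : ℝ} (hK : 1 ≤ K) (hC : 1 ≤ C) : ∃ C3 ω0 : ℝ, 0 < C3 ∧
    ∀ (q : ℕ) [NeZero q], ∀ ℓ ω : ℝ, ℓ = Real.log q → ω = Real.log ℓ → 0 < ℓ → ω0 ≤ ω →
    ∀ s : ℂ, 1 / 2 ≤ s.re → ∀ V : DirichletCharacter ℂ q → ℝ, UpB s C ℓ V →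
    ∑ χ ∈ Finset.univ.filter (fun χ : DirichletCharacter ℂ q => χ ≠ 1), Real.exp (K * V χ)
      ≤ C3 * Nat.totient q * Real.exp ((K ^ 2 / 4 + 1) * ω) := by
  obtain ⟨B0, C2, ω1, hB0, hC2, hlarge⟩ := large_values (K := K) (C := C) (by linarith) hC
  obtain ⟨Cm, hCm, hmert⟩ := mertens2 (η := 1) one_pos
  have hK0 : 0 < K := by linarith
  obtain ⟨Cn, hCn, hmern⟩ := mertens2 (η := 1 / K ^ 2) (by positivity)
  set D := K * B0 with hD
  have hD0 : 0 < D := by positivity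
  set B := 1 + 3 * D * Real.exp 1 with hB
  have hB1 : 1 ≤ B := by rw [hB]; have : 0 < 3 * D * Real.exp 1 := by positivity
                         linarith
  set H := K * B + D + 2 with hH
  have hH2 : 2 < H := by rw [hH]; have : 0 < K * B := by positivity
                         linarith
  set ε := 1 / (12 * K) with hε
  have hε0 : 0 < ε := by positivity
  set A := 12 * K * C with hA
  have hA12 : 12 ≤ A := by rw [hA]; nlinarith
  set R := 2 * A * D with hR
  have hR0 : 0 < R := by positivity
  refine ⟨C2 + (Real.exp 1 + 2 * Real.exp R) * Real.exp K +
    Real.exp (12 * K) * (4 * (2 * K * B + 3) * 2 * Real.exp (K ^ 2 / 4 * Cn)),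
    max (max ω1 (max 1 Cm)) (max (2 * H) (3 * H * Real.exp R / (2 * ε ^ 2))), by positivity, ?_⟩
  intro q _ ℓ ω hℓ hω hℓ0 hω0 s hs V hV
  simp only [max_le_iff] at hω0
  obtain ⟨⟨hωa, hω1, hωC⟩, hωH, hωR⟩ := hω0
  have hN : (0:ℝ) ≤ Nat.totient q := by positivity
  have hωpos : 0 < ω := by linarith
  have hℓe : ℓ = Real.exp ω := by rw [hω, Real.exp_log hℓ0]
  have hℓω : H * ω ≤ ℓ := by
    rw [hℓe]
    have := Real.quadratic_le_exp_of_nonneg hωpos.le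
    nlinarith
  set L := A * ℓ / ω with hL
  set Lz := ℓ / (H * ω) with hLz
  have hH0 : 0 < H := by linarith
  have hL1 : 1 ≤ L := by
    rw [hL, le_div_iff₀ hωpos]
    nlinarith
  have hLz1 : 1 ≤ Lz := by rw [hLz, le_div_iff₀ (by positivity)]; linarith
  have hLzℓ : Lz ≤ ℓ := by
    rw [hLz, div_le_iff₀ (by positivity)]
    have : 1 ≤ H * ω := by nlinarith
    nlinarith
  have hlogLz : Real.log Lz ≤ ω := by rw [hω]; exact Real.log_le_log (by linarith) hLzℓ
  set P1 := Nat.primesLE ⌊Real.exp L⌋₊ with hP1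
  set P := P1.filter (fun p : ℕ => Real.log p ≤ Lz) with hP
  set P2 := P1.filter (fun p : ℕ => ¬ Real.log p ≤ Lz) with hP2
  set P3 := Nat.primesLE ⌊(Real.exp L) ^ (1/2:ℝ)⌋₊ with hP3
  have hP1p : ∀ p ∈ P1, p.Prime := fun p hp => (Nat.mem_primesLE.1 hp).2
  have hPp : ∀ p ∈ P, p.Prime := fun p hp => hP1p p (Finset.mem_filter.1 hp).1
  have hP2p : ∀ p ∈ P2, p.Prime := fun p hp => hP1p p (Finset.mem_filter.1 hp).1
  have hPz : ∀ p ∈ P, (p:ℝ) ^ 1 ≤ Real.exp Lz := fun p hp => by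
    rw [pow_one, ← Real.log_le_iff_le_exp (by exact_mod_cast (hPp p hp).pos)]
    exact (Finset.mem_filter.1 hp).2
  have hsplit : ∀ χ : DirichletCharacter ℂ q, PS χ P1 (a1 L s) 1 = PS χ P (a1 L s) 1 + PS χ P2 (a1 L s) 1 :=
    fun χ => (Finset.sum_filter_add_sum_filter_not P1 (fun p : ℕ => Real.log p ≤ Lz) _).symm
  have cP := count_bound (q := q) P hPp 1 one_ne_zero (a1 L s) (L := Lz) (u := D * ω) (σ := 3 * ω) (U := B * ω) (R := 1)
    (by linarith) hPz (by positivity) (by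
      rw [← hℓ, hLz]
      have : D * ω * (ℓ / (H * ω)) = (D / H) * ℓ := by field_simp
      rw [this]
      have : D / H < 1 := by rw [div_lt_one hH0, hH]; nlinarith
      nlinarith) (by
      refine sum_a1_sq hL1 hs _ hPp ?_
      refine (hmert Lz hLz1 _ fun p hp => ⟨hPp p hp, by simpa using hPz p hp⟩).trans ?_
      linarith) (by positivity) zero_le_one (by
      have hBB : 3 * D * Real.exp 1 ≤ B ^ 2 := by nlinarith
      rw [Real.exp_neg, ← div_eq_mul_inv, le_div_iff₀ (Real.exp_pos 1)]
      have : (0:ℝ) < ω ^ 2 := by positivity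
      nlinarith)
  have huL : ω / (2 * A) * L = ℓ / 2 := by rw [hL]; field_simp
  have hkey : 3 * H / 2 * ω ≤ (ε * ω) ^ 2 * Real.exp (-R) := by
    rw [div_le_iff₀ (by positivity)] at hωR
    rw [Real.exp_neg, ← div_eq_mul_inv, le_div_iff₀ (Real.exp_pos R)]
    nlinarith
  have hRu : R - R * (ω / (2 * A)) = R - D * ω := by rw [hR]; field_simp
  have c2 := count_bound (q := q) P2 hP2p 1 one_ne_zero (a1 L s) (L := L) (u := ω / (2 * A)) (σ := 3 * L / Lz) (U := ε * ω) (R := R)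
    (by linarith) (fun p hp => primesLE_exp (Finset.mem_filter.1 hp).1) (by positivity) (by
      rw [← hℓ, huL]; linarith) (by
      refine sum_a1_sq hL1 hs _ hP2p ?_
      refine prime_interval hL1 (by linarith) _ fun p hp => ⟨hP2p p hp, by simpa using primesLE_exp (Finset.mem_filter.1 hp).1, ?_⟩
      exact not_le.1 (Finset.mem_filter.1 hp).2) (by positivity) hR0.le (by
      refine le_trans (le_of_eq ?_) hkey
      rw [hL, hLz]; field_simp)
  have c3 := count_bound (q := q) P3 (fun p hp => (Nat.mem_primesLE.1 hp).2) 2 two_ne_zero (a2 L s) (L := L) (u := ω / (2 * A)) (σ := 2) (U := ε * ω) (R := R)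
    (by linarith) (fun p hp => primesLE_exp2 hp) (by positivity) (by
      rw [← hℓ, huL]; linarith) (sum_a2_sq hL1 hs _ (fun p hp => (Nat.mem_primesLE.1 hp).2)) (by positivity) hR0.le (by
      refine le_trans ?_ hkey
      have : ω / (2 * A) * 2 = ω / A := by field_simp
      rw [this, div_le_iff₀ (by linarith)]
      nlinarith [mul_pos hωpos (by linarith : 0 < A)])
  rw [hRu] at c2 c3
  rw [one_mul] at cP
  set J := ⌈K * B * ω⌉₊ with hJ
  have hJ1 : K * B * ω ≤ J := Nat.le_ceil _
  have hJ2 : (J:ℝ) < K * B * ω + 1 := Nat.ceil_lt_add_one (by positivity)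
  have hme := moment_exp (q := q) P hPp (a1 L s) (Lz := Lz) (σ := (1 + 1 / K ^ 2) * ω + Cn) (K := K) (J := J) hK0.le (by linarith) hPz
    (by
      rw [← hℓ, hLz, mul_div_assoc', div_lt_iff₀ (by positivity), mul_comm (J:ℝ)]
      refine mul_lt_mul_of_pos_left ?_ hℓ0
      rw [hH]; nlinarith) (by
      refine sum_a1_sq hL1 hs _ hPp ?_
      refine (hmern Lz hLz1 _ fun p hp => ⟨hPp p hp, by simpa using hPz p hp⟩).trans ?_
      gcongr)
  have hlv := hlarge q ℓ ω hℓ hω hℓ0 hωa s hs V hV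
  have hpt : ∀ χ ∈ Finset.univ.filter (fun χ : DirichletCharacter ℂ q => χ ≠ 1), Real.exp (K * V χ) ≤
      (if (χ ≠ 1 ∧ B0 * ω + 1 ≤ V χ) then Real.exp (K * V χ) else 0) +
      ((if B * ω ≤ ‖PS χ P (a1 L s) 1‖ then Real.exp (K * (B0 * ω + 1)) else 0) +
       (if ε * ω ≤ ‖PS χ P2 (a1 L s) 1‖ then Real.exp (K * (B0 * ω + 1)) else 0) +
       (if ε * ω ≤ ‖PS χ P3 (a2 L s) 2‖ then Real.exp (K * (B0 * ω + 1)) else 0)) +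
      Real.exp (K * (3 * ε * ω + 12)) *
        (if K * ‖PS χ P (a1 L s) 1‖ ≤ J then Real.exp (K * ‖PS χ P (a1 L s) 1‖) else 0) := by
    intro χ hχ
    have hχ1 := (Finset.mem_filter.1 hχ).2
    have i0 : 0 ≤ (if (χ ≠ 1 ∧ B0 * ω + 1 ≤ V χ) then Real.exp (K * V χ) else 0) := by split_ifs <;> positivity
    have i1 : 0 ≤ (if B * ω ≤ ‖PS χ P (a1 L s) 1‖ then Real.exp (K * (B0 * ω + 1)) else 0) := by split_ifs <;> positivity
    have i2 : 0 ≤ (if ε * ω ≤ ‖PS χ P2 (a1 L s) 1‖ then Real.exp (K * (B0 * ω + 1)) else 0) := by split_ifs <;> positivity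
    have i3 : 0 ≤ (if ε * ω ≤ ‖PS χ P3 (a2 L s) 2‖ then Real.exp (K * (B0 * ω + 1)) else 0) := by split_ifs <;> positivity
    have i4 : 0 ≤ Real.exp (K * (3 * ε * ω + 12)) *
        (if K * ‖PS χ P (a1 L s) 1‖ ≤ J then Real.exp (K * ‖PS χ P (a1 L s) 1‖) else 0) := by split_ifs <;> positivity
    by_cases h0 : B0 * ω + 1 ≤ V χ
    · rw [if_pos ⟨hχ1, h0⟩]; linarith
    push Not at h0
    have hexp : Real.exp (K * V χ) ≤ Real.exp (K * (B0 * ω + 1)) := by gcongr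
    by_cases h1 : B * ω ≤ ‖PS χ P (a1 L s) 1‖
    · rw [if_pos h1] at i1 ⊢; linarith
    by_cases h2 : ε * ω ≤ ‖PS χ P2 (a1 L s) 1‖
    · rw [if_pos h2] at i2 ⊢; linarith
    by_cases h3 : ε * ω ≤ ‖PS χ P3 (a2 L s) 2‖
    · rw [if_pos h3] at i3 ⊢; linarith
    push Not at h1 h2 h3
    have hb := (hV χ hχ1).2 L hL1
    rw [hsplit χ] at hb
    have hn := norm_add_le (PS χ P (a1 L s) 1) (PS χ P2 (a1 L s) 1)
    have hCL : C * ℓ / L = ε * ω := by rw [hL, hA, hε]; field_simp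
    rw [hCL] at hb
    have hKJ : K * ‖PS χ P (a1 L s) 1‖ ≤ J := by
      refine le_trans ?_ hJ1
      rw [mul_assoc]; gcongr
    have : Real.exp (K * V χ) ≤ Real.exp (K * (3 * ε * ω + 12)) *
        (if K * ‖PS χ P (a1 L s) 1‖ ≤ J then Real.exp (K * ‖PS χ P (a1 L s) 1‖) else 0) := by
      rw [if_pos hKJ, ← Real.exp_add, ← mul_add]
      gcongr
      linarith
    linarith
  refine (Finset.sum_le_sum hpt).trans ?_
  rw [Finset.sum_add_distrib, Finset.sum_add_distrib, ← Finset.mul_sum]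
  have hDω : Real.exp (K * (B0 * ω + 1)) = Real.exp (D * ω) * Real.exp K := by
    rw [← Real.exp_add, hD]; congr 1; ring
  have t1 : ∑ χ ∈ Finset.univ.filter (fun χ : DirichletCharacter ℂ q => χ ≠ 1),
      (if (χ ≠ 1 ∧ B0 * ω + 1 ≤ V χ) then Real.exp (K * V χ) else 0) ≤ C2 * Nat.totient q := by
    refine le_trans ?_ hlv
    rw [Finset.sum_filter (p := fun χ : DirichletCharacter ℂ q => χ ≠ 1 ∧ B0 * ω + 1 ≤ V χ)]
    refine Finset.sum_le_sum_of_subset_of_nonneg (Finset.filter_subset _ _) fun χ _ _ => ?_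
    split_ifs <;> positivity
  have cnt : ∀ (p : DirichletCharacter ℂ q → Prop) (r : ℝ), ((Finset.univ.filter p).card : ℝ) ≤ Nat.totient q * Real.exp (r - D * ω) →
      ∑ χ ∈ Finset.univ.filter (fun χ : DirichletCharacter ℂ q => χ ≠ 1), (if p χ then Real.exp (K * (B0 * ω + 1)) else 0)
        ≤ Nat.totient q * (Real.exp r * Real.exp K) := by
    intro p r hp
    refine le_trans (Finset.sum_le_sum_of_subset_of_nonneg (Finset.filter_subset _ _) fun χ _ _ => by split_ifs <;> positivity) ?_
    rw [← Finset.sum_filter, Finset.sum_const, nsmul_eq_mul, hDω]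
    calc _ ≤ (Nat.totient q * Real.exp (r - D * ω)) * (Real.exp (D * ω) * Real.exp K) := by gcongr
      _ = Nat.totient q * ((Real.exp (r - D * ω) * Real.exp (D * ω)) * Real.exp K) := by ring
      _ = _ := by rw [← Real.exp_add]; congr 3; ring_nf
  have t2 := cnt _ _ cP
  have t3 := cnt _ _ c2
  have t4 := cnt _ _ c3
  have t5 : ∑ χ ∈ Finset.univ.filter (fun χ : DirichletCharacter ℂ q => χ ≠ 1),
      (if K * ‖PS χ P (a1 L s) 1‖ ≤ J then Real.exp (K * ‖PS χ P (a1 L s) 1‖) else 0) ≤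
      4 * Nat.totient q * ((2 * J + 1) * Real.exp (K ^ 2 / 4 * ((1 + 1 / K ^ 2) * ω + Cn))) := by
    refine le_trans (Finset.sum_le_sum_of_subset_of_nonneg (Finset.filter_subset _ _) fun χ _ _ => ?_) hme
    split_ifs <;> positivity
  rw [Finset.sum_add_distrib, Finset.sum_add_distrib]
  have hone : 1 ≤ Real.exp ((K ^ 2 / 4 + 1) * ω) := Real.one_le_exp (by positivity)
  have t6 : Real.exp (K * (3 * ε * ω + 12)) * ∑ χ ∈ Finset.univ.filter (fun χ : DirichletCharacter ℂ q => χ ≠ 1),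
      (if K * ‖PS χ P (a1 L s) 1‖ ≤ J then Real.exp (K * ‖PS χ P (a1 L s) 1‖) else 0) ≤
      Real.exp (12 * K) * (4 * (2 * K * B + 3) * 2 * Real.exp (K ^ 2 / 4 * Cn)) * (Nat.totient q * Real.exp ((K ^ 2 / 4 + 1) * ω)) := by
    have hJb : (2 * J + 1 : ℝ) ≤ (2 * K * B + 3) * 2 * Real.exp (ω / 2) := by
      have h1 : ω ≤ 2 * Real.exp (ω / 2) := by have := Real.add_one_le_exp (ω / 2); linarith
      have h2 : (2 * J + 1 : ℝ) ≤ (2 * K * B + 3) * ω := by nlinarith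
      refine h2.trans ?_
      rw [mul_assoc (2 * K * B + 3)]
      exact mul_le_mul_of_nonneg_left h1 (by positivity)
    calc _ ≤ Real.exp (K * (3 * ε * ω + 12)) * (4 * Nat.totient q * (((2 * K * B + 3) * 2 * Real.exp (ω / 2)) * Real.exp (K ^ 2 / 4 * ((1 + 1 / K ^ 2) * ω + Cn)))) := by
          refine mul_le_mul_of_nonneg_left (t5.trans ?_) (Real.exp_nonneg _)
          gcongr
      _ = (4 * (2 * K * B + 3) * 2) * Nat.totient q * (Real.exp (K * (3 * ε * ω + 12)) * Real.exp (ω / 2) * Real.exp (K ^ 2 / 4 * ((1 + 1 / K ^ 2) * ω + Cn))) := by ring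
      _ = (4 * (2 * K * B + 3) * 2) * Nat.totient q * (Real.exp (12 * K) * Real.exp (K ^ 2 / 4 * Cn) * Real.exp ((K ^ 2 / 4 + 1) * ω)) := by
          rw [← Real.exp_add, ← Real.exp_add, ← Real.exp_add, ← Real.exp_add]
          congr 2
          rw [hε]; field_simp; ring
      _ = _ := by ring
  calc _ ≤ C2 * Nat.totient q + (Nat.totient q * (Real.exp 1 * Real.exp K) + Nat.totient q * (Real.exp R * Real.exp K) +
        Nat.totient q * (Real.exp R * Real.exp K)) + Real.exp (12 * K) * (4 * (2 * K * B + 3) * 2 * Real.exp (K ^ 2 / 4 * Cn)) * (Nat.totient q * Real.exp ((K ^ 2 / 4 + 1) * ω)) := by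
        gcongr
    _ = (C2 + (Real.exp 1 + 2 * Real.exp R) * Real.exp K) * Nat.totient q * 1 + Real.exp (12 * K) * (4 * (2 * K * B + 3) * 2 * Real.exp (K ^ 2 / 4 * Cn)) * (Nat.totient q * Real.exp ((K ^ 2 / 4 + 1) * ω)) := by ring
    _ ≤ (C2 + (Real.exp 1 + 2 * Real.exp R) * Real.exp K) * Nat.totient q * Real.exp ((K ^ 2 / 4 + 1) * ω) + Real.exp (12 * K) * (4 * (2 * K * B + 3) * 2 * Real.exp (K ^ 2 / 4 * Cn)) * (Nat.totient q * Real.exp ((K ^ 2 / 4 + 1) * ω)) := by gcongr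
    _ = _ := by ring


/-! ### Part 4c : moments of L at a fixed height -/

lemma PS_le_card {q : ℕ} (χ : DirichletCharacter ℂ q) (n : ℕ) (a : ℕ → ℂ) (e : ℕ)
    (ha : ∀ p, p.Prime → ‖a p‖ ^ 2 ≤ 1) : ‖PS χ (Nat.primesLE n) a e‖ ≤ n := by
  refine (norm_sum_le _ _).trans ?_
  have h1 : ∀ p ∈ Nat.primesLE n, ‖a p * χ ((p ^ e : ℕ) : ZMod q)‖ ≤ 1 := by
    intro p hp
    rw [norm_mul]
    have h2 := ha p (Nat.mem_primesLE.1 hp).2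
    have h3 : ‖a p‖ ≤ 1 := by
      by_contra h
      push Not at h
      nlinarith
    exact mul_le_one₀ h3 (norm_nonneg _) (DirichletCharacter.norm_le_one χ _)
  refine (Finset.sum_le_card_nsmul _ _ 1 h1).trans ?_
  rw [nsmul_eq_mul, mul_one]
  have : (Nat.primesLE n) ⊆ Finset.Icc 1 n := fun p hp => by
    have := Nat.mem_primesLE.1 hp
    exact Finset.mem_Icc.2 ⟨this.2.pos, this.1⟩
  have := Finset.card_le_card this
  rw [Nat.card_Icc] at this
  exact_mod_cast this.trans (by omega)

lemma norm_L_eq {q : ℕ} {χ : DirichletCharacter ℂ q} [NeZero q] {G : ℂ → ℂ} (hG : IsLogL χ G) {s : ℂ} (hs : 1 / 2 < s.re) :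
    ‖DirichletCharacter.LFunction χ s‖ = Real.exp (G s).re := by
  rw [← hG.2.1 s hs, Complex.norm_exp]

lemma L_line_bound : ∃ C4 : ℝ, 0 < C4 ∧ ∀ (q : ℕ) [NeZero q] (χ : DirichletCharacter ℂ q) (_ : χ ≠ 1) (_ : dirichletRH χ)
    (c : ℝ) (_ : 1 / 2 < c) (_ : c ≤ 3 / 4) (t : ℝ),
    ‖DirichletCharacter.LFunction χ ⟨c, t⟩‖ ≤ C4 * (QQ q t) ^ (1/4:ℝ) := by
  obtain ⟨C1, hC1, hup⟩ := logL_upper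
  set L := 4 * C1 with hL
  refine ⟨Real.exp (Real.exp L + (Real.exp L) ^ (1/2:ℝ) + 12), by positivity, ?_⟩
  intro q _ χ hχ hRH c hc hc1 t
  obtain ⟨G, hG⟩ := exists_logL hχ hRH
  rw [norm_L_eq hG (by simpa using hc)]
  have hL1 : 1 ≤ L := by linarith
  have h1 := hup q χ hχ G hG c hc hc1 t L hL1
  have hs : 1 / 2 ≤ (⟨c, t⟩ : ℂ).re := hc.le
  have h2 := sq_split χ hs hL1
  have h3 := PS_le_card χ ⌊Real.exp L⌋₊ (a1 L ⟨c, t⟩) 1 (fun p hp => (norm_a1_sq hL1 hs hp).trans (by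
    have : (1:ℝ) ≤ p := by exact_mod_cast hp.one_lt.le
    exact div_le_one_of_le₀ this (by positivity)))
  have h4 := PS_le_card χ ⌊(Real.exp L) ^ (1/2:ℝ)⌋₊ (a2 L ⟨c, t⟩) 2 (fun p hp => (norm_a2_sq hL1 hs hp).trans (by
    have : (1:ℝ) ≤ p := by exact_mod_cast hp.one_lt.le
    exact div_le_one_of_le₀ (Real.one_le_rpow this (by norm_num)) (by positivity)))
  have h5 := Nat.floor_le (Real.exp_nonneg L)
  have h6 := Nat.floor_le (show 0 ≤ (Real.exp L) ^ (1/2:ℝ) by positivity)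
  have hQ := two_le_QQ q t
  have h7 : C1 * Real.log (QQ q t) / L = Real.log (QQ q t) * (1/4) := by rw [hL]; field_simp
  rw [Real.rpow_def_of_pos (show 0 < QQ q t by linarith), ← Real.exp_add]
  apply Real.exp_le_exp.2
  unfold PS at h3 h4
  linarith

lemma QQ_le {q : ℕ} (hq : 3 ≤ q) {t : ℝ} (ht : |t| ≤ (q:ℝ) ^ 4) : QQ q t ≤ (q:ℝ) ^ 6 := by
  have h3 : (3:ℝ) ≤ q := by exact_mod_cast hq
  have h5 : (81:ℝ) ≤ (q:ℝ) ^ 4 := by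
    have : (3:ℝ) ^ 4 ≤ (q:ℝ) ^ 4 := by gcongr
    linarith
  calc QQ q t ≤ q * ((q:ℝ) ^ 4 + 2) := by rw [QQ]; gcongr
    _ ≤ q * (q * (q:ℝ) ^ 4) := by gcongr; nlinarith
    _ = _ := by ring

open Classical in
lemma L_moment {K : ℝ} (hK : 1 ≤ K) : ∃ C3 : ℝ, 0 < C3 ∧ ∃ q0 : ℕ, ∀ (q : ℕ) [NeZero q], q0 ≤ q →
    (∀ χ : DirichletCharacter ℂ q, dirichletRH χ) → ∀ t : ℝ, |t| ≤ (q:ℝ) ^ 4 →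
    4 ≤ Real.log q ∧
    ∑ χ ∈ Finset.univ.filter (fun χ : DirichletCharacter ℂ q => χ ≠ 1),
      ‖DirichletCharacter.LFunction χ ⟨1 / 2 + 1 / Real.log q, t⟩‖ ^ K
      ≤ C3 * Nat.totient q * Real.log q ^ (K ^ 2 / 4 + 1) := by
  obtain ⟨C1, hC1, hup⟩ := logL_upper
  obtain ⟨C3, ω0, hC3, hmain⟩ := main_moment hK (C := 6 * C1) (by linarith)
  refine ⟨C3, hC3, ⌈Real.exp (Real.exp (max ω0 4))⌉₊, ?_⟩
  intro q _ hq hRH t ht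
  have hq1 : Real.exp (Real.exp (max ω0 4)) ≤ q := (Nat.le_ceil _).trans (by exact_mod_cast hq)
  have hq0 : (0:ℝ) < q := (Real.exp_pos _).trans_le hq1
  have hl1 : Real.exp (max ω0 4) ≤ Real.log q := (Real.le_log_iff_exp_le hq0).2 hq1
  have hl0 : 0 < Real.log q := (Real.exp_pos _).trans_le hl1
  have hω : max ω0 4 ≤ Real.log (Real.log q) := (Real.le_log_iff_exp_le hl0).2 hl1
  have hl4 : 4 ≤ Real.log q := by
    have := Real.add_one_le_exp (max ω0 4)
    have := le_max_right ω0 4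
    linarith
  have hq3 : 3 ≤ q := by
    have := Real.log_le_sub_one_of_pos hq0
    have : (3:ℝ) ≤ q := by linarith
    exact_mod_cast this
  have hq3' : (3:ℝ) ≤ q := by exact_mod_cast hq3
  refine ⟨hl4, ?_⟩
  set c := 1 / 2 + 1 / Real.log q with hc
  have hc1 : 1 / 2 < c := by have : 0 < 1 / Real.log q := by positivity
                             linarith
  have hc2 : c ≤ 3 / 4 := by
    have : 1 / Real.log q ≤ 1 / 4 := by gcongr
    linarith
  have hlQ : Real.log (QQ q t) ≤ 6 * Real.log q := by
    have h := Real.log_le_log (by linarith [two_le_QQ q t]) (QQ_le hq3 ht)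
    rw [Real.log_pow] at h
    exact_mod_cast h
  have hre : (⟨c, t⟩ : ℂ).re = c := rfl
  have hne : ∀ χ : DirichletCharacter ℂ q, χ ≠ 1 → 0 < ‖DirichletCharacter.LFunction χ ⟨c, t⟩‖ := by
    intro χ hχ
    obtain ⟨G, hG⟩ := exists_logL hχ (hRH χ)
    rw [norm_L_eq hG (by rw [hre]; exact hc1)]
    exact Real.exp_pos _
  have h := hmain q (Real.log q) (Real.log (Real.log q)) rfl rfl hl0 ((le_max_left _ _).trans hω)
    ⟨c, t⟩ (by rw [hre]; exact hc1.le) (fun χ => Real.log ‖DirichletCharacter.LFunction χ ⟨c, t⟩‖) ?_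
  · have e : Real.exp ((K ^ 2 / 4 + 1) * Real.log (Real.log q)) = Real.log q ^ (K ^ 2 / 4 + 1) := by
      rw [Real.rpow_def_of_pos hl0, mul_comm]
    rw [e] at h
    refine le_trans (le_of_eq ?_) h
    refine Finset.sum_congr rfl fun χ hχ => ?_
    rw [Real.rpow_def_of_pos (hne χ (Finset.mem_filter.1 hχ).2), mul_comm]
  · intro χ hχ
    constructor
    · have hb := L_bound hχ (s := ⟨c, t⟩) (by rw [hre]; linarith)
      rw [Real.log_le_iff_le_exp (hne χ hχ)]
      have e6 : Real.exp (6 * Real.log q) = (q:ℝ) ^ 6 := by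
        rw [mul_comm, ← Real.rpow_def_of_pos hq0]; norm_cast
      rw [e6]
      refine hb.trans ?_
      rw [hre]
      have hn : ‖(⟨c, t⟩ : ℂ)‖ ≤ 1 + (q:ℝ) ^ 4 := by
        refine (Complex.norm_le_abs_re_add_abs_im _).trans ?_
        have : |c| ≤ 1 := by rw [abs_of_pos (by linarith)]; linarith
        simp only
        linarith
      rw [div_le_iff₀ (by linarith)]
      have h4 : (1:ℝ) ≤ (q:ℝ) ^ 4 := one_le_pow₀ (by linarith)
      have : (q:ℝ) * ‖(⟨c, t⟩ : ℂ)‖ ≤ q * (2 * (q:ℝ) ^ 4) := by gcongr; linarith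
      have h6 : (q:ℝ) ^ 6 = q * (q:ℝ)^ 4 * q := by ring
      have h7 : 0 < q * (q:ℝ) ^ 4 := by positivity
      rw [h6]
      by_cases hq4 : (4:ℝ) ≤ q
      · have : q * (q:ℝ) ^ 4 * 4 ≤ q * (q:ℝ)^ 4 * q := by gcongr
        nlinarith
      · exfalso
        have := Real.log_le_sub_one_of_pos hq0
        linarith
    · intro L hL
      obtain ⟨G, hG⟩ := exists_logL hχ (hRH χ)
      show Real.log ‖DirichletCharacter.LFunction χ ⟨c, t⟩‖ ≤ _
      rw [norm_L_eq hG (by rw [hre]; exact hc1), Real.log_exp]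
      have h1 := hup q χ hχ G hG c hc1 hc2 t L hL
      have h2 := sq_split χ (s := ⟨c, t⟩) (by rw [hre]; exact hc1.le) hL
      have h3 : C1 * Real.log (QQ q t) / L ≤ 6 * C1 * Real.log q / L := by
        gcongr ?_ / L
        nlinarith
      unfold PS
      linarith


lemma trap_eq {N : ℕ} (hN : 2 ≤ N) {n : ℕ} (hn : 1 ≤ n) :
    Real.log (N+1) * tri (Real.log (N+1)) (Real.log n) - Real.log N * tri (Real.log N) (Real.log n)
      = (Real.log (N+1) - Real.log N) * (if n ≤ N then 1 else 0) := by
  have hN' : (2:ℝ) ≤ N := by exact_mod_cast hN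
  have hn' : (1:ℝ) ≤ n := by exact_mod_cast hn
  have hB : 0 < Real.log N := Real.log_pos (by linarith)
  have hBA : Real.log N ≤ Real.log (N+1) := Real.log_le_log (by linarith) (by linarith)
  have hA : 0 < Real.log ((N:ℝ)+1) := by linarith
  have h0 : 0 ≤ Real.log n := Real.log_nonneg hn'
  split_ifs with h
  · have h1 : Real.log n ≤ Real.log N := Real.log_le_log (by linarith) (by exact_mod_cast h)
    rw [tri_eq hA (by rw [abs_of_nonneg h0]; linarith), tri_eq hB (by rw [abs_of_nonneg h0]; linarith), abs_of_nonneg h0]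
    field_simp
    ring
  · have h2 : ((N:ℝ)+1) ≤ n := by exact_mod_cast (by omega : N + 1 ≤ n)
    have h1 : Real.log (N+1) ≤ Real.log n := Real.log_le_log (by linarith) h2
    rw [tri_eq_zero hA (by rw [abs_of_nonneg h0]; linarith), tri_eq_zero hB (by rw [abs_of_nonneg h0]; linarith)]
    ring

lemma exp_diff_le {A B c : ℝ} (hBA : B ≤ A) (s : ℂ) (hs : ∀ u ∈ Set.Icc B A, s.re * u ≤ c) :
    ‖cexp (A * s) - cexp (B * s)‖ ≤ ‖s‖ * Real.exp c * (A - B) := by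
  have := norm_image_sub_le_of_norm_deriv_le_segment' (f := fun u : ℝ => cexp (u * s)) (f' := fun u : ℝ => cexp (u * s) * s)
    (a := B) (b := A) (C := ‖s‖ * Real.exp c) (fun x hx => by
      have h1 : HasDerivAt (fun u : ℝ => cexp (u * s)) (cexp (x * s) * (1 * s)) x :=
        ((Complex.ofRealCLM.hasDerivAt (x := x)).mul_const s).cexp
      rw [one_mul] at h1
      exact h1.hasDerivWithinAt) (fun x hx => by
      rw [norm_mul, mul_comm, Complex.norm_exp]
      gcongr
      have := hs x ⟨hx.1, hx.2.le⟩
      simp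
      linarith) A ⟨hBA, le_rfl⟩
  exact this

noncomputable def Kn (N : ℕ) (z : ℂ) : ℂ :=
  ((Real.log (N+1) : ℝ) * Fk (Real.log (N+1)) z - (Real.log N : ℝ) * Fk (Real.log N) z) /
    ((Real.log (N+1) - Real.log N : ℝ) : ℂ)

lemma log_diff_ge {N : ℕ} (hN : 2 ≤ N) : 1 / ((N:ℝ)+1) ≤ Real.log (N+1) - Real.log N := by
  have hN' : (2:ℝ) ≤ N := by exact_mod_cast hN
  have h := Real.one_sub_inv_le_log_of_pos (show 0 < ((N:ℝ)+1)/N by positivity)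
  rw [Real.log_div (by positivity) (by positivity)] at h
  refine le_trans (le_of_eq ?_) h
  field_simp
  ring

lemma Kn_bound {N : ℕ} (hN : 2 ≤ N) {c : ℝ} (hc : 1/2 < c) (τ : ℝ) :
    ‖Kn N (c + τ * I)‖ ≤ 6 * ((N:ℝ)+1)^c / (1 + |τ|) ∧
    ‖Kn N (c + τ * I)‖ ≤ 36 * ((N:ℝ)+1)^c * (N+1) / (1 + |τ|)^2 := by
  have hN' : (2:ℝ) ≤ N := by exact_mod_cast hN
  have hB : 0 < Real.log N := Real.log_pos (by linarith)
  have hd := log_diff_ge hN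
  have hd0 : 0 < 1 / ((N:ℝ)+1) := by positivity
  set A := Real.log ((N:ℝ)+1) with hAd
  set B := Real.log (N:ℝ) with hBd
  set s : ℂ := c + τ * I with hs
  have hre : s.re = c := by simp [hs]
  have him : s.im = τ := by simp [hs]
  have hA : 0 < A := by linarith
  have hW : ((N:ℝ)+1)^c = Real.exp (c * A) := by
    rw [Real.rpow_def_of_pos (by positivity), mul_comm]
  have hs0 : (1 + |τ|) / 3 ≤ ‖s‖ := by
    have h1 := Complex.abs_re_le_norm s
    have h2 := Complex.abs_im_le_norm s
    rw [hre, abs_of_pos (by linarith)] at h1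
    rw [him] at h2
    linarith
  have hsp : 0 < ‖s‖ := lt_of_lt_of_le (by positivity) hs0
  have hsne : s ≠ 0 := norm_pos_iff.1 hsp
  have hAB : 0 < A - B := by linarith
  have hABc : ((A - B : ℝ) : ℂ) ≠ 0 := by exact_mod_cast hAB.ne'
  have hAc : (A:ℂ) ≠ 0 := by exact_mod_cast hA.ne'
  have hBc : (B:ℂ) ≠ 0 := by exact_mod_cast hB.ne'
  have hK : Kn N s = ((cexp (A * s) - cexp (B * s)) - (cexp ((B:ℝ) * (-s)) - cexp ((A:ℝ) * (-s)))) / (((A - B : ℝ) : ℂ) * s ^ 2) := by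
    unfold Kn
    rw [← hAd, ← hBd, Fk_eq A hA s hsne, Fk_eq B hB s hsne]
    field_simp
    ring_nf
  have hn : ‖Kn N s‖ = ‖(cexp (A * s) - cexp (B * s)) - (cexp ((B:ℝ) * (-s)) - cexp ((A:ℝ) * (-s)))‖ / ((A - B) * ‖s‖^2) := by
    rw [hK, norm_div, norm_mul, Complex.norm_real, Real.norm_of_nonneg hAB.le, norm_pow]
  have hE : 0 < Real.exp (c * A) := Real.exp_pos _
  constructor
  · have e1 := exp_diff_le (c := c * A) (sub_nonneg.1 hAB.le) s (fun u hu => by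
      rw [hre]; exact mul_le_mul_of_nonneg_left hu.2 (by linarith))
    have e2 := exp_diff_le (c := c * A) (sub_nonneg.1 hAB.le) (-s) (fun u hu => by
      have h0 : 0 ≤ u := hB.le.trans hu.1
      rw [Complex.neg_re, hre]; nlinarith)
    rw [norm_neg] at e2
    rw [hn, hW]
    have e3 : ‖(cexp (A * s) - cexp (B * s)) - (cexp ((B:ℝ) * (-s)) - cexp ((A:ℝ) * (-s)))‖ ≤ 2 * (‖s‖ * Real.exp (c * A) * (A - B)) := by
      refine (norm_sub_le _ _).trans ?_
      rw [norm_sub_rev (cexp ((B:ℝ) * (-s)))]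
      linarith
    calc _ ≤ 2 * (‖s‖ * Real.exp (c * A) * (A - B)) / ((A - B) * ‖s‖^2) := by gcongr
      _ = 2 * Real.exp (c * A) / ‖s‖ := by field_simp
      _ ≤ 2 * Real.exp (c * A) / ((1 + |τ|) / 3) := by gcongr
      _ = _ := by field_simp; ring
  · have f1 : ∀ z : ℂ, z.re ≤ c * A → ‖cexp z‖ ≤ Real.exp (c * A) := by
      intro z hz
      rw [Complex.norm_exp]
      exact Real.exp_le_exp.2 hz
    have hcA : 0 < c * A := mul_pos (by linarith) hA
    have g1 := f1 (A * s) (by simp [hre]; linarith)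
    have g2 := f1 (B * s) (by simp [hre]; nlinarith)
    have g3 := f1 ((B:ℝ) * (-s)) (by simp [hre]; nlinarith)
    have g4 := f1 ((A:ℝ) * (-s)) (by simp [hre]; nlinarith)
    have e3 : ‖(cexp (A * s) - cexp (B * s)) - (cexp ((B:ℝ) * (-s)) - cexp ((A:ℝ) * (-s)))‖ ≤ 4 * Real.exp (c * A) := by
      refine (norm_sub_le _ _).trans ?_
      have := norm_sub_le (cexp (A * s)) (cexp (B * s))
      have := norm_sub_le (cexp ((B:ℝ) * (-s))) (cexp ((A:ℝ) * (-s)))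
      linarith
    rw [hn, hW]
    calc _ ≤ 4 * Real.exp (c * A) / ((1 / ((N:ℝ)+1)) * ((1 + |τ|) / 3)^2) := by gcongr
      _ = _ := by field_simp; ring

lemma QQ_quarter {q : ℕ} (hq : 1 ≤ q) (t : ℝ) : (QQ q t) ^ (1/4:ℝ) ≤ 2 * q * (1 + |t|) ^ (1/4:ℝ) := by
  have hq' : (1:ℝ) ≤ q := by exact_mod_cast hq
  have h1 : QQ q t ≤ (2 * q) * (1 + |t|) := by
    unfold QQ
    have := abs_nonneg t
    nlinarith
  have h0 : 0 ≤ QQ q t := by unfold QQ; positivity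
  calc (QQ q t) ^ (1/4:ℝ) ≤ ((2 * q) * (1 + |t|)) ^ (1/4:ℝ) := by gcongr
    _ = (2 * q) ^ (1/4:ℝ) * (1 + |t|) ^ (1/4:ℝ) := by rw [Real.mul_rpow (by positivity) (by positivity)]
    _ ≤ (2 * q) ^ (1:ℝ) * (1 + |t|) ^ (1/4:ℝ) := by
      gcongr
      · linarith
      · norm_num
    _ = _ := by rw [Real.rpow_one]

lemma perron {C4 : ℝ} (hC4 : 0 < C4) (hline : ∀ (q : ℕ) [NeZero q] (χ : DirichletCharacter ℂ q), χ ≠ 1 → dirichletRH χ →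
      ∀ c : ℝ, 1/2 < c → c ≤ 3/4 → ∀ t : ℝ, ‖DirichletCharacter.LFunction χ ⟨c, t⟩‖ ≤ C4 * (QQ q t) ^ (1/4:ℝ))
    {q : ℕ} [NeZero q] (χ : DirichletCharacter ℂ q) (hχ : χ ≠ 1) (hRH : dirichletRH χ) {c : ℝ} (hc : 1/2 < c) (hc' : c ≤ 3/4)
    {N : ℕ} (hN : 2 ≤ N) :
    2 * π * ∑ n ∈ Finset.Icc 1 N, χ n = ∫ τ : ℝ, DirichletCharacter.LFunction χ (c + τ * I) * Kn N (c + τ * I) := by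
  have hN' : (2:ℝ) ≤ N := by exact_mod_cast hN
  have hq1 : 1 ≤ q := Nat.one_le_iff_ne_zero.2 (NeZero.ne q)
  have hq1' : (1:ℝ) ≤ q := by exact_mod_cast hq1
  have hB : 0 < Real.log N := Real.log_pos (by linarith)
  have hd := log_diff_ge hN
  have hd0 : 0 < 1 / ((N:ℝ)+1) := by positivity
  have hA : 0 < Real.log ((N:ℝ)+1) := by linarith
  set Kc : ℝ := C4 * (2 * q) + 2 * q * (2 + 1) with hKc
  have key : ∀ a : ℝ, 0 < a → MeasureTheory.Integrable (fun τ : ℝ => DirichletCharacter.LFunction χ (c + τ * I) * Fk a (c + τ * I)) ∧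
    ∫ τ : ℝ, DirichletCharacter.LFunction χ (c + τ * I) * Fk a (c + τ * I) =
      2 * π * ∑' n, LSeries.term (fun n => χ n) 0 n * tri a (Real.log n) := by
    intro a ha
    have hsum : LSeriesSummable (fun n => χ n) ((0:ℂ) + (2:ℝ)) := by
      refine LSeriesSummable_of_bounded_of_one_lt_re (m := 1) (fun n _ => χ.norm_le_one _) ?_
      simp
    refine tri_shift ha (D := DirichletCharacter.LFunction χ) (σ0 := c) (σ1 := 2) (K := Kc) (by linarith)
      (fun z _ _ => (DirichletCharacter.differentiable_LFunction hχ) z) ?_ ?_ hsum ?_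
    · intro z h1 h2
      have hz : 0 < z.re := by linarith
      refine (L_bound hχ hz).trans ?_
      have h3 := Complex.norm_le_abs_re_add_abs_im z
      rw [abs_of_pos hz] at h3
      have h4 := abs_nonneg z.im
      rw [Real.rpow_one]
      calc q * ‖z‖ / z.re ≤ q * (2 + |z.im|) / (1/2) := by
            gcongr
            · linarith
            · linarith
        _ = 2 * q * (2 + |z.im|) := by ring
        _ ≤ 2 * q * ((2 + 1) * (1 + |z.im|)) := by gcongr; linarith
        _ = (2 * q * (2 + 1)) * (1 + |z.im|) := by ring
        _ ≤ _ := by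
          gcongr
          rw [hKc]
          have : 0 < C4 * (2 * q) := by positivity
          linarith
    · intro τ
      have e : (c:ℂ) + τ * I = ⟨c, τ⟩ := by apply Complex.ext <;> simp
      rw [e]
      refine (hline q χ hχ hRH c hc hc' τ).trans ?_
      calc C4 * QQ q τ ^ (1/4:ℝ) ≤ C4 * (2 * q * (1 + |τ|) ^ (1/4:ℝ)) := by gcongr; exact QQ_quarter hq1 τ
        _ ≤ C4 * (2 * q * (1 + |τ|) ^ (1/2:ℝ)) := by
          gcongr
          · linarith [abs_nonneg τ]
          · norm_num
        _ = (C4 * (2 * q)) * (1 + |τ|) ^ (1/2:ℝ) := by ring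
        _ ≤ _ := by
          gcongr
          rw [hKc]
          have : (0:ℝ) ≤ 2 * q * (2 + 1) := by positivity
          linarith
    · intro τ
      rw [zero_add]
      exact DirichletCharacter.LFunction_eq_LSeries χ (by simp)
  obtain ⟨iA, eA⟩ := key _ hA
  obtain ⟨iB, eB⟩ := key _ hB
  have hfin : ∀ a : ℝ, 0 < a → a ≤ Real.log ((N:ℝ)+1) → ∑' n, LSeries.term (fun n => χ n) 0 n * tri a (Real.log n) =
      ∑ n ∈ Finset.Icc 1 N, χ n * tri a (Real.log n) := by
    intro a ha haA
    rw [tsum_eq_sum (s := Finset.Icc 1 N)]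
    · apply Finset.sum_congr rfl
      intro n hn
      have : n ≠ 0 := by have := (Finset.mem_Icc.1 hn).1; omega
      rw [LSeries.term_of_ne_zero this]
      simp
    · intro n hn
      by_cases h0 : n = 0
      · simp [h0]
      · have h2 : N + 1 ≤ n := by
          rw [Finset.mem_Icc] at hn; omega
        have h2' : (N:ℝ) + 1 ≤ n := by exact_mod_cast h2
        have h3 : Real.log ((N:ℝ)+1) ≤ Real.log n := Real.log_le_log (by linarith) h2'
        rw [tri_eq_zero ha (by rw [abs_of_nonneg (by linarith)]; linarith)]
        simp
  rw [hfin _ hA le_rfl] at eA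
  rw [hfin _ hB (by linarith)] at eB
  have hAB : ((Real.log ((N:ℝ)+1) - Real.log N : ℝ) : ℂ) ≠ 0 := by
    have : Real.log ((N:ℝ)+1) - Real.log N ≠ 0 := by linarith
    exact_mod_cast this
  have e1 : ∀ τ : ℝ, DirichletCharacter.LFunction χ (c + τ * I) * Kn N (c + τ * I) =
      (Real.log ((N:ℝ)+1) / (Real.log ((N:ℝ)+1) - Real.log N : ℝ) : ℂ) * (DirichletCharacter.LFunction χ (c + τ * I) * Fk (Real.log ((N:ℝ)+1)) (c + τ * I))
      - (Real.log N / (Real.log ((N:ℝ)+1) - Real.log N : ℝ) : ℂ) * (DirichletCharacter.LFunction χ (c + τ * I) * Fk (Real.log N) (c + τ * I)) := by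
    intro τ
    unfold Kn
    ring
  simp_rw [e1]
  rw [MeasureTheory.integral_sub (iA.const_mul _) (iB.const_mul _), MeasureTheory.integral_const_mul, MeasureTheory.integral_const_mul, eA, eB]
  have e2 : ∑ n ∈ Finset.Icc 1 N, χ n = ∑ n ∈ Finset.Icc 1 N, χ n * (((Real.log (N+1) * tri (Real.log (N+1)) (Real.log n) - Real.log N * tri (Real.log N) (Real.log n) : ℝ) : ℂ) / ((Real.log ((N:ℝ)+1) - Real.log N : ℝ) : ℂ)) := by
    apply Finset.sum_congr rfl
    intro n hn
    rw [Finset.mem_Icc] at hn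
    rw [trap_eq hN hn.1, if_pos hn.2, mul_one, div_self hAB, mul_one]
  rw [e2]
  simp only [Finset.mul_sum]
  rw [← Finset.sum_sub_distrib]
  apply Finset.sum_congr rfl
  intro n hn
  push_cast
  ring


lemma L_cont {q : ℕ} [NeZero q] (χ : DirichletCharacter ℂ q) (hχ : χ ≠ 1) (c : ℝ) :
    Continuous (fun τ : ℝ => ‖DirichletCharacter.LFunction χ ⟨c, τ⟩‖) := by
  have h := (DirichletCharacter.differentiable_LFunction hχ).continuous
  have e : (fun τ : ℝ => ‖DirichletCharacter.LFunction χ ⟨c, τ⟩‖) = fun τ : ℝ => ‖DirichletCharacter.LFunction χ (c + τ * I)‖ := by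
    funext τ
    congr 2
    apply Complex.ext <;> simp
  rw [e]
  fun_prop

lemma S_bound : ∃ C6 : ℝ, 0 < C6 ∧ ∀ (q : ℕ) [NeZero q] (χ : DirichletCharacter ℂ q), χ ≠ 1 → dirichletRH χ →
      ∀ c : ℝ, 1/2 < c → c ≤ 3/4 → ∀ N : ℕ, 2 ≤ N → N ≤ q →
      ‖∑ n ∈ Finset.Icc 1 N, χ n‖ ≤ ((N:ℝ)+1)^c *
        ((∫ τ in Set.Icc (-(q:ℝ)^4) ((q:ℝ)^4), ‖DirichletCharacter.LFunction χ ⟨c, τ⟩‖ * (1 + |τ|)⁻¹) + C6) := by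
  obtain ⟨C4, hC4, hline⟩ := L_line_bound
  set J : ℝ := ∫ τ : ℝ, (144 * C4) * (1 + |τ|) ^ (-(5/4):ℝ) with hJ
  have hJ0 : 0 ≤ J := MeasureTheory.integral_nonneg (fun τ => by
    show 0 ≤ (144 * C4) * (1 + |τ|) ^ (-(5/4):ℝ)
    positivity)
  refine ⟨J + 1, by linarith, ?_⟩
  intro q _ χ hχ hRH c hc hc' N hN hNq
  have hN' : (2:ℝ) ≤ N := by exact_mod_cast hN
  have hNq' : (N:ℝ) ≤ q := by exact_mod_cast hNq
  have hq1 : 1 ≤ q := by omega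
  have hp := perron hC4 hline χ hχ hRH hc hc' hN
  set W : ℝ := ((N:ℝ)+1)^c with hW
  have hW0 : 0 < W := by positivity
  set T : ℝ := (q:ℝ)^4 with hT
  have hcont := L_cont χ hχ c
  set g : ℝ → ℝ := fun τ => ‖DirichletCharacter.LFunction χ ⟨c, τ⟩‖ * (1 + |τ|)⁻¹ with hg
  have hgc : Continuous g := by
    refine hcont.mul (Continuous.inv₀ (by fun_prop) (fun τ => by positivity))
  have hgi : MeasureTheory.IntegrableOn g (Set.Icc (-T) T) := hgc.integrableOn_Icc
  have hgi' : MeasureTheory.Integrable ((Set.Icc (-T) T).indicator g) := hgi.integrable_indicator measurableSet_Icc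
  have hti := integrable_pow_aux (r := 5/4) (by norm_num) (144 * C4)
  have hpt : ∀ τ : ℝ, ‖DirichletCharacter.LFunction χ (c + τ * I) * Kn N (c + τ * I)‖ ≤
      W * (6 * (Set.Icc (-T) T).indicator g τ + (144 * C4) * (1 + |τ|) ^ (-(5/4):ℝ)) := by
    intro τ
    have e : (c:ℂ) + τ * I = ⟨c, τ⟩ := by apply Complex.ext <;> simp
    obtain ⟨k1, k2⟩ := Kn_bound hN hc τ
    rw [norm_mul]
    have hpos : 0 < 1 + |τ| := by positivity
    by_cases hτ : τ ∈ Set.Icc (-T) T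
    · rw [Set.indicator_of_mem hτ]
      have h0 : 0 ≤ (144 * C4) * (1 + |τ|) ^ (-(5/4):ℝ) := by positivity
      calc _ ≤ ‖DirichletCharacter.LFunction χ (c + τ * I)‖ * (6 * W / (1 + |τ|)) := by gcongr
        _ = W * (6 * g τ) := by rw [hg, e]; simp only [div_eq_mul_inv]; ring
        _ ≤ _ := by gcongr; linarith
    · rw [Set.indicator_of_notMem hτ]
      have hTτ : T ≤ |τ| := by
        by_contra h
        push Not at h
        exact hτ (abs_le.1 h.le)
      have hq2 : (q:ℝ)^2 ≤ (1 + |τ|) ^ (1/2:ℝ) := by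
        have : (q:ℝ)^2 = (T) ^ (1/2:ℝ) := by
          rw [hT, ← Real.sqrt_eq_rpow, show (q:ℝ)^4 = ((q:ℝ)^2)^2 by ring, Real.sqrt_sq (by positivity)]
        rw [this]
        apply Real.rpow_le_rpow (by positivity) (by linarith) (by norm_num)
      have hL := (hline q χ hχ hRH c hc hc' τ).trans (mul_le_mul_of_nonneg_left (QQ_quarter hq1 τ) hC4.le)
      rw [← e] at hL
      calc _ ≤ (C4 * (2 * q * (1 + |τ|) ^ (1/4:ℝ))) * (36 * W * (N+1) / (1 + |τ|)^2) := by gcongr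
        _ ≤ (C4 * (2 * q * (1 + |τ|) ^ (1/4:ℝ))) * (36 * W * (2 * q) / (1 + |τ|)^2) := by gcongr; linarith
        _ = W * (144 * C4) * ((1 + |τ|) ^ (1/4:ℝ) * ((1 + |τ|)^2)⁻¹) * (q:ℝ)^2 := by
          simp only [div_eq_mul_inv]; ring
        _ ≤ W * (144 * C4) * ((1 + |τ|) ^ (1/4:ℝ) * ((1 + |τ|)^2)⁻¹) * (1 + |τ|) ^ (1/2:ℝ) := by gcongr
        _ = W * (144 * C4) * ((1 + |τ|) ^ (1/4:ℝ) * (1 + |τ|)^(-2:ℝ) * (1 + |τ|) ^ (1/2:ℝ)) := by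
          rw [Real.rpow_neg hpos.le, show (2:ℝ) = ((2:ℕ):ℝ) by norm_num, Real.rpow_natCast]; norm_num; ring
        _ = W * (144 * C4) * (1 + |τ|) ^ (-(5/4):ℝ) := by
          rw [← Real.rpow_add hpos, ← Real.rpow_add hpos]; norm_num
        _ = _ := by ring
  have h1 := MeasureTheory.norm_integral_le_of_norm_le ((hgi'.const_mul 6 |>.add hti).const_mul W) (MeasureTheory.ae_of_all _ hpt)
  rw [← hp, norm_mul] at h1
  simp only [Pi.add_apply] at h1
  rw [MeasureTheory.integral_const_mul, MeasureTheory.integral_add (hgi'.const_mul 6) hti, MeasureTheory.integral_const_mul,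
    MeasureTheory.integral_indicator measurableSet_Icc] at h1
  have h2 : ‖(2 * π : ℂ)‖ = 2 * π := by
    rw [norm_mul, Complex.norm_real, Real.norm_of_nonneg Real.pi_pos.le]; simp
  rw [h2] at h1
  have h3 : 0 ≤ ∫ τ in Set.Icc (-T) T, g τ := MeasureTheory.integral_nonneg (fun τ => by
    show 0 ≤ ‖DirichletCharacter.LFunction χ ⟨c, τ⟩‖ * (1 + |τ|)⁻¹
    positivity)
  have hpi := Real.pi_gt_three
  have h4 : (6:ℝ) * ‖∑ n ∈ Finset.Icc 1 N, χ n‖ ≤ 6 * (W * ((∫ τ in Set.Icc (-T) T, g τ) + (J+1))) := by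
    have h5 : (6:ℝ) * ‖∑ n ∈ Finset.Icc 1 N, χ n‖ ≤ 2 * π * ‖∑ n ∈ Finset.Icc 1 N, χ n‖ := by
      gcongr; linarith
    refine h5.trans (h1.trans ?_)
    rw [← hJ, show 6 * (W * ((∫ τ in Set.Icc (-T) T, g τ) + (J+1))) = W * (6 * (∫ τ in Set.Icc (-T) T, g τ) + 6 * (J+1)) by ring]
    gcongr
    linarith
  linarith

lemma weight_int {T : ℝ} (hT : 0 ≤ T) : ∫ τ in Set.Icc (-T) T, (1 + |τ|)⁻¹ = 2 * Real.log (1 + T) := by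
  rw [MeasureTheory.integral_Icc_eq_integral_Ioc, ← intervalIntegral.integral_of_le (by linarith)]
  have hc : Continuous (fun τ : ℝ => (1 + |τ|)⁻¹) := Continuous.inv₀ (by fun_prop) (fun τ => by positivity)
  rw [← intervalIntegral.integral_add_adjacent_intervals (b := 0) (hc.intervalIntegrable _ _) (hc.intervalIntegrable _ _)]
  have h1 : ∫ τ in (0:ℝ)..T, (1 + |τ|)⁻¹ = Real.log (1 + T) := by
    rw [intervalIntegral.integral_eq_sub_of_hasDerivAt (f := fun x => Real.log (1 + x)) _ (hc.intervalIntegrable _ _)]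
    · simp
    · intro x hx
      rw [Set.uIcc_of_le hT] at hx
      have h := ((hasDerivAt_id x).const_add 1).log (by have := hx.1; simp; linarith)
      simpa [abs_of_nonneg hx.1] using h
  have h2 : ∫ τ in (-T)..(0:ℝ), (1 + |τ|)⁻¹ = Real.log (1 + T) := by
    rw [← h1]
    have := intervalIntegral.integral_comp_neg (a := 0) (b := T) (fun τ : ℝ => (1 + |τ|)⁻¹)
    simp only [abs_neg, neg_zero] at this
    exact this.symm
  rw [h1, h2]; ring

lemma holder_weight {T p : ℝ} (hT : 0 ≤ T) (hp : 1 < p) {f : ℝ → ℝ} (hf : Continuous f) (hf0 : ∀ x, 0 ≤ f x) :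
    (∫ τ in Set.Icc (-T) T, f τ * (1 + |τ|)⁻¹) ^ p ≤
      (2 * Real.log (1 + T)) ^ (p - 1) * ∫ τ in Set.Icc (-T) T, f τ ^ p * (1 + |τ|)⁻¹ := by
  have hpq := Real.HolderConjugate.conjExponent hp
  set r := p.conjExponent with hr
  have hr0 := hpq.symm.pos
  have hp0 := hpq.pos
  have hmem : ∀ (g : ℝ → ℝ) (s : ENNReal), Continuous g → MeasureTheory.MemLp g s (MeasureTheory.volume.restrict (Set.Icc (-T) T)) := by
    intro g s hg
    obtain ⟨C, hC⟩ := isCompact_Icc.exists_bound_of_continuousOn (s := Set.Icc (-T) T) hg.continuousOn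
    exact MeasureTheory.MemLp.of_bound hg.aestronglyMeasurable C
      (MeasureTheory.ae_restrict_of_forall_mem measurableSet_Icc hC)
  have hw : Continuous (fun τ : ℝ => 1 + |τ|) := by fun_prop
  have hwp : ∀ e : ℝ, Continuous (fun τ : ℝ => (1 + |τ|) ^ e) := fun e =>
    hw.rpow_const (fun τ => Or.inl (by positivity))
  have h := MeasureTheory.integral_mul_le_Lp_mul_Lq_of_nonneg (μ := MeasureTheory.volume.restrict (Set.Icc (-T) T)) hpq
    (f := fun τ => f τ * (1 + |τ|) ^ (-(1/p))) (g := fun τ => (1 + |τ|) ^ (-(1/r)))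
    (MeasureTheory.ae_of_all _ (fun τ => mul_nonneg (hf0 τ) (by positivity)))
    (MeasureTheory.ae_of_all _ (fun τ => by show 0 ≤ (1 + |τ|) ^ (-(1/r)); positivity))
    (hmem _ _ (hf.mul (hwp _))) (hmem _ _ (hwp _))
  have e1 : ∀ τ : ℝ, f τ * (1 + |τ|) ^ (-(1/p)) * (1 + |τ|) ^ (-(1/r)) = f τ * (1 + |τ|)⁻¹ := by
    intro τ
    rw [mul_assoc, ← Real.rpow_add (by positivity), show -(1/p) + -(1/r) = -1 by
      have := hpq.inv_add_inv_eq_one; simp only [one_div]; linarith, Real.rpow_neg_one]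
  have e2 : ∀ τ : ℝ, (f τ * (1 + |τ|) ^ (-(1/p))) ^ p = f τ ^ p * (1 + |τ|)⁻¹ := by
    intro τ
    rw [Real.mul_rpow (hf0 τ) (by positivity), ← Real.rpow_mul (by positivity),
      show -(1/p) * p = -1 by field_simp, Real.rpow_neg_one]
  have e3 : ∀ τ : ℝ, ((1 + |τ|) ^ (-(1/r))) ^ r = (1 + |τ|)⁻¹ := by
    intro τ
    rw [← Real.rpow_mul (by positivity), show -(1/r) * r = -1 by field_simp, Real.rpow_neg_one]
  simp only [e1, e2, e3] at h
  rw [weight_int hT] at h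
  have hX : 0 ≤ ∫ τ in Set.Icc (-T) T, f τ * (1 + |τ|)⁻¹ := MeasureTheory.integral_nonneg (fun τ => mul_nonneg (hf0 τ) (by positivity))
  have hY : 0 ≤ ∫ τ in Set.Icc (-T) T, f τ ^ p * (1 + |τ|)⁻¹ := MeasureTheory.integral_nonneg (fun τ => mul_nonneg (Real.rpow_nonneg (hf0 τ) _) (by positivity))
  have hZ : 0 ≤ 2 * Real.log (1 + T) := mul_nonneg (by norm_num) (Real.log_nonneg (by linarith))
  have h' := Real.rpow_le_rpow hX h hp0.le
  rw [Real.mul_rpow (by positivity) (by positivity), ← Real.rpow_mul hY, ← Real.rpow_mul hZ,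
    show 1 / p * p = 1 by field_simp, Real.rpow_one,
    show 1 / r * p = p - 1 by
      have := hpq.inv_add_inv_eq_one
      have h3 : 1 / r = 1 - 1/p := by simp only [one_div]; linarith
      rw [h3]; field_simp] at h'
  linarith


lemma card_char {q : ℕ} [NeZero q] (hq : 1 < q) : ((Finset.univ : Finset (DirichletCharacter ℂ q)).card : ℝ) ≤ Nat.totient q := by
  have := low_moment (q := q) 0 0 (by simpa using hq)
  simpa using this

lemma high_range {K : ℝ} (hK : 1 < K) : ∃ C : ℝ, 0 < C ∧ ∃ q0 : ℕ, ∀ (q : ℕ) [NeZero q], q0 ≤ q →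
    (∀ χ : DirichletCharacter ℂ q, dirichletRH χ) → ∀ N : ℕ, 2 ≤ N → N ≤ q → 4 ≤ Real.log q ∧
    ∑ χ ∈ Finset.univ.filter (fun χ : DirichletCharacter ℂ q => χ ≠ 1), ‖∑ n ∈ Finset.Icc 1 N, χ n‖ ^ K ≤
      C * Nat.totient q * (N:ℝ) ^ (K/2) * Real.log q ^ (K^2/4 + 1 + K) := by
  obtain ⟨C6, hC6, hS⟩ := S_bound
  obtain ⟨C3, hC3, q0, hmom⟩ := L_moment hK.le
  refine ⟨16 ^ K * 2 ^ K * (10 ^ K * C3 + C6 ^ K), by positivity, q0, ?_⟩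
  intro q _ hq hRH N hN hNq
  have h4 : 4 ≤ Real.log q := (hmom q hq hRH 0 (by rw [abs_zero]; positivity)).1
  refine ⟨h4, ?_⟩
  set ℓ := Real.log q with hℓ
  have hℓ0 : 0 < ℓ := by linarith
  have hN' : (2:ℝ) ≤ N := by exact_mod_cast hN
  have hNq' : (N:ℝ) ≤ q := by exact_mod_cast hNq
  have hq2 : (2:ℝ) ≤ q := by linarith
  have hqe : (q:ℝ) = Real.exp ℓ := by rw [hℓ, Real.exp_log (by linarith)]
  set c : ℝ := 1/2 + 1/ℓ with hc
  have hc1 : 1/2 < c := by have : 0 < 1/ℓ := by positivity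
                           linarith
  have hc2 : c ≤ 3/4 := by
    have : 1/ℓ ≤ 1/4 := by gcongr
    linarith
  set T : ℝ := (q:ℝ)^4 with hT
  have hT0 : 0 ≤ T := by positivity
  have hW : ((N:ℝ)+1)^c ≤ 16 * (N:ℝ)^(1/2:ℝ) := by
    rw [hc, Real.rpow_add (by positivity)]
    have a1 : ((N:ℝ)+1)^(1/2:ℝ) ≤ 2 * (N:ℝ)^(1/2:ℝ) := by
      calc ((N:ℝ)+1)^(1/2:ℝ) ≤ (4 * N)^(1/2:ℝ) := by gcongr; linarith
        _ = 4 ^ (1/2:ℝ) * (N:ℝ)^(1/2:ℝ) := by rw [Real.mul_rpow (by norm_num) (by positivity)]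
        _ = 2 * (N:ℝ)^(1/2:ℝ) := by
          rw [← Real.sqrt_eq_rpow 4, show (4:ℝ) = 2^2 by norm_num, Real.sqrt_sq (by norm_num)]
    have a2 : ((N:ℝ)+1)^(1/ℓ) ≤ 8 := by
      calc ((N:ℝ)+1)^(1/ℓ) ≤ ((q:ℝ)^2)^(1/ℓ) := by gcongr; nlinarith
        _ = Real.exp 2 := by
          rw [hqe, ← Real.exp_nat_mul, ← Real.exp_mul]; congr 1; push_cast; field_simp
        _ = Real.exp 1 ^ 2 := by rw [← Real.exp_nat_mul]; norm_num
        _ ≤ 8 := by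
          have := Real.exp_one_lt_d9
          have := Real.exp_pos 1
          nlinarith
    calc _ ≤ (2 * (N:ℝ)^(1/2:ℝ)) * 8 := by gcongr
      _ = _ := by ring
  set X : DirichletCharacter ℂ q → ℝ := fun χ => ∫ τ in Set.Icc (-T) T, ‖DirichletCharacter.LFunction χ ⟨c, τ⟩‖ * (1 + |τ|)⁻¹ with hX
  have hX0 : ∀ χ, 0 ≤ X χ := fun χ => MeasureTheory.integral_nonneg (fun τ => by
    show 0 ≤ ‖DirichletCharacter.LFunction χ ⟨c, τ⟩‖ * (1 + |τ|)⁻¹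
    positivity)
  have hH : 2 * Real.log (1 + T) ≤ 10 * ℓ := by
    have : Real.log (1 + T) ≤ Real.log ((q:ℝ)^5) := by
      apply Real.log_le_log (by positivity)
      have h1 : (1:ℝ) ≤ (q:ℝ)^4 := one_le_pow₀ (by linarith)
      rw [hT, pow_succ]
      nlinarith
    rw [Real.log_pow] at this
    push_cast at this
    linarith
  have hH0 : 0 < 2 * Real.log (1 + T) := by
    have : 0 < T := by positivity
    exact mul_pos (by norm_num) (Real.log_pos (by linarith))
  set F := Finset.univ.filter (fun χ : DirichletCharacter ℂ q => χ ≠ 1) with hF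
  have hXK : ∑ χ ∈ F, X χ ^ K ≤ 10 ^ K * C3 * Nat.totient q * ℓ ^ (K^2/4 + 1 + K) := by
    have hcw : Continuous (fun τ : ℝ => (1 + |τ|)⁻¹) := Continuous.inv₀ (by fun_prop) (fun τ => by positivity)
    have hci : ∀ χ ∈ F, MeasureTheory.Integrable (fun τ : ℝ => ‖DirichletCharacter.LFunction χ ⟨c, τ⟩‖ ^ K * (1 + |τ|)⁻¹)
        (MeasureTheory.volume.restrict (Set.Icc (-T) T)) := by
      intro χ hχ
      have hχ' : χ ≠ 1 := (Finset.mem_filter.1 hχ).2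
      exact (((L_cont χ hχ' c).rpow_const (fun _ => Or.inr (by linarith))).mul hcw).integrableOn_Icc
    calc ∑ χ ∈ F, X χ ^ K ≤ ∑ χ ∈ F, (2 * Real.log (1 + T)) ^ (K - 1) * ∫ τ in Set.Icc (-T) T, ‖DirichletCharacter.LFunction χ ⟨c, τ⟩‖ ^ K * (1 + |τ|)⁻¹ := by
          apply Finset.sum_le_sum
          intro χ hχ
          have hχ' : χ ≠ 1 := (Finset.mem_filter.1 hχ).2
          exact holder_weight hT0 hK (L_cont χ hχ' c) (fun _ => norm_nonneg _)
      _ = (2 * Real.log (1 + T)) ^ (K - 1) * ∫ τ in Set.Icc (-T) T, ∑ χ ∈ F, ‖DirichletCharacter.LFunction χ ⟨c, τ⟩‖ ^ K * (1 + |τ|)⁻¹ := by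
          rw [← Finset.mul_sum, MeasureTheory.integral_finsetSum _ hci]
      _ ≤ (2 * Real.log (1 + T)) ^ (K - 1) * ∫ τ in Set.Icc (-T) T, (C3 * Nat.totient q * ℓ ^ (K^2/4+1)) * (1 + |τ|)⁻¹ := by
          refine mul_le_mul_of_nonneg_left ?_ (by positivity)
          refine MeasureTheory.setIntegral_mono_on (MeasureTheory.integrable_finsetSum _ hci) ((hcw.integrableOn_Icc).const_mul _) measurableSet_Icc ?_
          intro τ hτ
          rw [← Finset.sum_mul]
          have := (hmom q hq hRH τ (abs_le.2 hτ)).2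
          gcongr
      _ = (2 * Real.log (1 + T)) ^ (K - 1) * (2 * Real.log (1 + T)) * (C3 * Nat.totient q * ℓ ^ (K^2/4+1)) := by
          rw [MeasureTheory.integral_const_mul, weight_int hT0]; ring
      _ = (2 * Real.log (1 + T)) ^ K * (C3 * Nat.totient q * ℓ ^ (K^2/4+1)) := by
          rw [← Real.rpow_add_one hH0.ne', sub_add_cancel]
      _ ≤ (10 * ℓ) ^ K * (C3 * Nat.totient q * ℓ ^ (K^2/4+1)) := by gcongr
      _ = _ := by
          rw [Real.mul_rpow (by norm_num) hℓ0.le, Real.rpow_add hℓ0 (K^2/4+1) K]; ring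
  have hcard : (F.card : ℝ) ≤ Nat.totient q := by
    refine le_trans ?_ (card_char (q := q) (by omega))
    exact_mod_cast Finset.card_filter_le _ _
  have hNK : (16 * (N:ℝ)^(1/2:ℝ)) ^ K = 16 ^ K * (N:ℝ)^(K/2) := by
    rw [Real.mul_rpow (by norm_num) (by positivity), ← Real.rpow_mul (by positivity)]
    congr 2; ring
  have hone : 1 ≤ ℓ ^ (K^2/4 + 1 + K) := Real.one_le_rpow (by linarith) (by positivity)
  calc _ ≤ ∑ χ ∈ F, (16 ^ K * (N:ℝ)^(K/2)) * (2 ^ K * (X χ ^ K + C6 ^ K)) := by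
        apply Finset.sum_le_sum
        intro χ hχ
        have hχ' : χ ≠ 1 := (Finset.mem_filter.1 hχ).2
        have h1 := hS q χ hχ' (hRH χ) c hc1 hc2 N hN hNq
        have h2 : (X χ + C6) ^ K ≤ 2 ^ K * (X χ ^ K + C6 ^ K) := by
          have h3 : X χ + C6 ≤ 2 * max (X χ) C6 := by
            have := le_max_left (X χ) C6
            have := le_max_right (X χ) C6
            linarith
          have h5 : 0 ≤ X χ ^ K := Real.rpow_nonneg (hX0 χ) _
          have h6 : 0 ≤ C6 ^ K := by positivity
          calc (X χ + C6) ^ K ≤ (2 * max (X χ) C6) ^ K :=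
                Real.rpow_le_rpow (by have := hX0 χ; linarith) h3 (by linarith)
            _ = 2 ^ K * (max (X χ) C6) ^ K := by rw [Real.mul_rpow (by norm_num) (le_max_of_le_right hC6.le)]
            _ ≤ _ := by
              refine mul_le_mul_of_nonneg_left ?_ (by positivity)
              rcases max_choice (X χ) C6 with h | h <;> rw [h] <;> linarith
        calc _ ≤ ((16 * (N:ℝ)^(1/2:ℝ)) * (X χ + C6)) ^ K := by
              refine Real.rpow_le_rpow (norm_nonneg _) (h1.trans ?_) (by linarith)
              exact mul_le_mul_of_nonneg_right hW (by have := hX0 χ; linarith)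
          _ = (16 ^ K * (N:ℝ)^(K/2)) * (X χ + C6) ^ K := by
              rw [Real.mul_rpow (by positivity) (by have := hX0 χ; linarith), hNK]
          _ ≤ _ := by gcongr
    _ = (16 ^ K * (N:ℝ)^(K/2)) * (2 ^ K * (∑ χ ∈ F, X χ ^ K + F.card * C6 ^ K)) := by
        rw [← Finset.mul_sum, ← Finset.mul_sum, Finset.sum_add_distrib, Finset.sum_const, nsmul_eq_mul]
    _ ≤ (16 ^ K * (N:ℝ)^(K/2)) * (2 ^ K * (10 ^ K * C3 * Nat.totient q * ℓ ^ (K^2/4 + 1 + K) + (Nat.totient q * C6 ^ K) * ℓ ^ (K^2/4 + 1 + K))) := by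
        have : F.card * C6 ^ K ≤ (Nat.totient q * C6 ^ K) * ℓ ^ (K^2/4 + 1 + K) := by
          calc F.card * C6 ^ K ≤ Nat.totient q * C6 ^ K * 1 := by rw [mul_one]; gcongr
            _ ≤ _ := by gcongr
        gcongr
    _ = _ := by ring

lemma low_range {m : ℝ} (hm : 0 < m) {M : ℕ} (hmM : m ≤ M) {q : ℕ} [NeZero q] (hq : 1 < q) {N : ℕ} (hN1 : 1 ≤ N) (hN : N ^ M < q) :
    ∑ χ : DirichletCharacter ℂ q, ‖∑ n ∈ Finset.Icc 1 N, χ n‖ ^ (2 * m) ≤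
      2 * Nat.totient q * ((N:ℝ) ^ m * (1 + Real.log N) ^ (M * m)) := by
  have hN1' : (1:ℝ) ≤ N := by exact_mod_cast hN1
  have hM : 0 < (M:ℝ) := by linarith
  have hlog : 0 ≤ Real.log N := Real.log_nonneg hN1'
  have h := low_moment (q := q) M N hN
  set V : ℝ := ((N : ℝ) * (1 + Real.log N) ^ M) ^ M with hV
  have hV0 : 0 < V := by positivity
  set θ : ℝ := m / M with hθ
  have hθ0 : 0 < θ := by positivity
  have hθ1 : θ ≤ 1 := by rw [hθ, div_le_one hM]; exact hmM
  have hVθ : V ^ θ = (N:ℝ) ^ m * (1 + Real.log N) ^ (M * m) := by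
    rw [hV, ← Real.rpow_natCast _ M, ← Real.rpow_mul (by positivity), hθ,
      show (M:ℝ) * (m / M) = m by field_simp, Real.mul_rpow (by positivity) (by positivity),
      ← Real.rpow_natCast _ M, ← Real.rpow_mul (by positivity)]
  have hyoung : ∀ x : ℝ, 0 ≤ x → x ^ θ ≤ V ^ θ + x * V ^ (θ - 1) := by
    intro x hx
    by_cases hxV : x ≤ V
    · have : x ^ θ ≤ V ^ θ := by gcongr
      have h2 : 0 ≤ x * V ^ (θ - 1) := by positivity
      linarith
    · push Not at hxV
      have hx0 : 0 < x := hV0.trans hxV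
      have h1 : x ^ θ = x * x ^ (θ - 1) := by
        rw [mul_comm, ← Real.rpow_add_one hx0.ne', sub_add_cancel]
      have h2 : x ^ (θ - 1) ≤ V ^ (θ - 1) := Real.rpow_le_rpow_of_nonpos hV0 hxV.le (by linarith)
      have h3 : 0 ≤ V ^ θ := by positivity
      rw [h1]
      nlinarith
  calc _ ≤ ∑ χ : DirichletCharacter ℂ q, (V ^ θ + ‖∑ n ∈ Finset.Icc 1 N, χ n‖ ^ (2 * M) * V ^ (θ - 1)) := by
        apply Finset.sum_le_sum
        intro χ _
        have := hyoung (‖∑ n ∈ Finset.Icc 1 N, χ n‖ ^ (2 * M)) (by positivity)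
        refine le_trans (le_of_eq ?_) this
        rw [← Real.rpow_natCast _ (2 * M), ← Real.rpow_mul (norm_nonneg _), hθ]
        congr 1
        push_cast
        field_simp
    _ = (Finset.univ : Finset (DirichletCharacter ℂ q)).card * V ^ θ + (∑ χ : DirichletCharacter ℂ q, ‖∑ n ∈ Finset.Icc 1 N, χ n‖ ^ (2 * M)) * V ^ (θ - 1) := by
        rw [Finset.sum_add_distrib, Finset.sum_const, nsmul_eq_mul, Finset.sum_mul]
    _ ≤ Nat.totient q * V ^ θ + (Nat.totient q * V) * V ^ (θ - 1) := by
        have := card_char hq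
        gcongr
    _ = Nat.totient q * V ^ θ + Nat.totient q * V ^ θ := by
        rw [mul_assoc, mul_comm V, ← Real.rpow_add_one hV0.ne', sub_add_cancel]
    _ = _ := by rw [hVθ]; ring

open Classical in
theorem stmt19 (k : ℝ) (hk : 2 < k) :
    ∃ C : ℝ, 0 < C ∧ ∃ q0 : ℕ, ∀ (q : ℕ) [NeZero q], q0 ≤ q →
      (∀ χ : DirichletCharacter ℂ q, dirichletRH χ) →
      ∀ y : ℝ, 10 ≤ y → y ≤ (q : ℝ) →
        ∑ χ ∈ Finset.univ.filter (fun χ : DirichletCharacter ℂ q => χ.IsPrimitive),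
            ‖∑ n ∈ Finset.Icc 1 ⌊y⌋₊, χ n‖ ^ (4 * k - 2)
          ≤ C * y ^ (2 * k - 1) * (Nat.totient q) * Real.log y ^ (4 * k ^ 2) := by
  set m : ℝ := 2 * k - 1 with hm
  have hm0 : 0 < m := by linarith
  set M : ℕ := ⌈m⌉₊ with hM
  have hmM : m ≤ M := Nat.le_ceil m
  have hMm : (M:ℝ) < m + 1 := Nat.ceil_lt_add_one hm0.le
  have hM0 : 0 < (M:ℝ) := by linarith
  obtain ⟨C, hC, q0, hhigh⟩ := high_range (K := 4 * k - 2) (by linarith)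
  refine ⟨2 * 2 ^ (4 * k ^ 2) + C * M ^ (4 * k ^ 2), by positivity, q0, ?_⟩
  intro q _ hq hRH y hy hyq
  set N : ℕ := ⌊y⌋₊ with hN
  have hNy : (N:ℝ) ≤ y := Nat.floor_le (by linarith)
  have hN10 : 10 ≤ N := Nat.le_floor (by exact_mod_cast hy)
  have hNq : N ≤ q := by exact_mod_cast hNy.trans hyq
  have hN10' : (10:ℝ) ≤ N := by exact_mod_cast hN10
  have hly : 1 ≤ Real.log y := by
    rw [Real.le_log_iff_exp_le (by linarith)]
    have := Real.exp_one_lt_d9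
    linarith
  have hlN : Real.log N ≤ Real.log y := Real.log_le_log (by linarith) hNy
  have hlN0 : 0 ≤ Real.log N := Real.log_nonneg (by linarith)
  have hmain : 0 ≤ y ^ m * (Nat.totient q) * Real.log y ^ (4 * k ^ 2) := by positivity
  by_cases hlow : N ^ M < q
  · have h := low_range hm0 hmM (q := q) (by omega) (by omega : 1 ≤ N) hlow
    have e : 2 * m = 4 * k - 2 := by rw [hm]; ring
    rw [e] at h
    have h2 : (1 + Real.log N) ^ (M * m) ≤ 2 ^ (4 * k ^ 2) * Real.log y ^ (4 * k ^ 2) := by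
      calc (1 + Real.log N) ^ (M * m) ≤ (1 + Real.log N) ^ (4 * k ^ 2) := by
            apply Real.rpow_le_rpow_of_exponent_le (by linarith)
            have : M * m ≤ (m + 1) * m := by gcongr
            nlinarith
        _ ≤ (2 * Real.log y) ^ (4 * k ^ 2) := by gcongr; linarith
        _ = _ := by rw [Real.mul_rpow (by norm_num) (by linarith)]
    calc _ ≤ ∑ χ : DirichletCharacter ℂ q, ‖∑ n ∈ Finset.Icc 1 N, χ n‖ ^ (4 * k - 2) := by
          apply Finset.sum_le_sum_of_subset_of_nonneg (Finset.filter_subset _ _)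
          intros; positivity
      _ ≤ _ := h
      _ ≤ 2 * Nat.totient q * (y ^ m * (2 ^ (4 * k ^ 2) * Real.log y ^ (4 * k ^ 2))) := by gcongr
      _ = (2 * 2 ^ (4 * k ^ 2)) * (y ^ m * (Nat.totient q) * Real.log y ^ (4 * k ^ 2)) := by ring
      _ ≤ (2 * 2 ^ (4 * k ^ 2) + C * M ^ (4 * k ^ 2)) * (y ^ m * (Nat.totient q) * Real.log y ^ (4 * k ^ 2)) := by
          gcongr
          have : 0 ≤ C * (M:ℝ) ^ (4 * k ^ 2) := by positivity
          linarith
      _ = _ := by ring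
  · push Not at hlow
    obtain ⟨h4, h⟩ := hhigh q hq hRH N (by omega) hNq
    have hlq : Real.log q ≤ M * Real.log y := by
      have h1 : Real.log q ≤ Real.log ((N:ℝ) ^ M) :=
        Real.log_le_log (by linarith) (by exact_mod_cast hlow)
      rw [Real.log_pow] at h1
      exact h1.trans (by gcongr)
    have e1 : (4 * k - 2) ^ 2 / 4 + 1 + (4 * k - 2) = 4 * k ^ 2 := by ring
    have e2 : (4 * k - 2) / 2 = m := by rw [hm]; ring
    rw [e1, e2] at h
    calc _ ≤ ∑ χ ∈ Finset.univ.filter (fun χ : DirichletCharacter ℂ q => χ ≠ 1), ‖∑ n ∈ Finset.Icc 1 N, χ n‖ ^ (4 * k - 2) := by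
          apply Finset.sum_le_sum_of_subset_of_nonneg
          · intro χ hχ
            rw [Finset.mem_filter] at hχ ⊢
            refine ⟨hχ.1, fun h1 => ?_⟩
            have h2 := hχ.2
            rw [h1, DirichletCharacter.isPrimitive_def, DirichletCharacter.conductor_one] at h2
            omega
          · intros; positivity
      _ ≤ C * Nat.totient q * (N:ℝ) ^ m * Real.log q ^ (4 * k ^ 2) := by convert h
      _ ≤ C * Nat.totient q * y ^ m * (M * Real.log y) ^ (4 * k ^ 2) := by gcongr
      _ = (C * M ^ (4 * k ^ 2)) * (y ^ m * (Nat.totient q) * Real.log y ^ (4 * k ^ 2)) := by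
          rw [Real.mul_rpow hM0.le (by linarith)]; ring
      _ ≤ (2 * 2 ^ (4 * k ^ 2) + C * M ^ (4 * k ^ 2)) * (y ^ m * (Nat.totient q) * Real.log y ^ (4 * k ^ 2)) := by
          gcongr
          have : (0:ℝ) ≤ 2 * 2 ^ (4 * k ^ 2) := by positivity
          linarith
      _ = _ := by ring
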